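/- arXiv:math/9902035 — 3 statements merged into one kernel-verified Lean document; each statement's English description precedes it below -/
import Mathlib

section
/- Let σ₁, σ₂ ∈ H. Then there exists σ₃ ∈ H such that φ_{σ₁} ∘ φ_{σ₂} = φ_{σ₃} near the origin: there is an open neighborhood V of (0,0) in ℂ^n × ℂ on which 1 + δ_{σ₂}(z,w) ≠ 0, 1 + δ_{σ₁}(φ_{σ₂}(z,w)) ≠ 0 and 1 + δ_{σ₃}(z,w) ≠ 0, and φ_{σ₁}(φ_{σ₂}(z,w)) = φ_{σ₃}(z,w) for all (z,w) ∈ V. -/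
open Complex Matrix

/-- The Hermitian form `⟨z,ζ⟩ = Σ_{α<e} z^α conj(ζ^α) − Σ_{α≥e} z^α conj(ζ^α)`
of signature `(e, n-e)` on `ℂ^n`. -/
noncomputable def herm (n e : ℕ) (z ζ : Fin n → ℂ) : ℂ :=
  ∑ α : Fin n, (if (α : ℕ) < e then (1 : ℂ) else -1) * z α * (starRingEnd ℂ) (ζ α)

/-- `δ_σ(z,w) = 2i⟨z,a⟩ − (r + i⟨a,a⟩)w` for `σ = (C,a,ρ,r)`. -/
noncomputable def deltaSigma (n e : ℕ) (a : Fin n → ℂ) (r : ℝ) (z : Fin n → ℂ) (w : ℂ) : ℂ :=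
  2 * Complex.I * herm n e z a - ((r : ℂ) + Complex.I * herm n e a a) * w

/-- The fractional linear map `φ_σ(z,w) = (C(z − aw)/(1+δ_σ), ρw/(1+δ_σ))`. -/
noncomputable def phiSigma (n e : ℕ) (C : Matrix (Fin n) (Fin n) ℂ) (a : Fin n → ℂ)
    (ρ r : ℝ) (p : (Fin n → ℂ) × ℂ) : (Fin n → ℂ) × ℂ :=
  ((1 + deltaSigma n e a r p.1 p.2)⁻¹ • C.mulVec (p.1 - p.2 • a),
    (ρ : ℂ) * p.2 / (1 + deltaSigma n e a r p.1 p.2))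

theorem herm_add_left (n e : ℕ) (x y u : Fin n → ℂ) :
    herm n e (x + y) u = herm n e x u + herm n e y u := by
  simp only [herm, Pi.add_apply, ← Finset.sum_add_distrib]
  exact Finset.sum_congr rfl fun i _ => by ring

theorem herm_add_right (n e : ℕ) (x y u : Fin n → ℂ) :
    herm n e u (x + y) = herm n e u x + herm n e u y := by
  simp only [herm, Pi.add_apply, ← Finset.sum_add_distrib, map_add]
  exact Finset.sum_congr rfl fun i _ => by ring

theorem herm_smul_left (n e : ℕ) (c : ℂ) (x u : Fin n → ℂ) :
    herm n e (c • x) u = c * herm n e x u := by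
  simp only [herm, Pi.smul_apply, smul_eq_mul, Finset.mul_sum]
  exact Finset.sum_congr rfl fun i _ => by ring

theorem herm_smul_right (n e : ℕ) (c : ℂ) (x u : Fin n → ℂ) :
    herm n e u (c • x) = (starRingEnd ℂ) c * herm n e u x := by
  simp only [herm, Pi.smul_apply, smul_eq_mul, Finset.mul_sum, map_mul]
  exact Finset.sum_congr rfl fun i _ => by ring

theorem herm_conj (n e : ℕ) (x y : Fin n → ℂ) :
    herm n e y x = (starRingEnd ℂ) (herm n e x y) := by
  simp only [herm, map_sum, map_mul, Complex.conj_conj]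
  refine Finset.sum_congr rfl fun i _ => ?_
  split_ifs <;> simp <;> ring

theorem herm_polar (n e : ℕ) (C : Matrix (Fin n) (Fin n) ℂ) (ρ : ℝ)
    (h : ∀ z : Fin n → ℂ, herm n e (C.mulVec z) (C.mulVec z) = (ρ : ℂ) * herm n e z z)
    (x y : Fin n → ℂ) :
    herm n e (C.mulVec x) (C.mulVec y) = (ρ : ℂ) * herm n e x y := by
  have h1 := h (x + y)
  have h2 := h (x + Complex.I • y)
  have hx := h x
  have hy := h y
  simp only [Matrix.mulVec_add, Matrix.mulVec_smul, herm_add_left, herm_add_right,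
    herm_smul_left, herm_smul_right, Complex.conj_I] at h1 h2
  have hI := Complex.I_mul_I
  linear_combination (1 / 2 : ℂ) * h1 + (Complex.I / 2) * h2 -
    ((1 + Complex.I) / 2) * hx - ((1 + Complex.I) / 2) * hy +
    (1 / 2 : ℂ) * (herm n e (C.mulVec x) (C.mulVec y) - herm n e (C.mulVec y) (C.mulVec x)
     - ρ * herm n e x y + ρ * herm n e y x
     + Complex.I * herm n e (C.mulVec y) (C.mulVec y) - Complex.I * ρ * herm n e y y) * hI

theorem delta_continuous (n e : ℕ) (a : Fin n → ℂ) (r : ℝ) :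
    Continuous fun p : (Fin n → ℂ) × ℂ => 1 + deltaSigma n e a r p.1 p.2 := by
  unfold deltaSigma herm
  fun_prop

/-- For `σ₁, σ₂ ∈ H` there is `σ₃ ∈ H` with `φ_{σ₁} ∘ φ_{σ₂} = φ_{σ₃}`
near the origin. -/
theorem stmt4 (n e : ℕ) (hn : 1 ≤ n) (he1 : n ≤ 2 * e) (he2 : e ≤ n)
    (C₁ : Matrix (Fin n) (Fin n) ℂ) (a₁ : Fin n → ℂ) (ρ₁ r₁ : ℝ)
    (hC₁ : IsUnit C₁) (hρ₁ : ρ₁ ≠ 0)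
    (hCρ₁ : ∀ z : Fin n → ℂ,
      herm n e (C₁.mulVec z) (C₁.mulVec z) = (ρ₁ : ℂ) * herm n e z z)
    (C₂ : Matrix (Fin n) (Fin n) ℂ) (a₂ : Fin n → ℂ) (ρ₂ r₂ : ℝ)
    (hC₂ : IsUnit C₂) (hρ₂ : ρ₂ ≠ 0)
    (hCρ₂ : ∀ z : Fin n → ℂ,
      herm n e (C₂.mulVec z) (C₂.mulVec z) = (ρ₂ : ℂ) * herm n e z z) :
    ∃ (C₃ : Matrix (Fin n) (Fin n) ℂ) (a₃ : Fin n → ℂ) (ρ₃ r₃ : ℝ),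
      IsUnit C₃ ∧ ρ₃ ≠ 0 ∧
      (∀ z : Fin n → ℂ,
        herm n e (C₃.mulVec z) (C₃.mulVec z) = (ρ₃ : ℂ) * herm n e z z) ∧
      ∃ V : Set ((Fin n → ℂ) × ℂ), IsOpen V ∧ (0, 0) ∈ V ∧
        ∀ p ∈ V,
          1 + deltaSigma n e a₂ r₂ p.1 p.2 ≠ 0 ∧
          1 + deltaSigma n e a₁ r₁ (phiSigma n e C₂ a₂ ρ₂ r₂ p).1
              (phiSigma n e C₂ a₂ ρ₂ r₂ p).2 ≠ 0 ∧
          1 + deltaSigma n e a₃ r₃ p.1 p.2 ≠ 0 ∧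
          phiSigma n e C₁ a₁ ρ₁ r₁ (phiSigma n e C₂ a₂ ρ₂ r₂ p)
            = phiSigma n e C₃ a₃ ρ₃ r₃ p := by
  obtain ⟨b, rfl⟩ : ∃ b, C₂.mulVec b = a₁ :=
    (Matrix.mulVec_surjective_iff_isUnit.mpr hC₂) a₁
  have key : ∀ p : (Fin n → ℂ) × ℂ, 1 + deltaSigma n e a₂ r₂ p.1 p.2 ≠ 0 →
      1 + deltaSigma n e (C₂.mulVec b) r₁ (phiSigma n e C₂ a₂ ρ₂ r₂ p).1
              (phiSigma n e C₂ a₂ ρ₂ r₂ p).2 =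
      (1 + deltaSigma n e (a₂ + (ρ₂ : ℂ) • b) (r₂ + ρ₂ * r₁ - 2 * ρ₂ * (herm n e a₂ b).im)
        p.1 p.2) / (1 + deltaSigma n e a₂ r₂ p.1 p.2) := by
    intro p hp
    rw [eq_div_iff hp]
    have e1 : deltaSigma n e (C₂.mulVec b) r₁ (phiSigma n e C₂ a₂ ρ₂ r₂ p).1
              (phiSigma n e C₂ a₂ ρ₂ r₂ p).2 * (1 + deltaSigma n e a₂ r₂ p.1 p.2) =
        2 * Complex.I * (ρ₂ * (herm n e p.1 b - p.2 * herm n e a₂ b))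
          - (r₁ + Complex.I * (ρ₂ * herm n e b b)) * (ρ₂ * p.2) := by
      have e2 : p.1 - p.2 • a₂ = p.1 + (-p.2) • a₂ := by rw [neg_smul, sub_eq_add_neg]
      simp only [phiSigma]
      generalize 1 + deltaSigma n e a₂ r₂ p.1 p.2 = D at hp
      unfold deltaSigma
      rw [herm_smul_left, herm_polar n e C₂ ρ₂ hCρ₂, hCρ₂, e2, herm_add_left, herm_smul_left]
      field_simp
      ring
    rw [add_mul, e1]
    have e3 : ((herm n e a₂ b).im : ℂ) * (2 * Complex.I) = herm n e a₂ b - herm n e b a₂ := by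
      rw [herm_conj n e a₂ b, Complex.sub_conj]
      push_cast
      ring
    simp only [deltaSigma, herm_add_left, herm_add_right, herm_smul_left, herm_smul_right,
      Complex.conj_ofReal]
    push_cast
    have hI := Complex.I_mul_I
    linear_combination (ρ₂ * p.2 * Complex.I) * e3 - 2 * ρ₂ * p.2 * (herm n e a₂ b).im * hI
  refine ⟨C₁ * C₂, a₂ + (ρ₂ : ℂ) • b, ρ₁ * ρ₂,
    r₂ + ρ₂ * r₁ - 2 * ρ₂ * (herm n e a₂ b).im, hC₁.mul hC₂, mul_ne_zero hρ₁ hρ₂, ?_, ?_⟩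
  · intro z
    rw [← Matrix.mulVec_mulVec, hCρ₁, hCρ₂]
    push_cast
    ring
  refine ⟨{p | 1 + deltaSigma n e a₂ r₂ p.1 p.2 ≠ 0} ∩
    {p | 1 + deltaSigma n e (a₂ + (ρ₂ : ℂ) • b)
      (r₂ + ρ₂ * r₁ - 2 * ρ₂ * (herm n e a₂ b).im) p.1 p.2 ≠ 0}, ?_, ?_, ?_⟩
  · exact (isOpen_ne_fun (delta_continuous _ _ _ _) continuous_const).inter
      (isOpen_ne_fun (delta_continuous _ _ _ _) continuous_const)
  · constructor <;> simp [deltaSigma, herm]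
  · rintro p ⟨h2, h3⟩
    simp only [Set.mem_setOf_eq] at h2 h3
    have hk := key p h2
    refine ⟨h2, ?_, h3, ?_⟩
    · rw [hk]
      exact div_ne_zero h3 h2
    · rw [phiSigma, hk]
      rw [phiSigma.eq_def n e (C₁ * C₂)]
      generalize 1 + deltaSigma n e (a₂ + (ρ₂ : ℂ) • b)
        (r₂ + ρ₂ * r₁ - 2 * ρ₂ * (herm n e a₂ b).im) p.1 p.2 = D₃ at h3
      simp only [phiSigma]
      generalize 1 + deltaSigma n e a₂ r₂ p.1 p.2 = D₂ at h2
      refine Prod.ext ?_ ?_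
      · have e4 : D₂⁻¹ • C₂.mulVec (p.1 - p.2 • a₂) - (ρ₂ * p.2 / D₂) • C₂.mulVec b
            = D₂⁻¹ • C₂.mulVec (p.1 - p.2 • (a₂ + (ρ₂ : ℂ) • b)) := by
          simp only [Matrix.mulVec_sub, Matrix.mulVec_add, Matrix.mulVec_smul]
          module
        simp only [e4]
        rw [Matrix.mulVec_smul, Matrix.mulVec_mulVec, smul_smul]
        congr 1
        field_simp
      · push_cast
        field_simp
end

section
/- Let k ≥ 3. Let φ₁ = (f₁,g₁), φ₂ = (f₂,g₂), Φ₁, Φ₂ be biholomorphic map germs at the origin of ℂ^n × ℂ fixing the origin, each written as a pair (f,g) with f valued in ℂ^n and g valued in ℂ and satisfying f(0,0) = 0, g(0,0) = 0 and (∂g/∂z^α)(0,0) = 0 for all α = 1,…,n. If φ₁ = Φ₁ + O_×(k) and φ₂ = Φ₂ + O_×(k), then φ₁ ∘ φ₂ = Φ₁ ∘ Φ₂ + O_×(k). -/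
open Complex

/-- A holomorphic-germ `f : ℂ^n × ℂ → ℂ` is `O(m)` in the weighted sense
(`z^α` of weight 1, `w` of weight 2) if all Taylor coefficients at the origin on
monomials of weight `< m` vanish; equivalently, for every `(z,w)` the one-variable
function `t ↦ f(tz, t²w)` has vanishing derivatives at `0` up to order `m − 1`. -/
def wBigO (n m : ℕ) (f : (Fin n → ℂ) × ℂ → ℂ) : Prop :=
  ∀ (z : Fin n → ℂ) (w : ℂ) (j : ℕ), j < m →
    iteratedDeriv j (fun t : ℂ => f (t • z, t ^ 2 * w)) 0 = 0

/-- `h = h̃ + O_×(m)`: the `ℂ^n`-components differ by `O(m−1)` and the `ℂ`-components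
differ by `O(m)`. -/
def wBigOx (n m : ℕ) (h h' : (Fin n → ℂ) × ℂ → (Fin n → ℂ) × ℂ) : Prop :=
  (∀ α : Fin n, wBigO n (m - 1) (fun p => (h p).1 α - (h' p).1 α)) ∧
    wBigO n m (fun p => (h p).2 - (h' p).2)

/-- A biholomorphic germ at the origin fixing the origin, whose `ℂ`-component `g`
satisfies `∂g/∂z^α(0,0) = 0` for all `α`. -/
def GoodGerm (n : ℕ) (φ : (Fin n → ℂ) × ℂ → (Fin n → ℂ) × ℂ) : Prop :=
  AnalyticAt ℂ φ 0 ∧ φ 0 = 0 ∧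
    (∃ L : ((Fin n → ℂ) × ℂ) ≃L[ℂ] ((Fin n → ℂ) × ℂ),
      fderiv ℂ φ 0 = (L : ((Fin n → ℂ) × ℂ) →L[ℂ] ((Fin n → ℂ) × ℂ))) ∧
    ∀ α : Fin n, fderiv ℂ (fun p => (φ p).2) 0 ((Pi.single α 1 : Fin n → ℂ), 0) = 0

section Helpers

open Asymptotics Filter Topology

lemma analyticAt_snd' {n : ℕ} {φ : (Fin n → ℂ) × ℂ → (Fin n → ℂ) × ℂ} {p} (h : AnalyticAt ℂ φ p) :
    AnalyticAt ℂ (fun p => (φ p).2) p :=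
  AnalyticAt.fun_comp (g := Prod.snd) analyticAt_snd h

lemma analyticAt_fst' {n : ℕ} {φ : (Fin n → ℂ) × ℂ → (Fin n → ℂ) × ℂ} {p} (h : AnalyticAt ℂ φ p)
    (α : Fin n) : AnalyticAt ℂ (fun p => (φ p).1 α) p :=
  (analyticAt_pi_iff.1 (AnalyticAt.fun_comp (g := Prod.fst) analyticAt_fst h)) α

lemma bigO_fst {n : ℕ} {γ : ℂ → (Fin n → ℂ) × ℂ} (h : γ =O[𝓝 0] (fun t : ℂ => t)) :
    (fun t => (γ t).1) =O[𝓝 0] (fun t : ℂ => t) :=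
  IsBigO.prod_left_fst (g' := fun t => (γ t).2) h

lemma iterDeriv_zero_iff {f : ℂ → ℂ} (hf : AnalyticAt ℂ f 0) (m : ℕ) :
    (∀ j, j < m → iteratedDeriv j f 0 = 0) ↔ f =O[𝓝 0] (fun t : ℂ => t ^ m) := by
  rw [← natCast_le_analyticOrderAt_iff_iteratedDeriv_eq_zero hf]
  constructor
  · intro h
    obtain ⟨g, hg, he⟩ := (natCast_le_analyticOrderAt hf).1 h
    have hb : g =O[𝓝 0] (fun _ => (1 : ℂ)) := hg.continuousAt.norm.isBoundedUnder_le.isBigO_one ℂ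
    have := (isBigO_refl (fun t : ℂ => t ^ m) (𝓝 0)).mul hb
    refine (this.congr' ?_ (by simp))
    filter_upwards [he] with t ht
    simp [ht]
  · intro h
    by_contra hlt
    push Not at hlt
    obtain ⟨j, hj⟩ := ENat.ne_top_iff_exists.1 hlt.ne_top
    rw [← hj] at hlt
    have hjm : j < m := by exact_mod_cast hlt
    obtain ⟨g, hg, hg0, he⟩ := (hf.analyticOrderAt_eq_natCast).1 hj.symm
    have h2 : g =O[𝓝[≠] 0] (fun t : ℂ => t ^ (m - j)) := by
      have h3 := (isBigO_refl (fun t : ℂ => (t ^ j)⁻¹) (𝓝[≠] 0)).mul (h.mono nhdsWithin_le_nhds)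
      refine h3.congr' ?_ ?_
      · filter_upwards [he.filter_mono nhdsWithin_le_nhds, self_mem_nhdsWithin] with t ht ht0
        have : t ≠ 0 := ht0
        simp only [ht, sub_zero, smul_eq_mul]
        field_simp
      · filter_upwards [self_mem_nhdsWithin] with t ht0
        have : t ≠ 0 := ht0
        rw [pow_sub₀ _ this hjm.le, mul_comm]
    have h4 : Tendsto (fun t : ℂ => t ^ (m - j)) (𝓝[≠] 0) (𝓝 0) := by
      have : Tendsto (fun t : ℂ => t ^ (m - j)) (𝓝 0) (𝓝 (0 ^ (m-j))) :=
        (continuous_pow (m - j)).tendsto 0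
      rw [zero_pow (by omega)] at this
      exact this.mono_left nhdsWithin_le_nhds
    have h5 := h2.trans_tendsto h4
    have h6 : Tendsto g (𝓝[≠] 0) (𝓝 (g 0)) := hg.continuousAt.tendsto.mono_left nhdsWithin_le_nhds
    exact hg0 (tendsto_nhds_unique h6 h5)

lemma analytic_line {n : ℕ} {F : Type*} [NormedAddCommGroup F] [NormedSpace ℂ F]
    {u : (Fin n → ℂ) × ℂ → F} (hu : AnalyticAt ℂ u 0) (z : Fin n → ℂ) (w : ℂ) :
    AnalyticAt ℂ (fun t : ℂ => u (t • z, t ^ 2 * w)) 0 := by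
  have h1 : AnalyticAt ℂ (fun t : ℂ => ((t • z, t ^ 2 * w) : (Fin n → ℂ) × ℂ)) 0 := by fun_prop
  refine AnalyticAt.fun_comp (g := u) ?_ h1
  convert hu using 1
  simp

lemma lemB {n : ℕ} (m : ℕ) {u : (Fin n → ℂ) × ℂ → ℂ} (hu : AnalyticAt ℂ u 0)
    (h : wBigO n (m + 1) u) {γ : ℂ → (Fin n → ℂ) × ℂ}
    (h1 : (fun t => (γ t).1) =O[𝓝 0] (fun t : ℂ => t))
    (h2 : (fun t => (γ t).2) =O[𝓝 0] (fun t : ℂ => t ^ 2)) :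
    (fun t => u (γ t)) =O[𝓝 0] (fun t : ℂ => t ^ (m + 1)) := by
  have u0 : u 0 = 0 := by
    have e : u ((0 : Fin n → ℂ), (0 : ℂ)) = 0 := by simpa using h 0 0 0 (by omega)
    exact e
  obtain ⟨C₁, hC₁⟩ := h1.bound
  obtain ⟨C₂, hC₂⟩ := h2.bound
  obtain ⟨C, hC0, hC1, hC2⟩ : ∃ C : ℝ, 1 ≤ C ∧ C₁ ≤ C ∧ C₂ ≤ C :=
    ⟨max 1 (max C₁ C₂), by simp, by simp, by simp⟩
  have hbd : ∀ᶠ p in 𝓝 (0 : (Fin n → ℂ) × ℂ), ‖u p‖ < 1 := by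
    have := hu.continuousAt.norm.tendsto
    simp only [u0, norm_zero] at this
    exact this.eventually_lt_const one_pos
  obtain ⟨δ, hδ, hball⟩ := Metric.eventually_nhds_iff_ball.1 (hu.eventually_analyticAt.and hbd)
  obtain ⟨r, hr, hr1, hrδ⟩ : ∃ r : ℝ, 0 < r ∧ r ≤ 1 ∧ r * C ≤ δ := by
    refine ⟨min 1 (δ / C), by positivity, by simp, ?_⟩
    rw [← le_div_iff₀ (by positivity)]
    simp
  have key : ∀ (z : Fin n → ℂ) (w : ℂ), ‖z‖ ≤ C → ‖w‖ ≤ C → ∀ t ∈ Metric.ball (0 : ℂ) r,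
      ‖u (t • z, t ^ 2 * w)‖ ≤ 1 * (‖t‖ / r) ^ (m + 1) := by
    intro z w hz hw t ht
    have hin : ∀ s ∈ Metric.ball (0 : ℂ) r,
        ((s • z, s ^ 2 * w) : (Fin n → ℂ) × ℂ) ∈ Metric.ball (0 : (Fin n → ℂ) × ℂ) δ := by
      intro s hs
      rw [mem_ball_zero_iff] at hs ⊢
      rw [Prod.norm_mk, max_lt_iff, norm_smul, norm_mul, norm_pow]
      constructor
      · calc ‖s‖ * ‖z‖ ≤ ‖s‖ * C := by gcongr
          _ < r * C := by gcongr
          _ ≤ δ := hrδ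
      · calc ‖s‖ ^ 2 * ‖w‖ ≤ ‖s‖ * C := by
              gcongr
              nlinarith [norm_nonneg s]
          _ < r * C := by gcongr
          _ ≤ δ := hrδ
    have hs := Complex.dist_le_mul_div_pow_of_mapsTo_ball_of_isLittleO (f := fun t : ℂ => u (t • z, t ^ 2 * w)) (c := 0) (z := t)
      (R₁ := r) (R₂ := 1) (n := m) ?_ ?_ ?_ ht
    · have e0 : u ((0 : Fin n → ℂ), (0 : ℂ)) = 0 := u0
      simpa [e0] using hs
    · intro s hs
      have h3 := (hball _ (hin s hs)).1.differentiableAt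
      have h4 : DifferentiableAt ℂ (fun t : ℂ => ((t • z, t ^ 2 * w) : (Fin n → ℂ) × ℂ)) s := by
        fun_prop
      exact (DifferentiableAt.comp s (g := u) h3 h4).differentiableWithinAt
    · intro s hs
      have e0 : u ((0 : Fin n → ℂ), (0 : ℂ)) = 0 := u0
      simpa [e0] using (hball _ (hin s hs)).2.le
    · have e0 : u ((0 : Fin n → ℂ), (0 : ℂ)) = 0 := u0
      have := (iterDeriv_zero_iff (analytic_line hu z w) (m + 1)).1 (h z w)
      simpa [e0] using
        (this.trans_isLittleO (isLittleO_pow_pow (𝕜 := ℂ) (Nat.lt_succ_self m))).norm_right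
  refine IsBigO.of_bound ((1 / r) ^ (m + 1)) ?_
  filter_upwards [hC₁, hC₂, Metric.ball_mem_nhds (0 : ℂ) hr] with t ht1 ht2 htr
  by_cases ht : t = 0
  · subst ht
    have e1 : (γ 0).1 = 0 := by simpa using ht1
    have e2 : (γ 0).2 = 0 := by simpa using ht2
    have : γ 0 = 0 := Prod.ext e1 e2
    simp [this, u0]
  · have htp : 0 < ‖t‖ := norm_pos_iff.2 ht
    have := key (t⁻¹ • (γ t).1) ((t ^ 2)⁻¹ * (γ t).2) ?_ ?_ t htr
    · rw [smul_inv_smul₀ ht, mul_inv_cancel_left₀ (pow_ne_zero 2 ht)] at this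
      rw [norm_pow, ← mul_pow]
      calc _ ≤ _ := this
        _ = _ := by rw [one_mul]; congr 1; ring
    · rw [norm_smul, norm_inv, inv_mul_le_iff₀ htp, mul_comm]
      exact ht1.trans (by gcongr)
    · rw [norm_mul, norm_inv, inv_mul_le_iff₀ (norm_pos_iff.2 (pow_ne_zero 2 ht)), mul_comm]
      exact ht2.trans (by gcongr)

lemma lemA {n : ℕ} (m : ℕ) {g : (Fin n → ℂ) × ℂ → ℂ} (hg : AnalyticAt ℂ g 0)
    (hd : ∀ z : Fin n → ℂ, fderiv ℂ g 0 (z, 0) = 0) {γ Γ : ℂ → (Fin n → ℂ) × ℂ}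
    (h1 : γ =O[𝓝 0] (fun t : ℂ => t)) (h2 : Γ =O[𝓝 0] (fun t : ℂ => t))
    (h3 : (fun t => (γ t).1 - (Γ t).1) =O[𝓝 0] (fun t : ℂ => t ^ m))
    (h4 : (fun t => (γ t).2 - (Γ t).2) =O[𝓝 0] (fun t : ℂ => t ^ (m + 1))) :
    (fun t => g (γ t) - g (Γ t)) =O[𝓝 0] (fun t : ℂ => t ^ (m + 1)) := by
  have hdiff : (fun t => γ t - Γ t) =O[𝓝 0] (fun t : ℂ => t ^ m) :=
    IsBigO.prod_left h3 (h4.trans (isBigO_iff.2 ⟨1, by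
      filter_upwards [Metric.ball_mem_nhds (0 : ℂ) one_pos] with t ht
      rw [mem_ball_zero_iff] at ht
      rw [norm_pow, norm_pow, one_mul]
      exact pow_le_pow_of_le_one (norm_nonneg _) ht.le (Nat.le_succ m)⟩))
  have hL : (fun t => fderiv ℂ g 0 (γ t - Γ t)) =O[𝓝 0] (fun t : ℂ => t ^ (m + 1)) := by
    have : ∀ t, fderiv ℂ g 0 (γ t - Γ t) = ((γ t).2 - (Γ t).2) * fderiv ℂ g 0 (0, 1) := by
      intro t
      have e : γ t - Γ t = ((γ t).1 - (Γ t).1, 0) + ((γ t).2 - (Γ t).2) • ((0, 1) : (Fin n → ℂ) × ℂ) := by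
        ext <;> simp
      rw [e, map_add, hd, map_smul]
      simp
    simp only [this]
    simpa [mul_comm] using h4.const_mul_left (fderiv ℂ g 0 (0, 1))
  have hD : (fun p => fderiv ℂ g p - fderiv ℂ g 0) =O[𝓝 0] (fun p : (Fin n → ℂ) × ℂ => p) := by
    simpa using hg.fderiv.differentiableAt.isBigO_sub
  obtain ⟨K, hK0, hK⟩ := hD.exists_pos
  obtain ⟨δ, hδ, hball⟩ := Metric.eventually_nhds_iff_ball.1 (hg.eventually_analyticAt.and hK.bound)
  obtain ⟨C₁, hC₁⟩ := h1.bound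
  obtain ⟨C₂, hC₂⟩ := h2.bound
  obtain ⟨C, hC0, hC1, hC2⟩ : ∃ C : ℝ, 1 ≤ C ∧ C₁ ≤ C ∧ C₂ ≤ C :=
    ⟨max 1 (max C₁ C₂), by simp, by simp, by simp⟩
  have hR : (fun t => g (γ t) - g (Γ t) - fderiv ℂ g 0 (γ t - Γ t)) =O[𝓝 0]
      (fun t : ℂ => t * (t ^ m)) := by
    have : (fun t => g (γ t) - g (Γ t) - fderiv ℂ g 0 (γ t - Γ t)) =O[𝓝 0]
      (fun t : ℂ => ‖t‖ * ‖γ t - Γ t‖) := by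
      refine IsBigO.of_bound (K * C) ?_
      filter_upwards [hC₁, hC₂, Metric.ball_mem_nhds (0 : ℂ) (show 0 < δ / C by positivity)]
        with t ht1 ht2 ht
      rw [mem_ball_zero_iff, lt_div_iff₀ (by positivity)] at ht
      have hsub : ∀ x ∈ Metric.closedBall (0 : (Fin n → ℂ) × ℂ) (C * ‖t‖),
          x ∈ Metric.ball (0 : (Fin n → ℂ) × ℂ) δ := by
        intro x hx
        rw [mem_closedBall_zero_iff] at hx
        rw [mem_ball_zero_iff]
        linarith
      have := (convex_closedBall (0 : (Fin n → ℂ) × ℂ) (C * ‖t‖)).norm_image_sub_le_of_norm_fderiv_le'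
        (𝕜 := ℂ) (f := g) (φ := fderiv ℂ g 0) (C := K * (C * ‖t‖)) (x := Γ t) (y := γ t)
        (fun x hx => (hball x (hsub x hx)).1.differentiableAt)
        (fun x hx => (hball x (hsub x hx)).2.trans (by
          rw [mem_closedBall_zero_iff] at hx
          gcongr))
        (mem_closedBall_zero_iff.2 (ht2.trans (by gcongr)))
        (mem_closedBall_zero_iff.2 (ht1.trans (by gcongr)))
      refine this.trans (le_of_eq ?_)
      simp only [norm_mul, norm_norm]
      ring
    exact this.trans ((isBigO_refl (fun t : ℂ => t) (𝓝 0)).norm_left.mul hdiff.norm_left)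
  have := hR.add (f₂ := fun t => fderiv ℂ g 0 (γ t - Γ t)) (hL.congr_right (g₂ := fun t : ℂ => t * t ^ m) (fun t => by ring))
  exact this.congr (fun t => by ring) (fun t => by ring)

lemma line_bounds {n : ℕ} {φ : (Fin n → ℂ) × ℂ → (Fin n → ℂ) × ℂ} (hφ : GoodGerm n φ)
    (z : Fin n → ℂ) (w : ℂ) :
    (fun t : ℂ => φ (t • z, t ^ 2 * w)) =O[𝓝 0] (fun t : ℂ => t) ∧
    (fun t : ℂ => (φ (t • z, t ^ 2 * w)).2) =O[𝓝 0] (fun t : ℂ => t ^ 2) ∧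
    ∀ z : Fin n → ℂ, fderiv ℂ (fun p => (φ p).2) 0 (z, 0) = 0 := by
  obtain ⟨ha, h0, -, hd⟩ := hφ
  have h0' : φ ((0 : Fin n → ℂ), (0 : ℂ)) = 0 := h0
  have hd' : ∀ z : Fin n → ℂ, fderiv ℂ (fun p => (φ p).2) 0 (z, 0) = 0 := by
    intro z
    have e : ((z, 0) : (Fin n → ℂ) × ℂ)
        = ∑ α, z α • ((Pi.single α 1 : Fin n → ℂ), (0 : ℂ)) := by
      refine Prod.ext ?_ ?_
      · simp only [Prod.fst_sum, Prod.smul_fst]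
        exact pi_eq_sum_univ' z
      · simp [Prod.snd_sum]
    rw [e, map_sum]
    simp [hd, -Prod.smul_mk]
  have hl : (fun t : ℂ => ((t • z, t ^ 2 * w) : (Fin n → ℂ) × ℂ)) =O[𝓝 0] (fun t : ℂ => t) := by
    have : DifferentiableAt ℂ (fun t : ℂ => ((t • z, t ^ 2 * w) : (Fin n → ℂ) × ℂ)) 0 := by fun_prop
    simpa using this.isBigO_sub
  refine ⟨?_, ?_, hd'⟩
  · simpa [h0'] using (analytic_line ha z w).differentiableAt.isBigO_sub
  · have := lemA 1 (g := fun p => (φ p).2) (analyticAt_snd' ha) hd' (Γ := fun _ => 0) hl (isBigO_zero _ _) ?_ ?_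
    · simpa [h0, h0'] using this
    · simpa using bigO_fst hl
    · simpa [mul_comm] using (isBigO_refl (fun t : ℂ => t ^ 2) (𝓝 0)).const_mul_left w

end Helpers

open Asymptotics Filter Topology in
/-- For biholomorphic germs `φ₁, φ₂, Φ₁, Φ₂` fixing the origin with
`f(0,0) = 0`, `g(0,0) = 0` and `∂g/∂z(0,0) = 0`, if `φ₁ = Φ₁ + O_×(k)` and
`φ₂ = Φ₂ + O_×(k)` (`k ≥ 3`), then `φ₁ ∘ φ₂ = Φ₁ ∘ Φ₂ + O_×(k)`. -/
theorem stmt6 (n k : ℕ) (hk : 3 ≤ k)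
    (φ₁ φ₂ Φ₁ Φ₂ : (Fin n → ℂ) × ℂ → (Fin n → ℂ) × ℂ)
    (hφ₁ : GoodGerm n φ₁) (hφ₂ : GoodGerm n φ₂)
    (hΦ₁ : GoodGerm n Φ₁) (hΦ₂ : GoodGerm n Φ₂)
    (h1 : wBigOx n k φ₁ Φ₁) (h2 : wBigOx n k φ₂ Φ₂) :
    wBigOx n k (φ₁ ∘ φ₂) (Φ₁ ∘ Φ₂) := by
  have a1 := hφ₁.1
  have a2 := hφ₂.1
  have b1 := hΦ₁.1
  have b2 := hΦ₂.1
  have c1 : AnalyticAt ℂ (fun p => φ₁ (φ₂ p)) 0 :=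
    AnalyticAt.fun_comp (g := φ₁) (by rw [hφ₂.2.1]; exact a1) a2
  have c2 : AnalyticAt ℂ (fun p => Φ₁ (Φ₂ p)) 0 :=
    AnalyticAt.fun_comp (g := Φ₁) (by rw [hΦ₂.2.1]; exact b1) b2
  obtain ⟨m, rfl⟩ : ∃ m, k = m + 2 := ⟨k - 2, by omega⟩
  -- bounds along the weighted curves for the inner maps
  have hz : ∀ z w, (fun t : ℂ => (φ₂ (t • z, t ^ 2 * w)).1 - (Φ₂ (t • z, t ^ 2 * w)).1)
      =O[𝓝 0] (fun t : ℂ => t ^ (m + 1)) := by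
    intro z w
    rw [isBigO_pi]
    intro α
    exact (iterDeriv_zero_iff (analytic_line (u := fun p => (φ₂ p).1 α - (Φ₂ p).1 α)
      ((analyticAt_fst' a2 α).fun_sub (analyticAt_fst' b2 α)) z w) (m + 1)).1 (h2.1 α z w)
  have hw : ∀ z w, (fun t : ℂ => (φ₂ (t • z, t ^ 2 * w)).2 - (Φ₂ (t • z, t ^ 2 * w)).2)
      =O[𝓝 0] (fun t : ℂ => t ^ (m + 2)) := by
    intro z w
    exact (iterDeriv_zero_iff (analytic_line (u := fun p => (φ₂ p).2 - (Φ₂ p).2)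
      ((analyticAt_snd' a2).fun_sub (analyticAt_snd' b2)) z w) (m + 2)).1 (h2.2 z w)
  constructor
  · intro α z w
    refine (iterDeriv_zero_iff (analytic_line
      (u := fun p => ((φ₁ ∘ φ₂) p).1 α - ((Φ₁ ∘ Φ₂) p).1 α) ?_ z w) _).2 ?_
    · exact (analyticAt_fst' c1 α).fun_sub (analyticAt_fst' c2 α)
    obtain ⟨l1, l2, -⟩ := line_bounds hφ₂ z w
    obtain ⟨l3, l4, -⟩ := line_bounds hΦ₂ z w
    have hB := lemB m (u := fun p => (φ₁ p).1 α - (Φ₁ p).1 α)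
      ((analyticAt_fst' a1 α).fun_sub (analyticAt_fst' b1 α)) (h1.1 α)
      (bigO_fst l1) l2
    have hlip : (fun t : ℂ => (Φ₁ (φ₂ (t • z, t ^ 2 * w))).1 α - (Φ₁ (Φ₂ (t • z, t ^ 2 * w))).1 α)
        =O[𝓝 0] (fun t : ℂ => φ₂ (t • z, t ^ 2 * w) - Φ₂ (t • z, t ^ 2 * w)) := by
      have hs : HasStrictFDerivAt (fun p => (Φ₁ p).1 α) (fderiv ℂ (fun p => (Φ₁ p).1 α) 0) 0 :=
        (analyticAt_fst' b1 α).hasStrictFDerivAt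
      have t0 : Tendsto (fun t : ℂ => (φ₂ (t • z, t ^ 2 * w), Φ₂ (t • z, t ^ 2 * w))) (𝓝 0)
          (𝓝 (0, 0)) :=
        (l1.trans_tendsto tendsto_id).prodMk_nhds (l3.trans_tendsto tendsto_id)
      exact hs.isBigO_sub.comp_tendsto t0
    have hpw : (fun t : ℂ => t ^ (m + 2)) =O[𝓝 0] (fun t : ℂ => t ^ (m + 1)) :=
      (isLittleO_pow_pow (𝕜 := ℂ) (Nat.lt_succ_self (m + 1))).isBigO
    have := hB.add (hlip.trans (IsBigO.prod_left (hz z w) ((hw z w).trans hpw)))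
    refine this.congr_left fun t => ?_
    simp only [Function.comp_apply]
    ring
  · intro z w
    refine (iterDeriv_zero_iff (analytic_line
      (u := fun p => ((φ₁ ∘ φ₂) p).2 - ((Φ₁ ∘ Φ₂) p).2) ?_ z w) _).2 ?_
    · exact (analyticAt_snd' c1).fun_sub (analyticAt_snd' c2)
    obtain ⟨l1, l2, -⟩ := line_bounds hφ₂ z w
    obtain ⟨l3, l4, -⟩ := line_bounds hΦ₂ z w
    obtain ⟨-, -, hd⟩ := line_bounds hΦ₁ z w
    have hB := lemB (m + 1) (u := fun p => (φ₁ p).2 - (Φ₁ p).2)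
      ((analyticAt_snd' a1).fun_sub (analyticAt_snd' b1)) h1.2
      (bigO_fst l1) l2
    have hA := lemA (m + 1) (g := fun p => (Φ₁ p).2) (analyticAt_snd' b1) hd l1 l3 (hz z w) (hw z w)
    refine (hB.add hA).congr_left fun t => ?_
    simp only [Function.comp_apply]
    ring
end

section
/- Let M ⊆ ℂ^{n+1} (n ≥ 1) be a nondegenerate real-analytic real hypersurface. If p, q ∈ M are joined by a continuous path γ : [0,1] → M with γ(0) = p and γ(1) = q, then p is a spherical point of M if and only if q is a spherical point of M. -/
open Complex

/-- The Wirtinger derivative `∂h/∂ζ^j` at `p` of a function `h : ℂ^N → ℂ`, computed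
from the real Fréchet derivative: `∂h/∂ζ^j = ½(∂h/∂x^j − i ∂h/∂y^j)`. -/
noncomputable def wirtD (N : ℕ) (j : Fin N) (h : (Fin N → ℂ) → ℂ) (p : Fin N → ℂ) : ℂ :=
  (1 / 2) * (fderiv ℝ h p (Pi.single j 1) - Complex.I * fderiv ℝ h p (Pi.single j Complex.I))

/-- The conjugate Wirtinger derivative `∂h/∂ζ̄^j = ½(∂h/∂x^j + i ∂h/∂y^j)`. -/
noncomputable def wirtDbar (N : ℕ) (j : Fin N) (h : (Fin N → ℂ) → ℂ) (p : Fin N → ℂ) : ℂ :=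
  (1 / 2) * (fderiv ℝ h p (Pi.single j 1) + Complex.I * fderiv ℝ h p (Pi.single j Complex.I))

/-- The Levi matrix `(∂²r/∂ζ^j∂ζ̄^k)_{j,k}` of a real function `r` at `p`. -/
noncomputable def leviMatrix (N : ℕ) (r : (Fin N → ℂ) → ℝ) (p : Fin N → ℂ)
    (j k : Fin N) : ℂ :=
  wirtD N j (fun q => wirtDbar N k (fun x => ((r x : ℂ))) q) p

/-- The complex tangent space `{v : Σ_j (∂r/∂ζ^j)(p) v^j = 0}`. -/
def complexTangent (N : ℕ) (r : (Fin N → ℂ) → ℝ) (p : Fin N → ℂ) : Set (Fin N → ℂ) :=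
  {v | ∑ j : Fin N, wirtD N j (fun x => ((r x : ℂ))) p * v j = 0}

/-- Nondegeneracy of the Levi form of `r` at `p` restricted to the complex tangent space. -/
def LeviNondeg (N : ℕ) (r : (Fin N → ℂ) → ℝ) (p : Fin N → ℂ) : Prop :=
  ∀ v ∈ complexTangent N r p,
    (∀ w ∈ complexTangent N r p,
      ∑ j : Fin N, ∑ k : Fin N, leviMatrix N r p j k * v j * (starRingEnd ℂ) (w k) = 0)
    → v = 0

/-- A nondegenerate real-analytic real hypersurface of `ℂ^N`. -/
def IsNondegHypersurface (N : ℕ) (M : Set (Fin N → ℂ)) : Prop :=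
  ∀ p ∈ M, ∃ (V : Set (Fin N → ℂ)) (r : (Fin N → ℂ) → ℝ),
    IsOpen V ∧ p ∈ V ∧ AnalyticOnNhd ℝ r V ∧
    M ∩ V = {x ∈ V | r x = 0} ∧
    (∀ x ∈ V, fderiv ℝ r x ≠ 0) ∧
    (∀ x ∈ M ∩ V, LeviNondeg N r x)

/-- The real hyperquadric `Q_e = {Im w = Σ_{α<e} |z^α|² − Σ_{α≥e} |z^α|²}` in
`ℂ^n × ℂ ≅ ℂ^{n+1}`, where `w` is the last coordinate. -/
def hyperquadric (n e : ℕ) : Set (Fin (n + 1) → ℂ) :=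
  {ζ | (ζ (Fin.last n)).im
    = ∑ α : Fin n, (if (α : ℕ) < e then (1 : ℝ) else -1) * Complex.normSq (ζ α.castSucc)}

/-- `p ∈ M` is a spherical point: some neighborhood of `p` in `M` is mapped into a
real hyperquadric by a biholomorphism. -/
def IsSphericalPt (n : ℕ) (M : Set (Fin (n + 1) → ℂ)) (p : Fin (n + 1) → ℂ) : Prop :=
  ∃ (U : Set (Fin (n + 1) → ℂ)) (φ : (Fin (n + 1) → ℂ) → (Fin (n + 1) → ℂ)) (e : ℕ),
    e ≤ n ∧ IsOpen U ∧ p ∈ U ∧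
    AnalyticOnNhd ℂ φ U ∧ Set.InjOn φ U ∧ IsOpen (φ '' U) ∧
    (∃ ψ : (Fin (n + 1) → ℂ) → (Fin (n + 1) → ℂ),
      AnalyticOnNhd ℂ ψ (φ '' U) ∧ ∀ x ∈ U, ψ (φ x) = x) ∧
    φ '' (U ∩ M) ⊆ hyperquadric n e

namespace PinchukAux
open Filter Topology
set_option linter.unusedSectionVars false

theorem an_ift {𝕜 : Type*} [RCLike 𝕜] {X Y Z : Type*}
    [NormedAddCommGroup X] [NormedSpace 𝕜 X] [CompleteSpace X]
    [NormedAddCommGroup Y] [NormedSpace 𝕜 Y] [CompleteSpace Y]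
    [NormedAddCommGroup Z] [NormedSpace 𝕜 Z] [CompleteSpace Z]
    (f : X × Y → Z) (x0 : X) (y0 : Y) (hf : AnalyticAt 𝕜 f (x0, y0)) (h0 : f (x0, y0) = 0)
    (hb : Function.Bijective (fun y => fderiv 𝕜 f (x0, y0) (0, y))) :
    ∃ g : X → Y, AnalyticAt 𝕜 g x0 ∧ g x0 = y0 ∧
      (∀ᶠ v in 𝓝 (x0, y0), f v = 0 ↔ g v.1 = v.2) ∧ (∀ᶠ x in 𝓝 x0, f (x, g x) = 0) := by
  have hc : ContDiffAt 𝕜 ⊤ f (x0, y0) := hf.contDiffAt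
  have hinv : (fderiv 𝕜 f (x0, y0) ∘L .inr 𝕜 X Y).IsInvertible := by
    refine ⟨ContinuousLinearEquiv.ofBijective (fderiv 𝕜 f (x0, y0) ∘L .inr 𝕜 X Y) ?_ ?_, ?_⟩
    · exact LinearMap.ker_eq_bot.2 hb.1
    · exact LinearMap.range_eq_top.2 hb.2
    · ext; simp
  refine ⟨hc.implicitFunction (by simp) hinv, ?_, ?_, ?_, ?_⟩
  · exact (hc.contDiffAt_implicitFunction (by simp) hinv).analyticAt
  · exact hc.implicitFunction_apply_self (by simp) hinv
  · have := hc.eventually_apply_eq_iff_implicitFunction (by simp) hinv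
    simpa only [h0] using this
  · have := hc.eventually_apply_implicitFunction (by simp) hinv
    simpa only [h0] using this

theorem an_ident {E F : Type*} [NormedAddCommGroup E] [NormedSpace ℂ E]
    [NormedAddCommGroup F] [NormedSpace ℂ F] [CompleteSpace F] (f : E → F) (K : Set E)
    (hK : IsPreconnected K) (hf : ∀ x ∈ K, AnalyticAt ℂ f x) (x0 : E) (hx0 : x0 ∈ K)
    (h0 : ∀ᶠ x in 𝓝 x0, f x = 0) : ∀ x ∈ K, ∀ᶠ y in 𝓝 x, f y = 0 := by
  let u := {x | ∀ᶠ y in 𝓝 x, f y = 0}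
  have main : closure u ∩ K ⊆ u := by
    rintro x ⟨hxu, hxK⟩
    obtain ⟨ε, hε, hb⟩ := Metric.eventually_nhds_iff_ball.1 (hf x hxK).eventually_analyticAt
    obtain ⟨y, hy, hd⟩ := Metric.mem_closure_iff.1 hxu ε hε
    have hy' : y ∈ Metric.ball x ε := by rwa [Metric.mem_ball, dist_comm]
    have := AnalyticOnNhd.eqOn_zero_of_preconnected_of_eventuallyEq_zero
      (f := f) (U := Metric.ball x ε) (fun z hz => hb z hz)
      (convex_ball x ε).isPreconnected hy' hy
    filter_upwards [Metric.ball_mem_nhds x hε] with z hz using this hz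
  exact hK.subset_of_closure_inter_subset isOpen_setOfPred_eventually_nhds ⟨x0, hx0, h0⟩ main

/-- conjugation of the terms of a power series -/
noncomputable def conjMulti {E F : Type*} [NormedAddCommGroup E] [NormedSpace ℂ E]
    [StarAddMonoid E] [NormedStarGroup E] [StarModule ℂ E]
    [NormedAddCommGroup F] [NormedSpace ℂ F] [StarAddMonoid F] [NormedStarGroup F] [StarModule ℂ F]
    {k : ℕ} (p : ContinuousMultilinearMap ℂ (fun _ : Fin k => E) F) :
    ContinuousMultilinearMap ℂ (fun _ : Fin k => E) F :=
  MultilinearMap.mkContinuous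
    { toFun := fun m => star (p (fun i => star (m i)))
      map_update_add' := by
        intro _ m i x y
        have key : ∀ z : E, (fun j => star (Function.update m i z j)) =
            Function.update (fun j => star (m j)) i (star z) := by
          intro z; ext j
          by_cases h : j = i
          · subst h; simp
          · simp [h]
        have : (by assumption : DecidableEq (Fin k)) = (inferInstance : DecidableEq (Fin k)) :=
          Subsingleton.elim _ _
        rw [key, key, key, star_add, p.map_update_add, star_add]
      map_update_smul' := by
        intro _ m i c x
        have key : ∀ z : E, (fun j => star (Function.update m i z j)) =
            Function.update (fun j => star (m j)) i (star z) := by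
          intro z; ext j
          by_cases h : j = i
          · subst h; simp
          · simp [h]
        rw [key, key, star_smul, p.map_update_smul, star_smul, star_star] }
    ‖p‖ (by
      intro m
      simp only [MultilinearMap.coe_mk, norm_star]
      refine (p.le_opNorm _).trans ?_
      simp)

section conj
variable {E F : Type*} [NormedAddCommGroup E] [NormedSpace ℂ E]
    [StarAddMonoid E] [NormedStarGroup E] [StarModule ℂ E]
    [NormedAddCommGroup F] [NormedSpace ℂ F] [StarAddMonoid F] [NormedStarGroup F] [StarModule ℂ F]

theorem conjMulti_apply {k : ℕ} (p : ContinuousMultilinearMap ℂ (fun _ : Fin k => E) F)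
    (m : Fin k → E) : conjMulti p m = star (p (fun i => star (m i))) := rfl

theorem conjMulti_norm {k : ℕ} (p : ContinuousMultilinearMap ℂ (fun _ : Fin k => E) F) :
    ‖conjMulti p‖ ≤ ‖p‖ := MultilinearMap.mkContinuous_norm_le _ (norm_nonneg _) _

theorem conj_series {f : E → F} {a : E} {p : FormalMultilinearSeries ℂ E F}
    (h : HasFPowerSeriesAt f p (star a)) :
    HasFPowerSeriesAt (fun x => star (f (star x))) (fun k => conjMulti (p k)) a := by
  obtain ⟨r, hr⟩ := h
  refine ⟨r, ?_, hr.r_pos, ?_⟩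
  · refine hr.r_le.trans ?_
    refine ENNReal.le_of_forall_nnreal_lt fun s hs => ?_
    obtain ⟨C, hC, hb⟩ := p.norm_mul_pow_le_of_lt_radius hs
    refine FormalMultilinearSeries.le_radius_of_bound _ C fun k => ?_
    refine le_trans ?_ (hb k)
    gcongr
    exact conjMulti_norm _
  · intro y hy
    have hy' : star y ∈ Metric.eball (0 : E) r := by
      simpa [mem_eball_zero_iff, enorm_eq_nnnorm, nnnorm_star] using hy
    have := hr.hasSum hy'
    have h2 := this.star
    simpa [conjMulti_apply] using h2

theorem conj_analytic {f : E → F} {a : E} (h : AnalyticAt ℂ f (star a)) :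
    AnalyticAt ℂ (fun x => star (f (star x))) a := by
  obtain ⟨p, hp⟩ := h
  exact ⟨_, conj_series hp⟩

theorem conj_fderiv {f : E → F} {a : E} (h : AnalyticAt ℂ f (star a)) (v : E) :
    fderiv ℂ (fun x => star (f (star x))) a v = star (fderiv ℂ f (star a) (star v)) := by
  obtain ⟨p, hp⟩ := h
  rw [hp.fderiv_eq, (conj_series hp).fderiv_eq]
  simp [conjMulti_apply]
  congr 2
  ext i; fin_cases i; rfl
end conj

section cplx
variable {E W ι : Type*} [NormedAddCommGroup E] [NormedSpace ℝ E]
  [NormedAddCommGroup W] [NormedSpace ℂ W] [Fintype ι]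

noncomputable def cplxTerm (b : ι → E) (l : ι → W →L[ℂ] ℂ) (P : FormalMultilinearSeries ℝ E ℝ) :
    FormalMultilinearSeries ℂ W ℂ := fun k =>
  ∑ i : Fin k → ι, ((P k (fun j => b (i j)) : ℝ) : ℂ) •
    (ContinuousMultilinearMap.mkPiAlgebra ℂ (Fin k) ℂ).compContinuousLinearMap (fun j => l (i j))

theorem cplxTerm_apply (b : ι → E) (l : ι → W →L[ℂ] ℂ) (P : FormalMultilinearSeries ℝ E ℝ)
    (k : ℕ) (m : Fin k → W) : cplxTerm b l P k m =
      ∑ i : Fin k → ι, ((P k (fun j => b (i j)) : ℝ) : ℂ) * ∏ j, l (i j) (m j) := by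
  simp [cplxTerm]

theorem cplxTerm_norm (b : ι → E) (l : ι → W →L[ℂ] ℂ) (P : FormalMultilinearSeries ℝ E ℝ)
    (B L : ℝ) (hB : ∀ i, ‖b i‖ ≤ B) (hL : ∀ i, ‖l i‖ ≤ L) (hB0 : 0 ≤ B) (hL0 : 0 ≤ L)
    (k : ℕ) : ‖cplxTerm b l P k‖ ≤ ‖P k‖ * (Fintype.card ι * B * L) ^ k := by
  refine ContinuousMultilinearMap.opNorm_le_bound (by positivity) fun m => ?_
  rw [cplxTerm_apply]
  refine (norm_sum_le _ _).trans ?_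
  have : ∀ i ∈ (Finset.univ : Finset (Fin k → ι)),
      ‖((P k (fun j => b (i j)) : ℝ) : ℂ) * ∏ j, l (i j) (m j)‖ ≤
        ‖P k‖ * B ^ k * (L ^ k * ∏ j, ‖m j‖) := by
    intro i _
    rw [norm_mul]
    gcongr
    · rw [Complex.norm_real]
      refine ((P k).le_opNorm _).trans ?_
      gcongr
      refine (Finset.prod_le_prod (fun _ _ => norm_nonneg _) (fun j _ => hB (i j))).trans ?_
      simp
    · rw [norm_prod]
      have h2 : ∏ j, ‖l (i j) (m j)‖ ≤ ∏ j, (L * ‖m j‖) := by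
        refine Finset.prod_le_prod (fun _ _ => norm_nonneg _) (fun j _ => ?_)
        refine ((l (i j)).le_opNorm _).trans ?_
        gcongr
        exact hL _
      refine h2.trans ?_
      rw [Finset.prod_mul_distrib]
      simp
  refine (Finset.sum_le_sum this).trans ?_
  simp
  refine le_of_eq ?_
  ring

theorem cplx_exists (b : ι → E) (l : ι → W →L[ℂ] ℂ) (c : ι → E → ℝ)
    (hbc : ∀ y, y = ∑ i, c i y • b i) (κ : E → W) (hκ : ∀ y i, l i (κ y) = c i y)
    (hκc : Tendsto κ (𝓝 0) (𝓝 0))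
    (r : E → ℝ) (p : E) (hr : AnalyticAt ℝ r p) (w0 : W) :
    ∃ R : W → ℂ, AnalyticAt ℂ R w0 ∧ ∀ᶠ y in 𝓝 (0 : E), R (w0 + κ y) = r (p + y) := by
  obtain ⟨P, hP⟩ := hr
  obtain ⟨ρ, hρ⟩ := hP
  set Q := cplxTerm b l P with hQ
  have hQr : 0 < Q.radius := by
    set B := ∑ i, ‖b i‖
    set L := ∑ i, ‖l i‖
    have hB0 : 0 ≤ B := Finset.sum_nonneg fun _ _ => norm_nonneg _
    have hL0 : 0 ≤ L := Finset.sum_nonneg fun _ _ => norm_nonneg _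
    have hB : ∀ i, ‖b i‖ ≤ B := fun i =>
      Finset.single_le_sum (f := fun i => ‖b i‖) (fun _ _ => norm_nonneg _) (Finset.mem_univ i)
    have hL : ∀ i, ‖l i‖ ≤ L := fun i =>
      Finset.single_le_sum (f := fun i => ‖l i‖) (fun _ _ => norm_nonneg _) (Finset.mem_univ i)
    obtain ⟨C, a, hC, ha, hb⟩ := P.le_mul_pow_of_radius_pos (hρ.r_pos.trans_le hρ.r_le)
    set D := Fintype.card ι * B * L
    have hD : 0 ≤ D := by positivity
    have hpos : 0 < a * D + 1 := by positivity
    let ss : NNReal := ⟨(a * D + 1)⁻¹, by positivity⟩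
    have : (ss : ENNReal) ≤ Q.radius := by
      refine FormalMultilinearSeries.le_radius_of_bound _ C fun k => ?_
      have h1 : ‖Q k‖ ≤ C * (a * D + 1) ^ k := by
        refine (cplxTerm_norm b l P B L hB hL hB0 hL0 k).trans ?_
        calc ‖P k‖ * D ^ k ≤ C * a ^ k * D ^ k := by gcongr; exact hb k
          _ = C * (a * D) ^ k := by ring
          _ ≤ _ := by gcongr; linarith
      have h2 : (ss : ℝ) = (a * D + 1)⁻¹ := rfl
      rw [h2]
      calc ‖Q k‖ * (a * D + 1)⁻¹ ^ k ≤ C * (a * D + 1) ^ k * (a * D + 1)⁻¹ ^ k := by gcongr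
        _ = C := by rw [inv_pow]; field_simp
    refine lt_of_lt_of_le ?_ this
    rw [ENNReal.coe_pos]
    exact inv_pos.2 hpos
  have hsum := Q.hasFPowerSeriesOnBall hQr
  refine ⟨fun w => Q.sum (w - w0), ?_, ?_⟩
  · have h1 : AnalyticAt ℂ Q.sum (w0 - w0) := by rw [sub_self]; exact hsum.analyticAt
    exact h1.comp (f := fun w => w - w0) (analyticAt_id.sub analyticAt_const)
  · have e1 : ∀ᶠ y in 𝓝 (0 : E), κ y ∈ Metric.eball (0 : W) Q.radius :=
      hκc.eventually (Metric.eball_mem_nhds _ hQr)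
    have e2 : ∀ᶠ y in 𝓝 (0 : E), y ∈ Metric.eball (0 : E) ρ := Metric.eball_mem_nhds _ hρ.r_pos
    filter_upwards [e1, e2] with y h1 h2
    have s1 := hsum.hasSum h1
    have s2 := hρ.hasSum h2
    have s3 : HasSum (fun k => (((P k fun _ => y) : ℝ) : ℂ)) ((r (p + y) : ℝ) : ℂ) := by
      exact_mod_cast s2
    have : ∀ k, (Q k fun _ => κ y) = (((P k fun _ => y) : ℝ) : ℂ) := by
      intro k
      rw [hQ, cplxTerm_apply]
      conv_rhs => rw [hbc y]
      rw [ContinuousMultilinearMap.map_sum]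
      push_cast
      refine Finset.sum_congr rfl fun i _ => ?_
      rw [ContinuousMultilinearMap.map_smul_univ]
      simp only [hκ, smul_eq_mul]
      push_cast
      ring
    simp only [this] at s1
    simp only [add_sub_cancel_left]
    rw [zero_add] at s1
    exact s1.unique s3
end cplx

theorem complexify {N : ℕ} (r : (Fin N → ℂ) → ℝ) (p : Fin N → ℂ) (hr : AnalyticAt ℝ r p) :
    ∃ R : (Fin N → ℂ) × (Fin N → ℂ) → ℂ, AnalyticAt ℂ R (p, star p) ∧
      ∀ᶠ z in 𝓝 p, R (z, star z) = r z := by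
  let A : Fin N → ((Fin N → ℂ) × (Fin N → ℂ)) →L[ℂ] ℂ := fun j =>
    (ContinuousLinearMap.proj j).comp (ContinuousLinearMap.fst ℂ _ _)
  let B : Fin N → ((Fin N → ℂ) × (Fin N → ℂ)) →L[ℂ] ℂ := fun j =>
    (ContinuousLinearMap.proj j).comp (ContinuousLinearMap.snd ℂ _ _)
  let l : Fin N ⊕ Fin N → ((Fin N → ℂ) × (Fin N → ℂ)) →L[ℂ] ℂ :=
    Sum.elim (fun j => (1 / 2 : ℂ) • (A j + B j)) (fun j => (-I / 2 : ℂ) • (A j - B j))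
  let b : Fin N ⊕ Fin N → (Fin N → ℂ) :=
    Sum.elim (fun j => Pi.single j 1) (fun j => Pi.single j I)
  let c : Fin N ⊕ Fin N → (Fin N → ℂ) → ℝ := Sum.elim (fun j y => (y j).re) (fun j y => (y j).im)
  obtain ⟨R, hR, h⟩ := cplx_exists b l c (fun y => by
      ext j
      simp [b, c, Fintype.sum_sum_type, Finset.sum_apply, Pi.single_apply]
      ) (fun y => (y, star y)) (by
      rintro y (j | j) <;> simp [l, A, B, c, Complex.ext_iff] <;> ring) (by
      have : Continuous (fun y : Fin N → ℂ => (y, star y)) := by fun_prop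
      have h2 := this.tendsto 0
      rw [star_zero] at h2
      exact h2) r p hr (p, star p)
  refine ⟨R, hR, ?_⟩
  have ht : Tendsto (fun z => z - p) (𝓝 p) (𝓝 0) := by
    have : Continuous (fun z : Fin N → ℂ => z - p) := by fun_prop
    simpa using this.tendsto p
  filter_upwards [ht.eventually h] with z hz
  simpa using hz

theorem totally_real {N : ℕ} (h : (Fin N → ℂ) × (Fin N → ℂ) → ℂ) (q : Fin N → ℂ)
    (ha : AnalyticAt ℂ h (q, star q)) (hz : ∀ᶠ z in 𝓝 q, h (z, star z) = 0) :
    ∀ᶠ x in 𝓝 (q, star q), h x = 0 := by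
  obtain ⟨ε, hε, hb⟩ := Metric.eventually_nhds_iff_ball.1 ha.eventually_analyticAt
  obtain ⟨δ, hδ, hz⟩ := Metric.eventually_nhds_iff_ball.1 hz
  -- coordinates: x = (q + u + I v, star q + star u + I star v)
  let u : (Fin N → ℂ) × (Fin N → ℂ) → (Fin N → ℂ) :=
    fun x => (1 / 2 : ℂ) • ((x.1 - q) + star (x.2 - star q))
  let v : (Fin N → ℂ) × (Fin N → ℂ) → (Fin N → ℂ) :=
    fun x => (-I / 2 : ℂ) • ((x.1 - q) - star (x.2 - star q))
  have hu : Continuous u := by fun_prop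
  have hv : Continuous v := by fun_prop
  have hu0 : u (q, star q) = 0 := by simp [u]
  have hv0 : v (q, star q) = 0 := by simp [v]
  set m := min (ε / 4) (δ / 3) with hm
  have hm0 : 0 < m := by positivity
  have e1 : ∀ᶠ x in 𝓝 (q, star q), ‖u x‖ < m := by
    have := (hu.norm.tendsto (q, star q))
    rw [hu0, norm_zero] at this
    exact this.eventually (gt_mem_nhds hm0)
  have e2 : ∀ᶠ x in 𝓝 (q, star q), ‖v x‖ < m := by
    have := (hv.norm.tendsto (q, star q))
    rw [hv0, norm_zero] at this
    exact this.eventually (gt_mem_nhds hm0)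
  filter_upwards [e1, e2] with x h1 h2
  let w : ℂ → (Fin N → ℂ) × (Fin N → ℂ) := fun lam =>
    (q + u x + lam • v x, star q + star (u x) + lam • star (v x))
  have hw : AnalyticOnNhd ℂ w Set.univ := by
    intro z _
    exact (analyticAt_const.add (analyticAt_id.smul analyticAt_const)).prod
      (analyticAt_const.add (analyticAt_id.smul analyticAt_const))
  have hwb : ∀ lam ∈ Metric.ball (0 : ℂ) 2, w lam ∈ Metric.ball (q, star q) ε := by
    intro lam hl
    rw [mem_ball_zero_iff] at hl
    rw [Metric.mem_ball, Prod.dist_eq, max_lt_iff]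
    have h4 : m ≤ ε / 4 := min_le_left _ _
    have : ‖u x‖ + ‖lam‖ * ‖v x‖ < ε := by nlinarith [norm_nonneg (v x), norm_nonneg lam]
    constructor
    · rw [dist_eq_norm]
      have : w lam = (q + u x + lam • v x, star q + star (u x) + lam • star (v x)) := rfl
      rw [this]
      have : (q + u x + lam • v x) - q = u x + lam • v x := by abel
      simp only [this]
      refine (norm_add_le _ _).trans_lt ?_
      rw [norm_smul lam]; assumption
    · rw [dist_eq_norm]
      have : w lam = (q + u x + lam • v x, star q + star (u x) + lam • star (v x)) := rfl
      rw [this]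
      have : (star q + star (u x) + lam • star (v x)) - star q =
        star (u x) + lam • star (v x) := by abel
      simp only [this]
      refine (norm_add_le _ _).trans_lt ?_
      rw [norm_smul lam, norm_star, norm_star]; assumption
  have han : AnalyticOnNhd ℂ (fun lam => h (w lam)) (Metric.ball (0 : ℂ) 2) := by
    intro lam hl
    exact (hb _ (hwb lam hl)).comp (hw lam trivial)
  have hreal : ∀ s : ℝ, |s| < 2 → h (w s) = 0 := by
    intro s hs
    have : w s = (q + u x + (s : ℂ) • v x, star (q + u x + (s : ℂ) • v x)) := by
      simp [w, star_smul]
    rw [this]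
    apply hz
    rw [Metric.mem_ball, dist_eq_norm]
    have : (q + u x + (s : ℂ) • v x) - q = u x + (s : ℂ) • v x := by abel
    rw [this]
    refine (norm_add_le _ _).trans_lt ?_
    rw [norm_smul (s : ℂ), Complex.norm_real, Real.norm_eq_abs]
    have h4 : m ≤ δ / 3 := min_le_right _ _
    nlinarith [norm_nonneg (v x), abs_nonneg s]
  have hfr : ∃ᶠ z in 𝓝[≠] (0 : ℂ), h (w z) = 0 := by
    have ht : Tendsto (fun s : ℝ => (s : ℂ)) (𝓝[≠] 0) (𝓝[≠] 0) := by
      refine tendsto_nhdsWithin_iff.2 ⟨?_, ?_⟩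
      · have : Continuous (fun s : ℝ => (s : ℂ)) := Complex.continuous_ofReal
        simpa using (this.tendsto 0).mono_left nhdsWithin_le_nhds
      · filter_upwards [self_mem_nhdsWithin] with s hs
        simpa using hs
    refine ht.frequently (Eventually.frequently ?_)
    have : ∀ᶠ s : ℝ in 𝓝 0, |s| < 2 := by
      have := (continuous_abs.tendsto (0 : ℝ))
      rw [abs_zero] at this
      exact this.eventually (gt_mem_nhds two_pos)
    filter_upwards [this.filter_mono nhdsWithin_le_nhds] with s hs using hreal s hs
  have key := han.eqOn_zero_of_preconnected_of_frequently_eq_zero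
    (convex_ball (0 : ℂ) 2).isPreconnected (by simp) hfr
  have hI := key (show I ∈ Metric.ball (0 : ℂ) 2 by simp)
  have hx : w I = x := by
    refine Prod.ext ?_ ?_
    · ext j; simp [w, u, v]; linear_combination (-(1 / 2) * (x.1 j - q j - (starRingEnd ℂ) (x.2 j) + q j)) * Complex.I_sq
    · ext j; simp [w, u, v]; linear_combination ((1 / 2) * ((starRingEnd ℂ) (x.1 j) - (starRingEnd ℂ) (q j) - (x.2 j) + (starRingEnd ℂ) (q j))) * Complex.I_sq
  rw [← hx]
  exact hI

/-- nondegeneracy of the mixed second derivative -/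
def NDR {X Y : Type*} [NormedAddCommGroup X] [NormedSpace ℂ X] [NormedAddCommGroup Y]
    [NormedSpace ℂ Y] (R : X × Y → ℂ) (x : X × Y) : Prop :=
  ∀ u : Y, fderiv ℂ R x (0, u) = 0 →
    (∀ v : X, fderiv ℂ R x (v, 0) = 0 → fderiv ℂ (fderiv ℂ R) x (v, 0) (0, u) = 0) → u = 0

theorem real_fderiv_diag {N : ℕ} (h : (Fin N → ℂ) → ℂ) (H : (Fin N → ℂ) × (Fin N → ℂ) → ℂ)
    (p : Fin N → ℂ) (hH : AnalyticAt ℂ H (p, star p)) (hh : ∀ᶠ z in 𝓝 p, H (z, star z) = h z)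
    (v : Fin N → ℂ) : fderiv ℝ h p v = fderiv ℂ H (p, star p) (v, star v) := by
  have h1 : HasFDerivAt (𝕜 := ℝ) H ((fderiv ℂ H (p, star p)).restrictScalars ℝ) (p, star p) :=
    hH.differentiableAt.hasFDerivAt.restrictScalars ℝ
  let S : (Fin N → ℂ) →L[ℝ] (Fin N → ℂ) := 
    ((starL' ℝ : (Fin N → ℂ) ≃L[ℝ] (Fin N → ℂ)) : (Fin N → ℂ) →L[ℝ] (Fin N → ℂ))
  have h2 : HasFDerivAt (𝕜 := ℝ) (fun z : Fin N → ℂ => (z, star z))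
      ((ContinuousLinearMap.id ℝ _).prod S) p :=
    (hasFDerivAt_id p).prodMk (S.hasFDerivAt)
  have h3 := (h1.comp p h2).congr_of_eventuallyEq (f₁ := h) (by
    filter_upwards [hh] with z hz using hz.symm)
  rw [h3.fderiv]
  simp [S]

theorem wirt_diag {N : ℕ} (h : (Fin N → ℂ) → ℂ) (H : (Fin N → ℂ) × (Fin N → ℂ) → ℂ)
    (p : Fin N → ℂ) (hH : AnalyticAt ℂ H (p, star p)) (hh : ∀ᶠ z in 𝓝 p, H (z, star z) = h z)
    (j : Fin N) : wirtD N j h p = fderiv ℂ H (p, star p) (Pi.single j 1, 0) ∧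
      wirtDbar N j h p = fderiv ℂ H (p, star p) (0, Pi.single j 1) := by
  have hs1 : star (Pi.single j (1 : ℂ) : Fin N → ℂ) = Pi.single j 1 := by
    ext i; by_cases hi : i = j
    · subst hi; simp
    · simp [hi]
  have hs2 : star (Pi.single j I : Fin N → ℂ) = (-I) • Pi.single j 1 := by
    ext i; by_cases hi : i = j
    · subst hi; simp
    · simp [hi]
  have hs3 : (Pi.single j I : Fin N → ℂ) = I • Pi.single j 1 := by
    ext i; by_cases hi : i = j
    · subst hi; simp
    · simp [hi]
  have a1 : (((Pi.single j 1 : Fin N → ℂ), (Pi.single j 1 : Fin N → ℂ))) =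
      (Pi.single j 1, 0) + (0, Pi.single j 1) := by simp
  have a2 : (((Pi.single j I : Fin N → ℂ), ((-I) • Pi.single j 1 : Fin N → ℂ))) =
      I • (Pi.single j 1, 0) - I • (0, Pi.single j 1) := by
    rw [hs3]; simp
  have d1 := real_fderiv_diag h H p hH hh (Pi.single j 1)
  have d2 := real_fderiv_diag h H p hH hh (Pi.single j I)
  rw [hs1, a1, map_add] at d1
  rw [hs2, a2, map_sub, map_smul, map_smul, smul_eq_mul, smul_eq_mul] at d2
  unfold wirtD wirtDbar
  rw [d1, d2]
  constructor
  · linear_combination (1 / 2 * (fderiv ℂ H (p, star p) (0, Pi.single j 1) - fderiv ℂ H (p, star p) (Pi.single j 1, 0))) * Complex.I_sq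
  · linear_combination (-1 / 2 * (fderiv ℂ H (p, star p) (0, Pi.single j 1) - fderiv ℂ H (p, star p) (Pi.single j 1, 0))) * Complex.I_sq

section
variable {N : ℕ} (r : (Fin N → ℂ) → ℝ) (R : (Fin N → ℂ) × (Fin N → ℂ) → ℂ)
  (p : Fin N → ℂ) (hR : AnalyticAt ℂ R (p, star p)) (hr : ∀ᶠ z in 𝓝 p, R (z, star z) = r z)
include hR

theorem symm_second (a b : (Fin N → ℂ) × (Fin N → ℂ)) :
    fderiv ℂ (fderiv ℂ R) (p, star p) a b = fderiv ℂ (fderiv ℂ R) (p, star p) b a := by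
  have h : ContDiffAt ℂ 2 R (p, star p) := hR.contDiffAt
  exact (h.isSymmSndFDerivAt (by simp)) a b

include hr

theorem near_diag : ∀ᶠ z in 𝓝 p, AnalyticAt ℂ R (z, star z) ∧
    ∀ᶠ y in 𝓝 z, R (y, star y) = r y := by
  have hc : Continuous (fun z : Fin N → ℂ => (z, star z)) := by fun_prop
  exact ((hc.tendsto p).eventually hR.eventually_analyticAt).and hr.eventually_nhds

theorem levi_diag (j k : Fin N) : leviMatrix N r p j k =
    fderiv ℂ (fderiv ℂ R) (p, star p) (Pi.single j 1, 0) (0, Pi.single k 1) := by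
  have hR' : AnalyticAt ℂ (fderiv ℂ R) (p, star p) := hR.fderiv
  have h1 := (wirt_diag (fun q => wirtDbar N k (fun x => ((r x : ℂ))) q)
    (fun x => fderiv ℂ R x (0, Pi.single k 1)) p
    ((ContinuousLinearMap.apply ℂ ℂ (((0 : Fin N → ℂ), (Pi.single k 1 : Fin N → ℂ)))).analyticAt _ |>.comp hR')
    (by
      filter_upwards [near_diag r R p hR hr] with z hz
      exact ((wirt_diag _ R z hz.1 hz.2 k).2).symm) j).1
  unfold leviMatrix
  rw [h1]
  have := hR'.differentiableAt.hasFDerivAt.clm_apply (hasFDerivAt_const ((0 : Fin N → ℂ), (Pi.single k 1 : Fin N → ℂ)) (p, star p))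
  rw [this.fderiv]
  simp

theorem tangent_diag (v : Fin N → ℂ) : v ∈ complexTangent N r p ↔
    fderiv ℂ R (p, star p) (v, 0) = 0 := by
  unfold complexTangent
  simp only [Set.mem_ofPred_eq, (wirt_diag _ R p hR hr _).1]
  have : (v, (0 : Fin N → ℂ)) = ∑ j, v j • ((Pi.single j 1 : Fin N → ℂ), (0 : Fin N → ℂ)) := by
    refine Prod.ext ?_ ?_
    · ext i; simp [Prod.fst_sum, Finset.sum_apply, Pi.single_apply]
    · simp [Prod.snd_sum]
  rw [this, map_sum]
  simp only [map_smul, smul_eq_mul]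
  simp only [mul_comm]

theorem levisum_diag (v w : Fin N → ℂ) :
    ∑ j : Fin N, ∑ k : Fin N, leviMatrix N r p j k * v j * (starRingEnd ℂ) (w k) =
      fderiv ℂ (fderiv ℂ R) (p, star p) (v, 0) (0, star w) := by
  have h1 : (v, (0 : Fin N → ℂ)) = ∑ j, v j • ((Pi.single j 1 : Fin N → ℂ), (0 : Fin N → ℂ)) := by
    refine Prod.ext ?_ ?_
    · ext i; simp [Prod.fst_sum, Finset.sum_apply, Pi.single_apply]
    · simp [Prod.snd_sum]
  have h2 : ((0 : Fin N → ℂ), star w) =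
      ∑ j, (starRingEnd ℂ) (w j) • ((0 : Fin N → ℂ), (Pi.single j 1 : Fin N → ℂ)) := by
    refine Prod.ext ?_ ?_
    · simp [Prod.fst_sum]
    · ext i; simp [Prod.snd_sum, Finset.sum_apply, Pi.single_apply]
  rw [h1, h2, map_sum, map_sum, Finset.sum_comm]
  refine Finset.sum_congr rfl fun k _ => ?_
  simp only [levi_diag r R p hR hr, map_smul, smul_eq_mul, sum_apply, Finset.mul_sum]
  refine Finset.sum_congr rfl fun j _ => ?_
  simp; ring

theorem reality : ∀ᶠ x in 𝓝 (p, star p), star (R (star x.2, star x.1)) = R x := by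
  have h0 : AnalyticAt ℂ (fun x : (Fin N → ℂ) × (Fin N → ℂ) => R (x.2, x.1)) (star (p, star p)) := by
    refine AnalyticAt.comp (g := R) (f := fun x : (Fin N → ℂ) × (Fin N → ℂ) => (x.2, x.1)) ?_ ?_
    · simpa using hR
    · exact analyticAt_snd.prod analyticAt_fst
  have h1 := conj_analytic h0
  have := totally_real (fun x => star (R (star x.2, star x.1)) - R x) p (h1.sub hR) (by
    filter_upwards [hr] with z hz
    simp [hz])
  filter_upwards [this] with x hx
  exact sub_eq_zero.1 hx

theorem hermit (a b : (Fin N → ℂ) × (Fin N → ℂ)) :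
    fderiv ℂ R (p, star p) b = star (fderiv ℂ R (p, star p) (star b.2, star b.1)) ∧
    fderiv ℂ (fderiv ℂ R) (p, star p) a b =
      star (fderiv ℂ (fderiv ℂ R) (p, star p) (star a.2, star a.1) (star b.2, star b.1)) := by
  have hre := reality r R p hR hr
  have hswap : ∀ (f : (Fin N → ℂ) × (Fin N → ℂ) → ℂ) (x v : (Fin N → ℂ) × (Fin N → ℂ)),
      fderiv ℂ (fun y : (Fin N → ℂ) × (Fin N → ℂ) => f (y.2, y.1)) x v =
        fderiv ℂ f (x.2, x.1) (v.2, v.1) := by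
    intro f x v
    have := (ContinuousLinearEquiv.prodComm ℂ (Fin N → ℂ) (Fin N → ℂ)).comp_right_fderiv
      (f := f) (x := x)
    have h2 := congrArg (fun L => L v) this
    exact h2
  have hswa : ∀ (f : (Fin N → ℂ) × (Fin N → ℂ) → ℂ) (x : (Fin N → ℂ) × (Fin N → ℂ)),
      AnalyticAt ℂ f (x.2, x.1) →
      AnalyticAt ℂ (fun y : (Fin N → ℂ) × (Fin N → ℂ) => f (y.2, y.1)) x := by
    intro f x h
    exact AnalyticAt.comp (g := f) (f := fun x : (Fin N → ℂ) × (Fin N → ℂ) => (x.2, x.1)) h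
      (analyticAt_snd.prod analyticAt_fst)
  have hcs : Continuous (fun x : (Fin N → ℂ) × (Fin N → ℂ) => (star x.2, star x.1)) := by fun_prop
  have hfirst : ∀ᶠ x in 𝓝 (p, star p), ∀ b, fderiv ℂ R x b =
      star (fderiv ℂ R (star x.2, star x.1) (star b.2, star b.1)) := by
    have hcan : ∀ᶠ x in 𝓝 (p, star p), AnalyticAt ℂ R (star x.2, star x.1) := by
      have := hcs.tendsto (p, star p)
      simp only [star_star] at this
      exact this.eventually hR.eventually_analyticAt
    filter_upwards [hre.eventually_nhds, hcan] with x hx hxa b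
    have h3 : R =ᶠ[𝓝 x] (fun x => star (R (star x.2, star x.1))) := by
      filter_upwards [hx] with y hy using hy.symm
    rw [h3.fderiv_eq]
    have h4 := conj_fderiv (f := fun y : (Fin N → ℂ) × (Fin N → ℂ) => R (y.2, y.1)) (a := x)
      (hswa R _ hxa) b
    rw [hswap] at h4
    exact h4
  refine ⟨by simpa using hfirst.self_of_nhds b, ?_⟩
  have hR' : AnalyticAt ℂ (fderiv ℂ R) (p, star p) := hR.fderiv
  have hk : ∀ c, AnalyticAt ℂ (fun y => fderiv ℂ R y c) (p, star p) := fun c =>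
    ((ContinuousLinearMap.apply ℂ ℂ c).analyticAt _).comp hR'
  have hdd : ∀ a c, fderiv ℂ (fun y => fderiv ℂ R y c) (p, star p) a =
      fderiv ℂ (fderiv ℂ R) (p, star p) a c := by
    intro a c
    have := hR'.differentiableAt.hasFDerivAt.clm_apply (hasFDerivAt_const c (p, star p))
    rw [this.fderiv]
    simp
  rw [← hdd, ← hdd]
  have h3 : (fun y => fderiv ℂ R y b) =ᶠ[𝓝 (p, star p)]
      (fun x => star (fderiv ℂ R (star x.2, star x.1) (star b.2, star b.1))) := by
    filter_upwards [hfirst] with x hx using hx b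
  rw [h3.fderiv_eq]
  have h4 := conj_fderiv
    (f := fun y : (Fin N → ℂ) × (Fin N → ℂ) => fderiv ℂ R (y.2, y.1) (star b.2, star b.1))
    (a := (p, star p)) (hswa (fun y => fderiv ℂ R y (star b.2, star b.1)) _ (by
      simpa using hk (star b.2, star b.1))) a
  rw [hswap (fun y => fderiv ℂ R y (star b.2, star b.1))] at h4
  simpa using h4

theorem ndr_of_levi (hL : LeviNondeg N r p) : NDR R (p, star p) ∧
    NDR (fun x : (Fin N → ℂ) × (Fin N → ℂ) => R (x.2, x.1)) (star p, p) := by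
  have hswap : ∀ (x v : (Fin N → ℂ) × (Fin N → ℂ)),
      fderiv ℂ (fun y : (Fin N → ℂ) × (Fin N → ℂ) => R (y.2, y.1)) x v =
        fderiv ℂ R (x.2, x.1) (v.2, v.1) := by
    intro x v
    have := (ContinuousLinearEquiv.prodComm ℂ (Fin N → ℂ) (Fin N → ℂ)).comp_right_fderiv
      (f := R) (x := x)
    exact congrArg (fun L => L v) this
  have hR' : AnalyticAt ℂ (fderiv ℂ R) (p, star p) := hR.fderiv
  have hswap2 : ∀ (a v : (Fin N → ℂ) × (Fin N → ℂ)),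
      fderiv ℂ (fderiv ℂ (fun y : (Fin N → ℂ) × (Fin N → ℂ) => R (y.2, y.1))) (star p, p) a v =
        fderiv ℂ (fderiv ℂ R) (p, star p) (a.2, a.1) (v.2, v.1) := by
    intro a v
    have e : (fderiv ℂ (fun y : (Fin N → ℂ) × (Fin N → ℂ) => R (y.2, y.1))) =
        fun x => (fderiv ℂ R ((ContinuousLinearEquiv.prodComm ℂ (Fin N → ℂ) (Fin N → ℂ)) x)).comp
        ((ContinuousLinearEquiv.prodComm ℂ (Fin N → ℂ) (Fin N → ℂ)) :
          ((Fin N → ℂ) × (Fin N → ℂ)) →L[ℂ] ((Fin N → ℂ) × (Fin N → ℂ))) := by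
      ext x v <;> simp [hswap] <;> rfl
    rw [e]
    have h1 : HasFDerivAt (fderiv ℂ R) (fderiv ℂ (fderiv ℂ R) (p, star p))
      ((ContinuousLinearEquiv.prodComm ℂ (Fin N → ℂ) (Fin N → ℂ)) (star p, p)) :=
      hR'.differentiableAt.hasFDerivAt
    have h2 := h1.comp (star p, p)
      (ContinuousLinearEquiv.prodComm ℂ (Fin N → ℂ) (Fin N → ℂ)).hasFDerivAt
    have h3 := h2.clm_comp (hasFDerivAt_const ((ContinuousLinearEquiv.prodComm ℂ (Fin N → ℂ) (Fin N → ℂ)) :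
          ((Fin N → ℂ) × (Fin N → ℂ)) →L[ℂ] ((Fin N → ℂ) × (Fin N → ℂ))) (star p, p))
    have h4 := h3.fderiv
    rw [Function.comp_def] at h4
    rw [h4]
    simp
    rfl
  have base : ∀ v, fderiv ℂ R (p, star p) (v, 0) = 0 →
      (∀ u, fderiv ℂ R (p, star p) (0, u) = 0 →
        fderiv ℂ (fderiv ℂ R) (p, star p) (v, 0) (0, u) = 0) → v = 0 := by
    intro v hv hu
    refine hL v ((tangent_diag r R p hR hr v).2 hv) fun w hw => ?_
    rw [levisum_diag r R p hR hr]
    apply hu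
    rw [(hermit r R p hR hr 0 _).1]
    simpa using (tangent_diag r R p hR hr w).1 hw
  constructor
  · intro u hu h
    have : star u = 0 := by
      refine base _ ?_ fun w hw => ?_
      · rw [(hermit r R p hR hr 0 _).1]; simpa using hu
      · rw [(hermit r R p hR hr _ _).2]
        simp only [star_zero, star_star]
        rw [symm_second R p hR, h, star_zero]
        rw [(hermit r R p hR hr 0 _).1]; simpa using hw
    simpa using this
  · intro u hu h
    simp only [hswap, hswap2] at hu h
    refine base u hu fun w hw => ?_
    rw [symm_second R p hR]
    exact h w hw

end

section half
variable {X Y : Type*} [NormedAddCommGroup X] [NormedSpace ℂ X] [FiniteDimensional ℂ X]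
  [NormedAddCommGroup Y] [NormedSpace ℂ Y] [FiniteDimensional ℂ Y]

structure Half (R : X × Y → ℂ) (e : X) (t : X × Y → ℂ) (D : Set (X × Y)) : Prop where
  op : IsOpen D
  anR : ∀ x ∈ D, AnalyticAt ℂ R x
  anT : ∀ x ∈ D, AnalyticAt ℂ t x
  re : ∀ x ∈ D, fderiv ℂ R x (e, 0) ≠ 0
  zero : ∀ x ∈ D, R x = 0 → t x = 0
  proj : ∀ x ∈ D, R (x.1 + t x • e, x.2) = 0
  nd : ∀ x ∈ D, R x = 0 → ∀ u : Y,
    (∀ᶠ z in 𝓝 x.1, R (z, x.2) = 0 → fderiv ℂ R (z, x.2) (0, u) = 0) → u = 0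

theorem Half.mono {R : X × Y → ℂ} {e : X} {t : X × Y → ℂ} {D D' : Set (X × Y)}
    (h : Half R e t D) (ho : IsOpen D') (hs : D' ⊆ D) : Half R e t D' :=
  ⟨ho, fun x hx => h.anR x (hs hx), fun x hx => h.anT x (hs hx), fun x hx => h.re x (hs hx),
    fun x hx => h.zero x (hs hx), fun x hx => h.proj x (hs hx), fun x hx => h.nd x (hs hx)⟩

theorem half_exists (R : X × Y → ℂ) (e : X) (x0 : X × Y) (hR : AnalyticAt ℂ R x0) (h0 : R x0 = 0)
    (he : fderiv ℂ R x0 (e, 0) ≠ 0) (hnd : NDR R x0) :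
    ∃ t D, x0 ∈ D ∧ Half R e t D := by
  have : CompleteSpace X := FiniteDimensional.complete ℂ X
  have : CompleteSpace Y := FiniteDimensional.complete ℂ Y
  let A : (X × Y) × ℂ →L[ℂ] X × Y :=
    ContinuousLinearMap.fst ℂ _ _ + (ContinuousLinearMap.inl ℂ X Y).comp
      ((ContinuousLinearMap.snd ℂ (X × Y) ℂ).smulRight e)
  have hA : ∀ x τ, A (x, τ) = (x.1 + τ • e, x.2) := by
    intro x τ; refine Prod.ext ?_ ?_ <;> simp [A]
  have hA0 : A (x0, 0) = x0 := by rw [hA]; simp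
  have hRA : AnalyticAt ℂ R (A (x0, 0)) := by rw [hA0]; exact hR
  have hf : AnalyticAt ℂ (fun w => R (A w)) (x0, 0) := hRA.comp (A.analyticAt _)
  have hfd : ∀ y, fderiv ℂ (fun w => R (A w)) (x0, 0) (0, y) = y * fderiv ℂ R x0 (e, 0) := by
    intro y
    have := (hRA.differentiableAt.hasFDerivAt.comp (x0, 0) A.hasFDerivAt)
    rw [Function.comp_def] at this
    rw [this.fderiv, hA0]
    simp only [ContinuousLinearMap.comp_apply, hA]
    have : ((0 : X × Y).1 + y • e, (0 : X × Y).2) = y • (e, (0 : Y)) := by simp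
    rw [this, map_smul, smul_eq_mul]
  obtain ⟨t, htan, ht0, hu, hs⟩ := an_ift (𝕜 := ℂ) (fun w => R (A w)) x0 (0 : ℂ) hf
    (by simp only [hA0, h0]) (by
      simp only [hfd]
      constructor
      · intro a b hab
        exact mul_right_cancel₀ he hab
      · intro b
        exact ⟨b / fderiv ℂ R x0 (e, 0), by field_simp⟩)
  simp only [hA] at hs
  let P : X × Y → X × Y := fun x => A (x, t x)
  have hPan : AnalyticAt ℂ P x0 := (A.analyticAt _).comp (analyticAt_id.prod htan)
  have hP0 : P x0 = x0 := by simp only [P, ht0, hA0]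
  have hPc : Tendsto P (𝓝 x0) (𝓝 x0) := by
    have := hPan.continuousAt.tendsto
    rwa [hP0] at this
  have hR' : AnalyticAt ℂ (fderiv ℂ R) (P x0) := by rw [hP0]; exact hR.fderiv
  let cI : (X × Y →L[ℂ] ℂ) →L[ℂ] (Y →L[ℂ] ℂ) :=
    (ContinuousLinearMap.compL ℂ Y (X × Y) ℂ).flip (ContinuousLinearMap.inr ℂ X Y)
  let ψ : X × Y → (Y →L[ℂ] ℂ) := fun x => cI (fderiv ℂ R (P x))
  have hψ : ∀ x u, ψ x u = fderiv ℂ R (P x) (0, u) := fun x u => rfl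
  have hψan : AnalyticAt ℂ ψ x0 := (cI.analyticAt _).comp (hR'.comp hPan)
  let L : X × Y → (Y →L[ℂ] ℂ × (X →L[ℂ] ℂ)) := fun x =>
    (ψ x).prod ((fderiv ℂ ψ x).comp (ContinuousLinearMap.inl ℂ X Y)).flip
  have hLc : ContinuousAt L x0 := by
    have h1 : ContinuousAt (fun x => fderiv ℂ ψ x) x0 := hψan.fderiv.continuousAt
    have h2 : ContinuousAt (fun x => (fderiv ℂ ψ x).comp (ContinuousLinearMap.inl ℂ X Y)) x0 := by
      fun_prop
    have h3 := (ContinuousLinearMap.flipₗᵢ ℂ X Y ℂ).continuous.continuousAt.comp h2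
    have h4 := hψan.continuousAt.prodMk h3
    have h5 := (ContinuousLinearMap.prodₗᵢ ℂ (𝕜 := ℂ) (E := Y) (F := ℂ) (G := X →L[ℂ] ℂ)).continuous.continuousAt.comp h4
    exact h5
  have htd : ∀ v : X, fderiv ℂ R x0 (v, 0) = 0 → fderiv ℂ t x0 (v, 0) = 0 := by
    intro v hv
    have h1 : HasFDerivAt (fun x => R (P x)) ((fderiv ℂ R x0).comp (fderiv ℂ P x0)) x0 := by
      have : HasFDerivAt R (fderiv ℂ R x0) (P x0) := by
        rw [hP0]; exact hR.differentiableAt.hasFDerivAt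
      exact this.comp x0 hPan.differentiableAt.hasFDerivAt
    have h2 : HasFDerivAt P (A.comp ((ContinuousLinearMap.id ℂ _).prod (fderiv ℂ t x0))) x0 :=
      A.hasFDerivAt.comp x0 ((hasFDerivAt_id x0).prodMk htan.differentiableAt.hasFDerivAt)
    have h3 : (fun x => R (P x)) =ᶠ[𝓝 x0] fun _ => (0 : ℂ) := by
      filter_upwards [hs] with x hx
      simp only [P, hA, hx]
    have h4 := h1.fderiv
    rw [h3.fderiv_eq, h2.fderiv] at h4
    have h5 := congrArg (fun T => T (v, 0)) h4
    simp only [fderiv_fun_const, Pi.zero_apply, zero_apply,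
      ContinuousLinearMap.comp_apply, ContinuousLinearMap.prod_apply, hA, ContinuousLinearMap.id_apply] at h5
    have h6 : (v + (fderiv ℂ t x0 (v, 0)) • e, (0 : Y)) =
        (v, 0) + (fderiv ℂ t x0 (v, 0)) • (e, (0 : Y)) := by simp
    rw [h6, map_add, hv, map_smul, zero_add, smul_eq_mul] at h5
    exact (mul_eq_zero.1 h5.symm).resolve_right he
  have hLi : Function.Injective (L x0) := by
    refine (injective_iff_map_eq_zero (L x0)).2 fun u hu0 => ?_
    have e1 : ψ x0 u = 0 := congrArg Prod.fst hu0
    have e2 : ∀ v, fderiv ℂ ψ x0 (v, 0) u = 0 := fun v =>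
      congrArg (fun w : ℂ × (X →L[ℂ] ℂ) => w.2 v) hu0
    rw [hψ, hP0] at e1
    refine hnd u e1 fun v hv => ?_
    have h2 : HasFDerivAt P (A.comp ((ContinuousLinearMap.id ℂ _).prod (fderiv ℂ t x0))) x0 :=
      A.hasFDerivAt.comp x0 ((hasFDerivAt_id x0).prodMk htan.differentiableAt.hasFDerivAt)
    have h3 := cI.hasFDerivAt.comp x0 (hR'.differentiableAt.hasFDerivAt.comp x0 h2)
    have h4 := e2 v
    have h5 : fderiv ℂ ψ x0 = _ := h3.fderiv
    rw [h5, hP0] at h4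
    simp only [ContinuousLinearMap.comp_apply, ContinuousLinearMap.prod_apply, hA,
      ContinuousLinearMap.id_apply, htd v hv, zero_smul, add_zero] at h4
    exact h4
  have hLev : ∀ᶠ x in 𝓝 x0, Function.Injective (L x) :=
    hLc.eventually (ContinuousLinearMap.isOpen_injective.mem_nhds hLi)
  have hzero : ∀ᶠ x in 𝓝 x0, R x = 0 → t x = 0 := by
    have hc : Continuous (fun x : X × Y => (x, (0 : ℂ))) := by fun_prop
    filter_upwards [(hc.tendsto x0).eventually hu] with x hx hx0
    refine hx.1 ?_
    rw [hA]; simpa using hx0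
  have hre : ∀ᶠ x in 𝓝 x0, fderiv ℂ R x (e, 0) ≠ 0 := by
    have : ContinuousAt (fun x => fderiv ℂ R x (e, 0)) x0 :=
      hR.fderiv.continuousAt.clm_apply continuousAt_const
    exact this.eventually_ne he
  have hall := hR.eventually_analyticAt.and (htan.eventually_analyticAt.and (hre.and
    (hzero.and (hs.and (hLev.and hψan.eventually_analyticAt)))))
  obtain ⟨D, hD, hDo, hxD⟩ := eventually_nhds_iff.1 hall
  refine ⟨t, D, hxD, hDo, fun x hx => (hD x hx).1, fun x hx => (hD x hx).2.1,
    fun x hx => (hD x hx).2.2.1, fun x hx => (hD x hx).2.2.2.1, fun x hx => (hD x hx).2.2.2.2.1, ?_⟩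
  intro x hx hx0 u hu0
  obtain ⟨-, hxt, -, hxz, hxs, hxL, hxψ⟩ := hD x hx
  have htx := hxz hx0
  have hc : Continuous (fun z : X => (z, x.2)) := by fun_prop
  have hPx : ContinuousAt P x := 
    ((A.analyticAt _).comp (analyticAt_id.prod hxt) : AnalyticAt ℂ P x).continuousAt
  have hPx1 : Tendsto (fun z => (P (z, x.2)).1) (𝓝 x.1) (𝓝 x.1) := by
    have h1 : ContinuousAt (fun z => (P (z, x.2)).1) x.1 := by
      have : ContinuousAt (fun z : X => P (z, x.2)) x.1 :=
        ContinuousAt.comp (g := P) (f := fun z : X => (z, x.2)) hPx hc.continuousAt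
      exact continuousAt_fst.comp this
    have h2 : (P (x.1, x.2)).1 = x.1 := by simp [P, hA, htx]
    have h3 := h1.tendsto
    rwa [h2] at h3
  have hDz : ∀ᶠ z in 𝓝 x.1, (z, x.2) ∈ D := (hc.tendsto x.1).eventually (hDo.mem_nhds hx)
  have hvan : ∀ᶠ z in 𝓝 x.1, ψ (z, x.2) u = 0 := by
    filter_upwards [hPx1.eventually hu0, hDz] with z hz hzD
    rw [hψ]
    have h1 : P (z, x.2) = ((P (z, x.2)).1, x.2) := by simp only [P, hA]
    rw [h1]
    refine hz ?_
    have := (hD _ hzD).2.2.2.2.1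
    simpa only [P, hA] using this
  refine (injective_iff_map_eq_zero (L x)).1 hxL u ?_
  refine Prod.ext hvan.self_of_nhds ?_
  ext v
  change fderiv ℂ ψ x (v, 0) u = 0
  have h1 : HasFDerivAt ψ (fderiv ℂ ψ x) (x.1, x.2) := hxψ.differentiableAt.hasFDerivAt
  have h2 : HasFDerivAt (fun z : X => (z, x.2)) (ContinuousLinearMap.inl ℂ X Y) x.1 := by
    simpa using hasFDerivAt_prodMk_left (𝕜 := ℂ) x.1 x.2
  have h3 := (h1.comp x.1 h2).clm_apply (hasFDerivAt_const u x.1)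
  have h4 : (fun y : X => (ψ ∘ fun z => (z, x.2)) y u) =ᶠ[𝓝 x.1] fun _ => (0 : ℂ) := hvan
  have h5 := h3.fderiv
  rw [h4.fderiv_eq] at h5
  have h6 := congrArg (fun T => T v) h5
  simpa using h6.symm
end half

theorem an_clm_apply {E F G : Type*} [NormedAddCommGroup E] [NormedSpace ℂ E]
    [NormedAddCommGroup F] [NormedSpace ℂ F] [NormedAddCommGroup G] [NormedSpace ℂ G]
    {f : E → F →L[ℂ] G} {g : E → F} {x : E} (hf : AnalyticAt ℂ f x) (hg : AnalyticAt ℂ g x) :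
    AnalyticAt ℂ (fun y => f y (g y)) x :=
  AnalyticAt.comp (g := fun q : (F →L[ℂ] G) × F => q.1 q.2) (f := fun y => (f y, g y))
    ((ContinuousLinearMap.id ℂ (F →L[ℂ] G)).analyticAt_bilinear (f x, g x)) (hf.prod hg)

section dot
variable {E : Type*} [NormedAddCommGroup E] [NormedSpace ℂ E] {ι : Type*} [Fintype ι]

theorem fderiv_dot {f g : E → ι → ℂ} {f' g' : E →L[ℂ] (ι → ℂ)} {x : E}
    (hf : HasFDerivAt f f' x) (hg : HasFDerivAt g g' x) (w : E) :
    fderiv ℂ (fun y => f y ⬝ᵥ g y) x w = f' w ⬝ᵥ g x + f x ⬝ᵥ g' w := by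
  have h : HasFDerivAt (fun y => f y ⬝ᵥ g y)
      (∑ i, (f x i • (ContinuousLinearMap.proj i).comp g' + g x i • (ContinuousLinearMap.proj i).comp f')) x := by
    unfold dotProduct
    exact HasFDerivAt.fun_sum fun i _ => (hasFDerivAt_pi'.1 hf i).mul (hasFDerivAt_pi'.1 hg i)
  rw [h.fderiv]
  simp [dotProduct, Finset.sum_add_distrib, sum_apply, mul_comm, add_comm]

theorem analytic_dot {f g : E → ι → ℂ} {x : E}
    (hf : AnalyticAt ℂ f x) (hg : AnalyticAt ℂ g x) :
    AnalyticAt ℂ (fun y => f y ⬝ᵥ g y) x := by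
  unfold dotProduct
  exact Finset.analyticAt_fun_sum _ fun i _ =>
    (analyticAt_pi_iff.1 hf i).mul (analyticAt_pi_iff.1 hg i)
end dot

/-- generalized cross product -/
noncomputable def cross {m : ℕ} (X : Fin m → Fin (m + 1) → ℂ) : Fin (m + 1) → ℂ := fun i =>
  (-1) ^ (i : ℕ) * (Matrix.of fun a b => X a (i.succAbove b) : Matrix (Fin m) (Fin m) ℂ).det

theorem cross_dot {m : ℕ} (X : Fin m → Fin (m + 1) → ℂ) (Y : Fin (m + 1) → ℂ) :
    cross X ⬝ᵥ Y = (Matrix.of (Fin.cons Y X : Fin (m + 1) → Fin (m + 1) → ℂ)).det := by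
  rw [Matrix.det_succ_row_zero]
  unfold dotProduct cross
  refine Finset.sum_congr rfl fun i _ => ?_
  have : (Matrix.of (Fin.cons Y X : Fin (m + 1) → Fin (m + 1) → ℂ)).submatrix Fin.succ i.succAbove =
      (Matrix.of fun a b => X a (i.succAbove b) : Matrix (Fin m) (Fin m) ℂ) := by
    ext a b; simp
  rw [this]
  simp
  ring

theorem cross_orth {m : ℕ} (X : Fin m → Fin (m + 1) → ℂ) (i : Fin m) : cross X ⬝ᵥ X i = 0 := by
  rw [cross_dot]
  refine Matrix.det_zero_of_row_eq (i := 0) (j := i.succ) (Fin.succ_ne_zero i).symm ?_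
  ext; simp

theorem cross_ne {m : ℕ} (X : Fin m → Fin (m + 1) → ℂ) (Y : Fin (m + 1) → ℂ)
    (h : ∀ v : Fin (m + 1) → ℂ, v ⬝ᵥ Y = 0 → (∀ i, v ⬝ᵥ X i = 0) → v = 0) : cross X ≠ 0 := by
  intro h0
  have h1 := cross_dot X Y
  rw [h0, zero_dotProduct] at h1
  obtain ⟨v, hv, hv0⟩ := Matrix.exists_mulVec_eq_zero_iff.2 h1.symm
  refine hv (h v ?_ fun i => ?_)
  · have := congrFun hv0 0
    rw [dotProduct_comm]
    simpa [Matrix.mulVec] using this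
  · have := congrFun hv0 i.succ
    rw [dotProduct_comm]
    simpa [Matrix.mulVec] using this

theorem prop_of_orth {m : ℕ} (X : Fin m → Fin (m + 1) → ℂ) (Y : Fin (m + 1) → ℂ)
    (h : ∀ v : Fin (m + 1) → ℂ, v ⬝ᵥ Y = 0 → (∀ i, v ⬝ᵥ X i = 0) → v = 0)
    (G G' : Fin (m + 1) → ℂ) (hG : ∀ i, G ⬝ᵥ X i = 0) (hG' : ∀ i, G' ⬝ᵥ X i = 0) (h0 : G' ≠ 0) :
    ∃ c : ℂ, G = c • G' := by
  have hne : G' ⬝ᵥ Y ≠ 0 := fun h1 => h0 (h _ h1 hG')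
  refine ⟨(G ⬝ᵥ Y) / (G' ⬝ᵥ Y), ?_⟩
  rw [← sub_eq_zero]
  refine h _ ?_ fun i => ?_
  · rw [sub_dotProduct, smul_dotProduct, smul_eq_mul]; field_simp; simp
  · rw [sub_dotProduct, smul_dotProduct, hG, hG']; simp

theorem cross_analytic {E : Type*} [NormedAddCommGroup E] [NormedSpace ℂ E] {m : ℕ}
    {X : E → Fin m → Fin (m + 1) → ℂ} {x : E} (h : ∀ i, AnalyticAt ℂ (fun y => X y i) x) :
    AnalyticAt ℂ (fun y => cross (X y)) x := by
  refine analyticAt_pi_iff.2 fun i => ?_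
  unfold cross
  refine analyticAt_const.mul ?_
  simp only [Matrix.det_apply]
  refine Finset.analyticAt_fun_sum _ fun σ _ => ?_
  have : ∀ y, (Equiv.Perm.sign σ • ∏ a, Matrix.of (fun a b => X y a (i.succAbove b)) (σ a) a) =
    ((Equiv.Perm.sign σ : ℤ) : ℂ) * ∏ a, X y (σ a) (i.succAbove a) := by
    intro y; simp [Units.smul_def]
  simp only [this]
  refine analyticAt_const.mul ?_
  refine Finset.analyticAt_fun_prod _ fun a _ => ?_
  exact analyticAt_pi_iff.1 (h (σ a)) _

section imm
variable {X Y : Type*} [NormedAddCommGroup X] [NormedSpace ℂ X] [FiniteDimensional ℂ X]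
  [NormedAddCommGroup Y] [NormedSpace ℂ Y] [FiniteDimensional ℂ Y] {n : ℕ}

def Imm (F : X → Fin (n + 2) → ℂ) (ζ : X) : Prop :=
  ∀ (h : X) (c : ℂ), fderiv ℂ F ζ h + c • F ζ = 0 → h = 0 ∧ c = 0

def SRel (R : X × Y → ℂ) (F : X → Fin (n + 2) → ℂ) (G : Y → Fin (n + 2) → ℂ) (x0 : X × Y) : Prop :=
  ∀ᶠ x in 𝓝 x0, R x = 0 → F x.1 ⬝ᵥ G x.2 = 0

theorem Imm.ne_zero {F : X → Fin (n + 2) → ℂ} {ζ : X} (h : Imm F ζ) : F ζ ≠ 0 := by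
  intro h0
  have := (h 0 1 (by simp [h0])).2
  simp at this

noncomputable def immMap (F : X → Fin (n + 2) → ℂ) (ζ : X) : X × ℂ →L[ℂ] (Fin (n + 2) → ℂ) :=
  (fderiv ℂ F ζ).coprod ((ContinuousLinearMap.id ℂ ℂ).smulRight (F ζ))

theorem imm_iff (F : X → Fin (n + 2) → ℂ) (ζ : X) : Imm F ζ ↔ Function.Injective (immMap F ζ) := by
  rw [injective_iff_map_eq_zero (immMap F ζ)]
  constructor
  · rintro h ⟨a, c⟩ hac
    have := h a c (by simpa [immMap] using hac)
    simp [this.1, this.2]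
  · intro h a c hac
    have := h (a, c) (by simpa [immMap] using hac)
    simpa using this

theorem Imm.surj (hX : Module.finrank ℂ X = n + 1) {F : X → Fin (n + 2) → ℂ} {ζ : X}
    (h : Imm F ζ) (w : Fin (n + 2) → ℂ) : ∃ (a : X) (c : ℂ), fderiv ℂ F ζ a + c • F ζ = w := by
  have hi := (imm_iff F ζ).1 h
  have hs : Function.Surjective (immMap F ζ).toLinearMap := by
    refine (LinearMap.injective_iff_surjective_of_finrank_eq_finrank ?_).1 hi
    simp [hX]
  obtain ⟨⟨a, c⟩, hac⟩ := hs w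
  exact ⟨a, c, by simpa [immMap] using hac⟩

theorem Imm.eventually {F : X → Fin (n + 2) → ℂ} {ζ : X} (hF : AnalyticAt ℂ F ζ)
    (h : Imm F ζ) : ∀ᶠ z in 𝓝 ζ, Imm F z := by
  have hc : ContinuousAt (immMap F) ζ := by
    have e : immMap F = fun z => (fderiv ℂ F z).comp (ContinuousLinearMap.fst ℂ X ℂ) +
        (ContinuousLinearMap.snd ℂ X ℂ).smulRight (F z) := by
      ext z i <;> simp [immMap]
    rw [e]
    have h1 := hF.fderiv.continuousAt
    have h2 := hF.continuousAt
    have h3 : ContinuousAt (fun z => (ContinuousLinearMap.snd ℂ X ℂ).smulRight (F z)) ζ :=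
      ((ContinuousLinearMap.smulRightL ℂ (X × ℂ) (Fin (n + 2) → ℂ)
        (ContinuousLinearMap.snd ℂ X ℂ)).continuous.continuousAt).comp h2
    exact (h1.clm_comp continuousAt_const).add h3
  filter_upwards [hc.eventually (ContinuousLinearMap.isOpen_injective.mem_nhds ((imm_iff F ζ).1 h))]
    with z hz using (imm_iff F z).2 hz

def Spans (e : X) (b : Fin n → X) : Prop := ∀ v : X, ∃ (c : ℂ) (d : Fin n → ℂ), v = c • e + ∑ j, d j • b j

noncomputable def rows (F : X → Fin (n + 2) → ℂ) (e : X) (b : Fin n → X) (t : X × Y → ℂ)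
    (x : X × Y) : Fin (n + 1) → Fin (n + 2) → ℂ :=
  Fin.cons (F x.1) (fun j => fderiv ℂ F x.1 (b j + (fderiv ℂ t x (b j, 0)) • e))

theorem rows_gen (hX : Module.finrank ℂ X = n + 1) {F : X → Fin (n + 2) → ℂ} {e : X} {b : Fin n → X}
    (hb : Spans e b) (t : X × Y → ℂ) (x : X × Y) (h : Imm F x.1) (v : Fin (n + 2) → ℂ)
    (h0 : v ⬝ᵥ fderiv ℂ F x.1 e = 0) (h1 : ∀ i, v ⬝ᵥ rows F e b t x i = 0) : v = 0 := by
  have hF : v ⬝ᵥ F x.1 = 0 := by simpa [rows] using h1 0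
  have hbj : ∀ j, v ⬝ᵥ fderiv ℂ F x.1 (b j) = 0 := by
    intro j
    have := h1 j.succ
    simp only [rows, Fin.cons_succ, map_add, map_smul, dotProduct_add, dotProduct_smul, h0,
      smul_zero, add_zero] at this
    exact this
  refine dotProduct_eq_zero v fun w => ?_
  obtain ⟨a, c, hac⟩ := h.surj hX w
  obtain ⟨c', d, hd⟩ := hb a
  rw [← hac, hd]
  simp [dotProduct_add, dotProduct_smul, h0, hF, dotProduct_sum, hbj]

theorem rows_analytic {F : X → Fin (n + 2) → ℂ} (e : X) (b : Fin n → X) {t : X × Y → ℂ}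
    {x : X × Y} (hF : AnalyticAt ℂ F x.1) (ht : AnalyticAt ℂ t x) (i : Fin (n + 1)) :
    AnalyticAt ℂ (fun y => rows F e b t y i) x := by
  refine Fin.cases ?_ (fun j => ?_) i
  · simp only [rows, Fin.cons_zero]
    exact hF.comp analyticAt_fst
  · simp only [rows, Fin.cons_succ]
    have h1 : AnalyticAt ℂ (fun y : X × Y => fderiv ℂ F y.1) x := hF.fderiv.comp analyticAt_fst
    have h2 : AnalyticAt ℂ (fun y : X × Y => fderiv ℂ t y (b j, 0)) x :=
      ((ContinuousLinearMap.apply ℂ ℂ ((b j, (0 : Y)))).analyticAt _).comp ht.fderiv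
    have h3 : AnalyticAt ℂ (fun y : X × Y => b j + (fderiv ℂ t y (b j, 0)) • e) x :=
      analyticAt_const.add (h2.smul analyticAt_const)
    exact an_clm_apply h1 h3

variable {R : X × Y → ℂ} {e : X} {t : X × Y → ℂ} {D : Set (X × Y)}

def prj (e : X) (t : X × Y → ℂ) (x : X × Y) : X := x.1 + t x • e

theorem Half.prj_analytic (H : Half R e t D) {x : X × Y} (hx : x ∈ D) :
    AnalyticAt ℂ (prj e t) x :=
  analyticAt_fst.add ((H.anT x hx).smul analyticAt_const)

theorem Half.prj_eq (H : Half R e t D) {x : X × Y} (hx : x ∈ D) (h0 : R x = 0) :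
    prj e t x = x.1 := by simp [prj, H.zero x hx h0]

theorem Half.prj_fderiv (H : Half R e t D) {x : X × Y} (hx : x ∈ D) (w : X × Y) :
    fderiv ℂ (prj e t) x w = w.1 + (fderiv ℂ t x w) • e := by
  have h := (hasFDerivAt_fst (𝕜 := ℂ) (p := x)).add
    ((H.anT x hx).differentiableAt.hasFDerivAt.smul_const e)
  have h2 : fderiv ℂ (prj e t) x = _ := h.fderiv
  rw [h2]; simp

theorem Half.prj2_tendsto (H : Half R e t D) {x : X × Y} (hx : x ∈ D) (h0 : R x = 0) :
    Tendsto (fun y => (prj e t y, y.2)) (𝓝 x) (𝓝 x) := by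
  have h1 : ContinuousAt (fun y => (prj e t y, y.2)) x :=
    (H.prj_analytic hx).continuousAt.prodMk continuousAt_snd
  have h2 := h1.tendsto
  rw [H.prj_eq hx h0] at h2
  exact h2

theorem Half.t_fderiv (H : Half R e t D) {x : X × Y} (hx : x ∈ D) (h0 : R x = 0) (w : X × Y) :
    fderiv ℂ R x (w.1 + (fderiv ℂ t x w) • e, w.2) = 0 := by
  have h1 : (fun y => R (prj e t y, y.2)) =ᶠ[𝓝 x] fun _ => (0 : ℂ) := by
    filter_upwards [H.op.mem_nhds hx] with y hy using H.proj y hy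
  have h2 : HasFDerivAt R (fderiv ℂ R x) (prj e t x, x.2) := by
    rw [H.prj_eq hx h0]; exact (H.anR x hx).differentiableAt.hasFDerivAt
  have h3 := h2.comp x ((H.prj_analytic hx).differentiableAt.hasFDerivAt.prodMk hasFDerivAt_snd)
  have h4 := h3.fderiv
  have h5 : fderiv ℂ (fun y => R (prj e t y, y.2)) x = _ := h4
  rw [h1.fderiv_eq] at h5
  have h6 := congrArg (fun T => T w) h5
  simp only [fderiv_fun_const, Pi.zero_apply, zero_apply, ContinuousLinearMap.comp_apply,
    ContinuousLinearMap.prod_apply, H.prj_fderiv hx] at h6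
  exact h6.symm

theorem Half.rel_prj (H : Half R e t D) {x : X × Y} (hx : x ∈ D) (h0 : R x = 0)
    {F : X → Fin (n + 2) → ℂ} {G : Y → Fin (n + 2) → ℂ} (hr : SRel R F G x) :
    ∀ᶠ y in 𝓝 x, F (prj e t y) ⬝ᵥ G y.2 = 0 := by
  filter_upwards [(H.prj2_tendsto hx h0).eventually hr, H.op.mem_nhds hx] with y hy hyD
  exact hy (H.proj y hyD)

theorem Half.relD (H : Half R e t D) {x : X × Y} (hx : x ∈ D) (h0 : R x = 0)
    {F : X → Fin (n + 2) → ℂ} {G : Y → Fin (n + 2) → ℂ} (hF : AnalyticAt ℂ F x.1)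
    (hG : AnalyticAt ℂ G x.2) (hr : SRel R F G x) (w : X × Y) :
    fderiv ℂ F x.1 (w.1 + (fderiv ℂ t x w) • e) ⬝ᵥ G x.2 + F x.1 ⬝ᵥ fderiv ℂ G x.2 w.2 = 0 := by
  have h1 : (fun y => F (prj e t y) ⬝ᵥ G y.2) =ᶠ[𝓝 x] fun _ => (0 : ℂ) := H.rel_prj hx h0 hr
  have h2 : HasFDerivAt F (fderiv ℂ F x.1) (prj e t x) := by
    rw [H.prj_eq hx h0]; exact hF.differentiableAt.hasFDerivAt
  have h3 := h2.comp x (H.prj_analytic hx).differentiableAt.hasFDerivAt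
  have h4 := hG.differentiableAt.hasFDerivAt.comp x hasFDerivAt_snd
  have h5 := fderiv_dot h3 h4 w
  have h6 : fderiv ℂ (fun y => F (prj e t y) ⬝ᵥ G y.2) x w = _ := h5
  rw [h1.fderiv_eq] at h6
  simp only [fderiv_fun_const, Pi.zero_apply, zero_apply, ContinuousLinearMap.comp_apply,
    H.prj_fderiv hx, Function.comp_apply, H.prj_eq hx h0] at h6
  exact h6.symm

theorem imm_transfer (hX : Module.finrank ℂ X = n + 1) {b : Fin n → X} (hb : Spans e b)
    (H : Half R e t D) {x : X × Y} (hx : x ∈ D) (h0 : R x = 0)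
    {F : X → Fin (n + 2) → ℂ} {G : Y → Fin (n + 2) → ℂ} (hF : AnalyticAt ℂ F x.1)
    (hFi : Imm F x.1) (hG : AnalyticAt ℂ G x.2) (hG0 : G x.2 ≠ 0) (hr : SRel R F G x) :
    Imm G x.2 := by
  intro u c huc
  have hu : u = 0 := by
    refine H.nd x hx h0 u ?_
    have hne : fderiv ℂ F x.1 e ⬝ᵥ G x.2 ≠ 0 := by
      intro h1
      refine hG0 (rows_gen hX hb t x hFi _ (by rwa [dotProduct_comm]) fun i => ?_)
      rw [dotProduct_comm]
      refine Fin.cases ?_ (fun j => ?_) i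
      · simpa [rows] using hr.self_of_nhds h0
      · have := H.relD hx h0 hF hG hr (b j, 0)
        simpa [rows] using this
    have hc : Continuous (fun z : X => (z, x.2)) := by fun_prop
    have hne' : ∀ᶠ z in 𝓝 x.1, fderiv ℂ F z e ⬝ᵥ G x.2 ≠ 0 := by
      have : ContinuousAt (fun z => fderiv ℂ F z e ⬝ᵥ G x.2) x.1 := by
        have h2 : AnalyticAt ℂ (fun z => fderiv ℂ F z e) x.1 :=
          an_clm_apply hF.fderiv analyticAt_const
        exact (analytic_dot h2 analyticAt_const).continuousAt
      exact this.eventually_ne hne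
    filter_upwards [hne', hF.eventually_analyticAt, (hc.tendsto x.1).eventually hr.eventually_nhds,
      (hc.tendsto x.1).eventually (H.op.mem_nhds hx)] with z hz hFz hrz hzD hz0
    have h1 := H.relD hzD hz0 hFz hG hrz (0, u)
    have h2 : F z ⬝ᵥ G x.2 = 0 := hrz.self_of_nhds hz0
    have h3 : fderiv ℂ G x.2 u = -(c • G x.2) := eq_neg_of_add_eq_zero_left huc
    simp only [zero_add, h3, dotProduct_neg, dotProduct_smul, h2, mul_zero, neg_zero, add_zero,
      map_smul, smul_dotProduct, smul_eq_mul] at h1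
    have h4 := (mul_eq_zero.1 h1).resolve_right hz
    have h5 := H.t_fderiv hzD hz0 (0, u)
    simpa [h4] using h5
  refine ⟨hu, ?_⟩
  rw [hu, map_zero, zero_add] at huc
  exact (smul_eq_zero.1 huc).resolve_right hG0
end imm

section ext
variable {X Y : Type*} [NormedAddCommGroup X] [NormedSpace ℂ X] [FiniteDimensional ℂ X]
  [NormedAddCommGroup Y] [NormedSpace ℂ Y] [FiniteDimensional ℂ Y] {n : ℕ}
  {R : X × Y → ℂ} {e : X} {t : X × Y → ℂ} {D : Set (X × Y)}

noncomputable def ghat (F : X → Fin (n + 2) → ℂ) (e : X) (b : Fin n → X) (t : X × Y → ℂ)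
    (x : X × Y) : Fin (n + 2) → ℂ := cross (rows F e b t x)

theorem ghat_analytic {F : X → Fin (n + 2) → ℂ} (e : X) (b : Fin n → X) {t : X × Y → ℂ}
    {x : X × Y} (hF : AnalyticAt ℂ F x.1) (ht : AnalyticAt ℂ t x) :
    AnalyticAt ℂ (ghat F e b t) x :=
  cross_analytic (fun i => rows_analytic e b hF ht i)

theorem ghat_ne (hX : Module.finrank ℂ X = n + 1) {F : X → Fin (n + 2) → ℂ} {b : Fin n → X}
    (hb : Spans e b) (t : X × Y → ℂ) (x : X × Y) (h : Imm F x.1) : ghat F e b t x ≠ 0 :=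
  cross_ne _ (fderiv ℂ F x.1 e) (rows_gen hX hb t x h)

/-- near the starting point the constructed map is proportional to the given one -/
theorem ghat_prop (hX : Module.finrank ℂ X = n + 1) {b : Fin n → X} (hb : Spans e b)
    (H : Half R e t D) {F : X → Fin (n + 2) → ℂ} {G0 : Y → Fin (n + 2) → ℂ}
    {x0 : X × Y} (hx0 : x0 ∈ D) (hF : AnalyticAt ℂ F x0.1)
    (hFi : Imm F x0.1) (hG : AnalyticAt ℂ G0 x0.2) (hG0 : G0 x0.2 ≠ 0) (hr : SRel R F G0 x0) :
    ∀ᶠ x in 𝓝 x0, R x = 0 → ∃ c : ℂ, ghat F e b t x = c • G0 x.2 := by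
  have c1 : Tendsto (fun x : X × Y => x.1) (𝓝 x0) (𝓝 x0.1) := continuous_fst.tendsto x0
  have c2 : Tendsto (fun x : X × Y => x.2) (𝓝 x0) (𝓝 x0.2) := continuous_snd.tendsto x0
  filter_upwards [H.op.mem_nhds hx0, c1.eventually hF.eventually_analyticAt,
    c1.eventually (hFi.eventually hF), c2.eventually hG.eventually_analyticAt,
    c2.eventually (hG.continuousAt.eventually_ne hG0), hr.eventually_nhds] with x hxD hFx hFix hGx hGx0 hrx h0
  refine prop_of_orth (rows F e b t x) (fderiv ℂ F x.1 e) (rows_gen hX hb t x hFix) _ _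
    (fun i => cross_orth _ i) (fun i => ?_) hGx0
  rw [dotProduct_comm]
  refine Fin.cases ?_ (fun j => ?_) i
  · simpa [rows] using hrx.self_of_nhds h0
  · have := H.relD hxD h0 hFx hGx hrx (b j, 0)
    simpa [rows] using this

theorem ext_lemma (hX : Module.finrank ℂ X = n + 1) {b : Fin n → X} (hb : Spans e b)
    (H : Half R e t D) {F : X → Fin (n + 2) → ℂ} {G0 : Y → Fin (n + 2) → ℂ}
    (K : Set (X × Y)) (hK : IsPreconnected K) (hKD : K ⊆ D) (hK0 : ∀ x ∈ K, R x = 0)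
    (hF : ∀ x ∈ K, AnalyticAt ℂ F x.1) (hFi : ∀ x ∈ K, Imm F x.1)
    (x0 : X × Y) (hx0 : x0 ∈ K)
    (hG : AnalyticAt ℂ G0 x0.2) (hG0 : G0 x0.2 ≠ 0) (hr : SRel R F G0 x0)
    (x : X × Y) (hx : x ∈ K) (β : Y → X) (hβ : AnalyticAt ℂ β x.2) (hβx : β x.2 = x.1)
    (hβR : ∀ᶠ η in 𝓝 x.2, R (β η, η) = 0) :
    AnalyticAt ℂ (fun η => ghat F e b t (β η, η)) x.2 ∧
    Imm (fun η => ghat F e b t (β η, η)) x.2 ∧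
    SRel R F (fun η => ghat F e b t (β η, η)) x := by
  let Ψ : X × Y × X → ℂ := fun w =>
    F (prj e t (w.2.2, w.2.1)) ⬝ᵥ ghat F e b t (prj e t (w.1, w.2.1), w.2.1)
  let j : X × Y → X × Y × X := fun x => (x.1, x.2, x.1)
  have hj : Continuous j := by fun_prop
  have hpre : IsPreconnected (j '' K) := hK.image j hj.continuousOn
  have hΨan : ∀ w ∈ j '' K, AnalyticAt ℂ Ψ w := by
    rintro _ ⟨y, hy, rfl⟩
    have a1 : AnalyticAt ℂ (fun w : X × Y × X => (w.2.2, w.2.1)) (j y) :=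
      (analyticAt_snd.comp analyticAt_snd).prod (analyticAt_fst.comp analyticAt_snd)
    have a2 : AnalyticAt ℂ (fun w : X × Y × X => (w.1, w.2.1)) (j y) :=
      analyticAt_fst.prod (analyticAt_fst.comp analyticAt_snd)
    have a3 : AnalyticAt ℂ (fun w : X × Y × X => prj e t (w.2.2, w.2.1)) (j y) :=
      AnalyticAt.comp (g := prj e t) (H.prj_analytic (hKD hy)) a1
    have a4 : AnalyticAt ℂ (fun w : X × Y × X => (prj e t (w.1, w.2.1), w.2.1)) (j y) :=
      (AnalyticAt.comp (g := prj e t) (H.prj_analytic (hKD hy)) a2).prod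
        (analyticAt_fst.comp analyticAt_snd)
    have hp : prj e t y = y.1 := H.prj_eq (hKD hy) (hK0 y hy)
    refine analytic_dot ?_ ?_
    · refine AnalyticAt.comp (g := F) ?_ a3
      change AnalyticAt ℂ F (prj e t y)
      rw [hp]; exact hF y hy
    · refine AnalyticAt.comp (g := ghat F e b t) ?_ a4
      change AnalyticAt ℂ (ghat F e b t) (prj e t y, y.2)
      rw [hp]; exact ghat_analytic e b (hF y hy) (H.anT y (hKD hy))
  have hΨ0 : ∀ᶠ w in 𝓝 (j x0), Ψ w = 0 := by
    have hp := H.prj2_tendsto (hKD hx0) (hK0 x0 hx0)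
    have t1 : Tendsto (fun w : X × Y × X => (w.2.2, w.2.1)) (𝓝 (j x0)) (𝓝 x0) := by
      have : Continuous (fun w : X × Y × X => (w.2.2, w.2.1)) := by fun_prop
      exact this.tendsto (j x0)
    have t2 : Tendsto (fun w : X × Y × X => (w.1, w.2.1)) (𝓝 (j x0)) (𝓝 x0) := by
      have : Continuous (fun w : X × Y × X => (w.1, w.2.1)) := by fun_prop
      exact this.tendsto (j x0)
    filter_upwards [(hp.comp t2).eventually (ghat_prop hX hb H (hKD hx0) (hF x0 hx0) (hFi x0 hx0) hG hG0 hr),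
      t1.eventually (H.rel_prj (hKD hx0) (hK0 x0 hx0) hr), t2.eventually (H.op.mem_nhds (hKD hx0))]
      with w h1 h2 h3
    obtain ⟨c, hc⟩ := h1 (H.proj _ h3)
    change F (prj e t (w.2.2, w.2.1)) ⬝ᵥ ghat F e b t (prj e t (w.1, w.2.1), w.2.1) = 0
    have hc' : ghat F e b t (prj e t (w.1, w.2.1), w.2.1) = c • G0 w.2.1 := hc
    rw [hc', dotProduct_smul]
    have h2' : F (prj e t (w.2.2, w.2.1)) ⬝ᵥ G0 w.2.1 = 0 := h2
    rw [h2', smul_zero]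
  have hΨx := an_ident Ψ (j '' K) hpre hΨan (j x0) ⟨x0, hx0, rfl⟩ hΨ0 (j x) ⟨x, hx, rfl⟩
  have hβp : AnalyticAt ℂ (fun η => (β η, η)) x.2 := hβ.prod analyticAt_id
  have hβ2 : (β x.2, x.2) = x := by rw [hβx]
  have hGan : AnalyticAt ℂ (fun η => ghat F e b t (β η, η)) x.2 := by
    refine AnalyticAt.comp (g := ghat F e b t) ?_ hβp
    rw [hβ2]; exact ghat_analytic e b (hF x hx) (H.anT x (hKD hx))
  have hrel : SRel R F (fun η => ghat F e b t (β η, η)) x := by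
    have t0 : Tendsto (fun y : X × Y => y.2) (𝓝 x) (𝓝 x.2) := continuous_snd.tendsto x
    have t1 : Tendsto (fun y : X × Y => (β y.2, y.2)) (𝓝 x) (𝓝 x) := by
      have h1 := hβp.continuousAt.tendsto
      rw [hβ2] at h1
      exact h1.comp t0
    have t2 : Tendsto (fun y : X × Y => (β y.2, y.2, y.1)) (𝓝 x) (𝓝 (j x)) := by
      have h1 : Tendsto (fun y : X × Y => (β y.2, y.2, y.1)) (𝓝 x) (𝓝 (x.1, x.2, x.1)) := by
        refine Tendsto.prodMk_nhds ?_ (Tendsto.prodMk_nhds t0 (continuous_fst.tendsto x))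
        exact (continuous_fst.tendsto x).comp t1
      exact h1
    filter_upwards [t2.eventually hΨx, t1.eventually (H.op.mem_nhds (hKD hx)),
      H.op.mem_nhds (hKD hx), t0.eventually hβR] with y h1 h2 h3 h4 h5
    have h6 : F (prj e t (y.1, y.2)) ⬝ᵥ ghat F e b t (prj e t (β y.2, y.2), y.2) = 0 := h1
    rw [H.prj_eq h2 h4, H.prj_eq h3 h5] at h6
    exact h6
  refine ⟨hGan, ?_, hrel⟩
  refine imm_transfer hX hb H (hKD hx) (hK0 x hx) (hF x hx) (hFi x hx) hGan ?_ hrel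
  simp only [hβ2]
  exact ghat_ne hX hb t x (hFi x hx)
end ext

section geo
variable {X Y : Type*} [NormedAddCommGroup X] [NormedSpace ℂ X] [FiniteDimensional ℂ X]
  [NormedAddCommGroup Y] [NormedSpace ℂ Y] [FiniteDimensional ℂ Y]
  {R : X × Y → ℂ} {e : X} {t : X × Y → ℂ} {D : Set (X × Y)}

theorem geo (hY : 2 ≤ Module.finrank ℂ Y) (H : Half R e t D) (p : X) (p' : Y) (hp : (p, p') ∈ D)
    (h0 : R (p, p') = 0) (e' : Y) (he' : fderiv ℂ R (p, p') (0, e') ≠ 0) (ρ : ℝ) (hρ : 0 < ρ) :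
    ∃ z3 : X, dist z3 p < ρ ∧ (z3, p') ∈ D ∧ R (z3, p') = 0 ∧ ∃ η2 : X × Y × X → Y,
      ∀ᶠ w in 𝓝 (p, p', z3), AnalyticAt ℂ η2 w ∧ dist (η2 w) p' < ρ ∧ R (w.1, η2 w) = 0 ∧
        R (w.2.2, η2 w) = 0 ∧ (R (w.1, w.2.1) = 0 → R (w.2.2, w.2.1) = 0 → η2 w = w.2.1) := by
  have : CompleteSpace X := FiniteDimensional.complete ℂ X
  have : CompleteSpace Y := FiniteDimensional.complete ℂ Y
  obtain ⟨e2, he2, he20⟩ : ∃ e2 : Y, e2 ≠ 0 ∧ fderiv ℂ R (p, p') (0, e2) = 0 := by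
    let f : Y →ₗ[ℂ] ℂ := ((fderiv ℂ R (p, p')).comp (ContinuousLinearMap.inr ℂ X Y)).toLinearMap
    have hk : f.ker ≠ ⊥ := LinearMap.ker_ne_bot_of_finrank_lt (by rw [Module.finrank_self]; omega)
    obtain ⟨v, hv, hv0⟩ := (Submodule.ne_bot_iff _).1 hk
    exact ⟨v, hv0, hv⟩
  have hfreq : ∃ᶠ z in 𝓝 p, R (z, p') = 0 ∧ fderiv ℂ R (z, p') (0, e2) ≠ 0 := by
    intro hcon
    refine he2 (H.nd (p, p') hp h0 e2 ?_)
    filter_upwards [hcon] with z hz hz0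
    by_contra hne
    exact hz ⟨hz0, hne⟩
  have hc : Continuous (fun z : X => (z, p')) := by fun_prop
  have hev : ∀ᶠ z in 𝓝 p, dist z p < ρ ∧ (z, p') ∈ D :=
    Eventually.and (Metric.ball_mem_nhds p hρ) ((hc.tendsto p).eventually (H.op.mem_nhds hp))
  obtain ⟨z3, ⟨hz30, hz3e⟩, hz3d, hz3D⟩ := (hfreq.and_eventually hev).exists
  refine ⟨z3, hz3d, hz3D, hz30, ?_⟩
  -- the affine family of points
  let T : (X × Y × X) × (ℂ × ℂ) → Y := fun w => w.1.2.1 + (w.2.1 • e' + w.2.2 • e2)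
  let A : (X × Y × X) × (ℂ × ℂ) → X × Y := fun w => (w.1.1, T w)
  let B : (X × Y × X) × (ℂ × ℂ) → X × Y := fun w => (w.1.2.2, T w)
  have hT : ∀ w, AnalyticAt ℂ T w := by
    intro w
    have a1 : AnalyticAt ℂ (fun w : (X × Y × X) × (ℂ × ℂ) => w.1.2.1) w :=
      analyticAt_fst.comp (analyticAt_snd.comp analyticAt_fst)
    have a2 : AnalyticAt ℂ (fun w : (X × Y × X) × (ℂ × ℂ) => w.2.1) w :=
      analyticAt_fst.comp analyticAt_snd
    have a3 : AnalyticAt ℂ (fun w : (X × Y × X) × (ℂ × ℂ) => w.2.2) w :=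
      analyticAt_snd.comp analyticAt_snd
    exact a1.add ((a2.smul analyticAt_const).add (a3.smul analyticAt_const))
  have hA : ∀ w, AnalyticAt ℂ A w := fun w => (analyticAt_fst.comp analyticAt_fst).prod (hT w)
  have hB : ∀ w, AnalyticAt ℂ B w := fun w =>
    (analyticAt_snd.comp (analyticAt_snd.comp analyticAt_fst)).prod (hT w)
  let w0 : (X × Y × X) × (ℂ × ℂ) := ((p, p', z3), (0, 0))
  have hT0 : T w0 = p' := by simp [T, w0]
  have hA0 : A w0 = (p, p') := by simp only [A, hT0, w0]
  have hB0 : B w0 = (z3, p') := by simp only [B, hT0, w0]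
  have hRA : AnalyticAt ℂ R (A w0) := by rw [hA0]; exact H.anR _ hp
  have hRB : AnalyticAt ℂ R (B w0) := by rw [hB0]; exact H.anR _ hz3D
  have hΞ : AnalyticAt ℂ (fun w => (R (A w), R (B w))) w0 :=
    (hRA.comp (hA w0)).prod (hRB.comp (hB w0))
  have hline : ∀ (f : (X × Y × X) × (ℂ × ℂ) → X × Y), AnalyticAt ℂ f w0 →
      (∀ c : ℂ × ℂ, ∀ s : ℂ, f (w0 + s • (0, c)) = f w0 + s • ((0 : X), c.1 • e' + c.2 • e2)) →
      ∀ c, fderiv ℂ f w0 (0, c) = ((0 : X), c.1 • e' + c.2 • e2) := by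
    intro f hf hfs c
    have h1 : HasDerivAt (fun s : ℂ => w0 + s • ((0 : X × Y × X), c)) ((0 : X × Y × X), c) 0 := by
      simpa using ((hasDerivAt_id (0 : ℂ)).smul_const ((0 : X × Y × X), c)).const_add w0
    have h2 : HasFDerivAt f (fderiv ℂ f w0) (w0 + (0 : ℂ) • ((0 : X × Y × X), c)) := by
      simpa using hf.differentiableAt.hasFDerivAt
    have h3 := h2.comp_hasDerivAt (0 : ℂ) h1
    have h4 : HasDerivAt (fun s : ℂ => f w0 + s • ((0 : X), c.1 • e' + c.2 • e2))
        ((0 : X), c.1 • e' + c.2 • e2) 0 := by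
      simpa using ((hasDerivAt_id (0 : ℂ)).smul_const ((0 : X), c.1 • e' + c.2 • e2)).const_add (f w0)
    have h5 : (f ∘ fun s : ℂ => w0 + s • ((0 : X × Y × X), c)) =
      (fun s : ℂ => f w0 + s • ((0 : X), c.1 • e' + c.2 • e2)) := by
      funext s; exact hfs c s
    rw [h5] at h3
    exact h3.unique h4
  have hAd := hline A (hA w0) (by
    intro c s
    simp only [A, T, w0]
    refine Prod.ext ?_ ?_
    · simp
    · simp [mul_smul])
  have hBd := hline B (hB w0) (by
    intro c s
    simp only [B, T, w0]
    refine Prod.ext ?_ ?_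
    · simp
    · simp [mul_smul])
  have hd : ∀ c, fderiv ℂ (fun w => (R (A w), R (B w))) w0 (0, c) =
      (fderiv ℂ R (p, p') (0, c.1 • e' + c.2 • e2), fderiv ℂ R (z3, p') (0, c.1 • e' + c.2 • e2)) := by
    intro c
    have h1 := hRA.differentiableAt.hasFDerivAt.comp w0 (hA w0).differentiableAt.hasFDerivAt
    have h2 := hRB.differentiableAt.hasFDerivAt.comp w0 (hB w0).differentiableAt.hasFDerivAt
    have h3 : fderiv ℂ (fun w => (R (A w), R (B w))) w0 = _ := (h1.prodMk h2).fderiv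
    rw [h3]
    simp only [ContinuousLinearMap.prod_apply, ContinuousLinearMap.comp_apply, hAd, hBd, hA0, hB0]
  have hlin : ∀ (q : X) (c : ℂ × ℂ), fderiv ℂ R (q, p') (0, c.1 • e' + c.2 • e2) =
      c.1 * fderiv ℂ R (q, p') (0, e') + c.2 * fderiv ℂ R (q, p') (0, e2) := by
    intro q c
    have : ((0 : X), c.1 • e' + c.2 • e2) = c.1 • ((0 : X), e') + c.2 • ((0 : X), e2) := by simp
    rw [this, map_add, map_smul, map_smul, smul_eq_mul, smul_eq_mul]
  obtain ⟨g, hg, hg0, hu, hs⟩ := an_ift (𝕜 := ℂ) (fun w => (R (A w), R (B w))) (p, p', z3)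
    ((0 : ℂ), (0 : ℂ)) hΞ (by
      change (R (A w0), R (B w0)) = 0
      rw [hA0, hB0, h0, hz30]; rfl) (by
      have hd' : (fun c => fderiv ℂ (fun w => (R (A w), R (B w))) ((p, p', z3), ((0 : ℂ), (0 : ℂ))) (0, c)) =
        fun c => (c.1 * fderiv ℂ R (p, p') (0, e'),
          c.1 * fderiv ℂ R (z3, p') (0, e') + c.2 * fderiv ℂ R (z3, p') (0, e2)) := by
        funext c
        rw [show ((p, p', z3), ((0 : ℂ), (0 : ℂ))) = w0 from rfl, hd, hlin, hlin, he20]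
        simp
      rw [hd']
      constructor
      · rintro ⟨a, b⟩ ⟨a', b'⟩ hab
        simp only [Prod.mk.injEq] at hab
        have e1 : a = a' := mul_right_cancel₀ he' hab.1
        subst e1
        have e2 := mul_right_cancel₀ hz3e (add_left_cancel hab.2)
        rw [e2]
      · rintro ⟨a, b⟩
        refine ⟨(a / fderiv ℂ R (p, p') (0, e'),
          (b - a / fderiv ℂ R (p, p') (0, e') * fderiv ℂ R (z3, p') (0, e')) / fderiv ℂ R (z3, p') (0, e2)), ?_⟩
        refine Prod.ext ?_ ?_
        · simp only; field_simp
        · simp only; field_simp; ring)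
  let η2 : X × Y × X → Y := fun w => T (w, g w)
  have hη : AnalyticAt ℂ η2 (p, p', z3) :=
    AnalyticAt.comp (g := T) (f := fun w => (w, g w)) (hT _) (analyticAt_id.prod hg)
  have hη0 : η2 (p, p', z3) = p' := by simp only [η2, hg0]; exact hT0
  refine ⟨η2, ?_⟩
  have hdist : ∀ᶠ w in 𝓝 (p, p', z3), dist (η2 w) p' < ρ := by
    have := hη.continuousAt.tendsto
    rw [hη0] at this
    exact this.eventually (Metric.ball_mem_nhds p' hρ)
  have hc0 : Continuous (fun w : X × Y × X => (w, ((0 : ℂ), (0 : ℂ)))) := by fun_prop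
  filter_upwards [hη.eventually_analyticAt, hdist, hs, (hc0.tendsto (p, p', z3)).eventually hu]
    with w h1 h2 h3 h4
  refine ⟨h1, h2, congrArg Prod.fst h3, congrArg Prod.snd h3, fun h5 h6 => ?_⟩
  have h7 : g w = (0, 0) := by
    refine h4.1 ?_
    refine Prod.ext ?_ ?_
    · simpa [A, T] using h5
    · simpa [B, T] using h6
  simp [η2, T, h7]
end geo

section loc
variable {X Y : Type*} [NormedAddCommGroup X] [NormedSpace ℂ X] [FiniteDimensional ℂ X]
  [NormedAddCommGroup Y] [NormedSpace ℂ Y] [FiniteDimensional ℂ Y] {n : ℕ}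
  {R : X × Y → ℂ} {e : X} {t : X × Y → ℂ} {D : Set (X × Y)}
  {e' : Y} {s : Y × X → ℂ} {D' : Set (Y × X)}

theorem fderiv_swap (R : X × Y → ℂ) (x v : Y × X) :
    fderiv ℂ (fun y : Y × X => R (y.2, y.1)) x v = fderiv ℂ R (x.2, x.1) (v.2, v.1) := by
  have := (ContinuousLinearEquiv.prodComm ℂ Y X).comp_right_fderiv (f := R) (x := x)
  exact congrArg (fun L => L v) this

theorem SRel.swap {F : X → Fin (n + 2) → ℂ} {G : Y → Fin (n + 2) → ℂ} {x : X × Y}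
    (h : SRel R F G x) : SRel (fun y : Y × X => R (y.2, y.1)) G F (x.2, x.1) := by
  have hc : Continuous (fun y : Y × X => (y.2, y.1)) := by fun_prop
  have := (hc.tendsto (x.2, x.1)).eventually h
  filter_upwards [this] with y hy h0
  rw [dotProduct_comm]
  exact hy h0

theorem SRel.unswap {F : X → Fin (n + 2) → ℂ} {G : Y → Fin (n + 2) → ℂ} {x : Y × X}
    (h : SRel (fun y : Y × X => R (y.2, y.1)) G F x) : SRel R F G (x.2, x.1) := by
  have hc : Continuous (fun y : X × Y => (y.2, y.1)) := by fun_prop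
  have := (hc.tendsto (x.2, x.1)).eventually h
  filter_upwards [this] with y hy h0
  rw [dotProduct_comm]
  exact hy h0

theorem prop_local (hn : 1 ≤ n) (hX : Module.finrank ℂ X = n + 1) (hY : Module.finrank ℂ Y = n + 1)
    (p : X) (p' : Y) (h0 : R (p, p') = 0)
    (H : Half R e t D) (hp : (p, p') ∈ D) {b : Fin n → X} (hb : Spans e b)
    (H' : Half (fun y : Y × X => R (y.2, y.1)) e' s D') (hp' : (p', p) ∈ D')
    {b' : Fin n → Y} (hb' : Spans e' b') :
    ∃ δ > 0, ∀ q q', dist q p < δ → dist q' p' < δ → R (q, q') = 0 →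
      ∀ (F0 : X → Fin (n + 2) → ℂ) (G0 : Y → Fin (n + 2) → ℂ), AnalyticAt ℂ F0 q → Imm F0 q →
        AnalyticAt ℂ G0 q' → G0 q' ≠ 0 → SRel R F0 G0 (q, q') →
        ∃ Gt : Y → Fin (n + 2) → ℂ, (∀ η ∈ Metric.ball p' δ, AnalyticAt ℂ Gt η ∧ Imm Gt η) ∧
          ∀ᶠ η in 𝓝 q', ∃ c : ℂ, Gt η = c • G0 η := by
  have he' : fderiv ℂ R (p, p') (0, e') ≠ 0 := by
    have := H'.re (p', p) hp'
    rwa [fderiv_swap] at this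
  have hsw : Continuous (fun y : X × Y => (y.2, y.1)) := by fun_prop
  obtain ⟨ρ0, hρ0, hball0⟩ := Metric.eventually_nhds_iff_ball.1
    (Eventually.and (H.op.mem_nhds hp) ((hsw.tendsto (p, p')).eventually (H'.op.mem_nhds hp')))
  have hDD : ∀ z η, dist z p < ρ0 → dist η p' < ρ0 → (z, η) ∈ D ∧ (η, z) ∈ D' := by
    intro z η hz hη
    refine hball0 (z, η) ?_
    rw [Metric.mem_ball, Prod.dist_eq]
    exact max_lt hz hη
  have hprj : ∀ᶠ y in 𝓝 (p, p'), dist (prj e t y) p < ρ0 := by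
    have := (H.prj_analytic hp).continuousAt.tendsto
    rw [H.prj_eq hp h0] at this
    exact this.eventually (Metric.ball_mem_nhds p hρ0)
  obtain ⟨ρ2, hρ2, hball2⟩ := Metric.eventually_nhds_iff_ball.1 hprj
  obtain ⟨ρ1, hρ1, hρ10, hρ12⟩ : ∃ ρ1 > 0, ρ1 ≤ ρ0 ∧ ρ1 ≤ ρ2 :=
    ⟨min ρ0 ρ2, lt_min hρ0 hρ2, min_le_left _ _, min_le_right _ _⟩
  have hpr : ∀ z η, dist z p < ρ1 → dist η p' < ρ1 → dist (prj e t (z, η)) p < ρ0 := by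
    intro z η hz hη
    refine hball2 (z, η) ?_
    rw [Metric.mem_ball, Prod.dist_eq]
    exact max_lt (hz.trans_le hρ12) (hη.trans_le hρ12)
  obtain ⟨z3, hz3, hz3D, hz30, η2, hη2⟩ := geo (by omega) H p p' hp h0 e' he' ρ1 hρ1
  have hcont : Tendsto (fun w : X × Y × Y => (w.1, w.2.1, prj e t (z3, w.2.2))) (𝓝 (p, p', p'))
      (𝓝 (p, p', z3)) := by
    have h1 : Tendsto (fun w : X × Y × Y => (z3, w.2.2)) (𝓝 (p, p', p')) (𝓝 (z3, p')) := by
      have : Continuous (fun w : X × Y × Y => (z3, w.2.2)) := by fun_prop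
      exact this.tendsto (p, p', p')
    have h2 := (H.prj_analytic hz3D).continuousAt.tendsto
    rw [H.prj_eq hz3D hz30] at h2
    refine Tendsto.prodMk_nhds (continuous_fst.tendsto (p, p', p')) (Tendsto.prodMk_nhds ?_ (h2.comp h1))
    have : Continuous (fun w : X × Y × Y => w.2.1) := by fun_prop
    exact this.tendsto (p, p', p')
  obtain ⟨δ0, hδ0, hball3⟩ := Metric.eventually_nhds_iff_ball.1 (hcont.eventually hη2.eventually_nhds)
  refine ⟨min δ0 ρ1, lt_min hδ0 hρ1, ?_⟩
  intro q q' hq hq' hqq F0 G0 hF0 hF0i hG0 hG0n hrel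
  set δ := min δ0 ρ1 with hδ
  have hδ1 : δ ≤ ρ1 := min_le_right _ _
  -- the projection along z3
  set ζ : Y → X := fun η => prj e t (z3, η) with hζ
  set κ : Y → Y := fun η => η2 (q, q', ζ η) with hκ
  have good : ∀ η ∈ Metric.ball p' δ, ∀ᶠ w in 𝓝 (q, q', ζ η), AnalyticAt ℂ η2 w ∧
      dist (η2 w) p' < ρ1 ∧ R (w.1, η2 w) = 0 ∧
        R (w.2.2, η2 w) = 0 ∧ (R (w.1, w.2.1) = 0 → R (w.2.2, w.2.1) = 0 → η2 w = w.2.1) := by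
    intro η hη
    refine hball3 (q, q', η) ?_
    rw [Metric.mem_ball, Prod.dist_eq, Prod.dist_eq]
    exact max_lt (hq.trans_le (min_le_left _ _)) (max_lt (hq'.trans_le (min_le_left _ _))
      ((Metric.mem_ball.1 hη).trans_le (min_le_left _ _)))
  have hq1 : dist q p < ρ1 := hq.trans_le hδ1
  have hq'1 : dist q' p' < ρ1 := hq'.trans_le hδ1
  have hz3η : ∀ η ∈ Metric.ball p' δ, (z3, η) ∈ D := fun η hη =>
    (hDD z3 η (hz3.trans_le hρ10) ((Metric.mem_ball.1 hη).trans_le (hδ1.trans hρ10))).1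
  have hζan : ∀ η ∈ Metric.ball p' δ, AnalyticAt ℂ ζ η := fun η hη =>
    AnalyticAt.comp (g := prj e t) (f := fun η => (z3, η)) (H.prj_analytic (hz3η η hη))
      (analyticAt_const.prod analyticAt_id)
  have hζR : ∀ η ∈ Metric.ball p' δ, R (ζ η, η) = 0 := fun η hη => H.proj _ (hz3η η hη)
  have hζd : ∀ η ∈ Metric.ball p' δ, dist (ζ η) p < ρ0 := fun η hη =>
    hpr _ _ hz3 ((Metric.mem_ball.1 hη).trans_le hδ1)
  have hκan : ∀ η ∈ Metric.ball p' δ, AnalyticAt ℂ κ η := fun η hη =>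
    AnalyticAt.comp (g := η2) (f := fun η => (q, q', ζ η)) (good η hη).self_of_nhds.1
      (analyticAt_const.prod (analyticAt_const.prod (hζan η hη)))
  have hκR : ∀ η ∈ Metric.ball p' δ, R (q, κ η) = 0 := fun η hη =>
    (good η hη).self_of_nhds.2.2.1
  have hκd : ∀ η ∈ Metric.ball p' δ, dist (κ η) p' < ρ1 := fun η hη =>
    (good η hη).self_of_nhds.2.1
  have hκR2 : ∀ η ∈ Metric.ball p' δ, R (ζ η, κ η) = 0 := fun η hη =>
    (good η hη).self_of_nhds.2.2.2.1
  have hq'b : q' ∈ Metric.ball p' δ := hq'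
  have hκq : κ q' = q' := (good q' hq'b).self_of_nhds.2.2.2.2 hqq (hζR q' hq'b)
  have hqD : (q, q') ∈ D := (hDD q q' (hq1.trans_le hρ10) (hq'1.trans_le hρ10)).1
  have hballc : IsPreconnected (Metric.ball p' δ) := by
    have := (NormedSpace.restrictScalars ℝ ℂ Y)
    letI : NormedSpace ℝ Y := NormedSpace.restrictScalars ℝ ℂ Y
    exact (convex_ball p' δ).isPreconnected
  -- Step 1
  let K1 : Set (X × Y) := (fun η => (q, κ η)) '' Metric.ball p' δ
  have hK1 : IsPreconnected K1 := hballc.image _ (fun η hη =>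
    (continuousAt_const.prodMk (hκan η hη).continuousAt).continuousWithinAt)
  have hK1D : K1 ⊆ D := by
    rintro _ ⟨η, hη, rfl⟩
    exact (hDD q (κ η) (hq1.trans_le hρ10) ((hκd η hη).trans_le hρ10)).1
  have hqK1 : (q, q') ∈ K1 := ⟨q', hq'b, by simp only [hκq]⟩
  let G1 : Y → Fin (n + 2) → ℂ := fun η => ghat F0 e b t (prj e t (q, η), η)
  have step1 : ∀ η ∈ Metric.ball p' δ, AnalyticAt ℂ G1 (κ η) ∧ Imm G1 (κ η) ∧
      SRel R F0 G1 (q, κ η) := by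
    intro η hη
    have hmem : (q, κ η) ∈ K1 := ⟨η, hη, rfl⟩
    have hD := hK1D hmem
    refine ext_lemma hX hb H K1 hK1 hK1D ?_ ?_ ?_ (q, q') hqK1 hG0 hG0n hrel (q, κ η) hmem
      (fun η => prj e t (q, η)) ?_ ?_ ?_
    · rintro _ ⟨η, hη, rfl⟩; exact hκR η hη
    · rintro _ ⟨η, hη, rfl⟩; exact hF0
    · rintro _ ⟨η, hη, rfl⟩; exact hF0i
    · exact AnalyticAt.comp (g := prj e t) (f := fun η => (q, η)) (H.prj_analytic hD)
        (analyticAt_const.prod analyticAt_id)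
    · exact H.prj_eq hD (hκR η hη)
    · have hc : Continuous (fun η : Y => (q, η)) := by fun_prop
      filter_upwards [(hc.tendsto (κ η)).eventually (H.op.mem_nhds hD)] with y hy
      exact H.proj _ hy
  have hG1 := step1 q' hq'b
  rw [hκq] at hG1
  have prop1 : ∀ᶠ η in 𝓝 q', ∃ c : ℂ, G1 η = c • G0 η := by
    have h1 := ghat_prop hX hb H hqD hF0 hF0i hG0 hG0n hrel
    have hc : Continuous (fun η : Y => (q, η)) := by fun_prop
    have h2 := (H.prj2_tendsto hqD hqq).comp (hc.tendsto q')
    filter_upwards [h2.eventually h1, (hc.tendsto q').eventually (H.op.mem_nhds hqD)] with η h3 h4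
    exact h3 (H.proj _ h4)
  -- Step 2
  let K2a : Set (Y × X) := (fun z => (q', prj e t (z, q'))) '' (Metric.ball p ρ1)
  let K2b : Set (Y × X) := (fun η => (κ η, ζ η)) '' Metric.ball p' δ
  have hballc2 : IsPreconnected (Metric.ball p ρ1) := by
    letI : NormedSpace ℝ X := NormedSpace.restrictScalars ℝ ℂ X
    exact (convex_ball p ρ1).isPreconnected
  have hzD : ∀ z ∈ Metric.ball p ρ1, (z, q') ∈ D := fun z hz =>
    (hDD z q' ((Metric.mem_ball.1 hz).trans_le hρ10) (hq'1.trans_le hρ10)).1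
  have hK2 : IsPreconnected (K2a ∪ K2b) := by
    refine IsPreconnected.union (q', prj e t (z3, q')) ⟨z3, hz3, rfl⟩ ⟨q', hq'b, ?_⟩ ?_ ?_
    · simp only [hκq, hζ]
    · refine hballc2.image _ fun z hz => ContinuousAt.continuousWithinAt ?_
      have : ContinuousAt (fun z : X => prj e t (z, q')) z :=
        ContinuousAt.comp (g := prj e t) (f := fun z : X => (z, q'))
          (H.prj_analytic (hzD z hz)).continuousAt (by fun_prop)
      exact continuousAt_const.prodMk this
    · exact hballc.image _ fun η hη => ContinuousAt.continuousWithinAt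
        ((hκan η hη).continuousAt.prodMk (hζan η hη).continuousAt)
  have hK2D : K2a ∪ K2b ⊆ D' := by
    rintro _ (⟨z, hz, rfl⟩ | ⟨η, hη, rfl⟩)
    · exact (hDD _ _ (hpr z q' hz hq'1) (hq'1.trans_le hρ10)).2
    · exact (hDD _ _ (hζd η hη) ((hκd η hη).trans_le hρ10)).2
  have hqK2 : (q', q) ∈ K2a ∪ K2b := by
    refine Or.inl ⟨q, hq1, ?_⟩
    simp only [H.prj_eq hqD hqq]
  have hrel1 : SRel (fun y : Y × X => R (y.2, y.1)) G1 F0 (q', q) := hG1.2.2.swap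
  let F1 : X → Fin (n + 2) → ℂ := fun z => ghat G1 e' b' s (η2 (q, q', z), z)
  have step2 : ∀ η ∈ Metric.ball p' δ, AnalyticAt ℂ F1 (ζ η) ∧ Imm F1 (ζ η) ∧
      SRel (fun y : Y × X => R (y.2, y.1)) G1 F1 (κ η, ζ η) := by
    intro η hη
    have hmem : (κ η, ζ η) ∈ K2a ∪ K2b := Or.inr ⟨η, hη, rfl⟩
    have hcz : Continuous (fun z : X => (q, q', z)) := by fun_prop
    refine ext_lemma hY hb' H' (K2a ∪ K2b) hK2 hK2D ?_ ?_ ?_ (q', q) hqK2 hF0 hF0i.ne_zero hrel1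
      (κ η, ζ η) hmem (fun z => η2 (q, q', z)) ?_ rfl ?_
    · rintro _ (⟨z, hz, rfl⟩ | ⟨η, hη, rfl⟩)
      · exact H.proj _ (hzD z hz)
      · exact hκR2 η hη
    · rintro _ (⟨z, hz, rfl⟩ | ⟨η, hη, rfl⟩)
      · exact hG1.1
      · exact (step1 η hη).1
    · rintro _ (⟨z, hz, rfl⟩ | ⟨η, hη, rfl⟩)
      · exact hG1.2.1
      · exact (step1 η hη).2.1
    · exact AnalyticAt.comp (g := η2) (f := fun z => (q, q', z)) (good η hη).self_of_nhds.1
        (analyticAt_const.prod (analyticAt_const.prod analyticAt_id))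
    · filter_upwards [(hcz.tendsto (ζ η)).eventually (good η hη)] with z hz
      exact hz.2.2.2.1
  -- Step 3
  let K3 : Set (X × Y) := (fun η => (ζ η, η)) '' Metric.ball p' δ
  have hK3 : IsPreconnected K3 := hballc.image _ (fun η hη =>
    ((hζan η hη).continuousAt.prodMk continuousAt_id).continuousWithinAt)
  have hK3D : K3 ⊆ D := by
    rintro _ ⟨η, hη, rfl⟩
    exact (hDD _ _ (hζd η hη) ((Metric.mem_ball.1 hη).trans_le (hδ1.trans hρ10))).1
  have hqK3 : (ζ q', q') ∈ K3 := ⟨q', hq'b, rfl⟩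
  have hrel2 : SRel R F1 G1 (ζ q', q') := by
    have := (step2 q' hq'b).2.2
    rw [hκq] at this
    exact this.unswap
  let Gt : Y → Fin (n + 2) → ℂ := fun η => ghat F1 e b t (ζ η, η)
  refine ⟨Gt, ?_, ?_⟩
  · intro η hη
    have hmem : (ζ η, η) ∈ K3 := ⟨η, hη, rfl⟩
    have := ext_lemma hX hb H K3 hK3 hK3D (F := F1) (G0 := G1) ?_ ?_ ?_ (ζ q', q') hqK3 hG1.1
      hG1.2.1.ne_zero hrel2 (ζ η, η) hmem ζ (hζan η hη) rfl ?_
    · exact ⟨this.1, this.2.1⟩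
    · rintro _ ⟨η, hη, rfl⟩; exact hζR η hη
    · rintro _ ⟨η, hη, rfl⟩; exact (step2 η hη).1
    · rintro _ ⟨η, hη, rfl⟩; exact (step2 η hη).2.1
    · filter_upwards [Metric.isOpen_ball.mem_nhds hη] with y hy using hζR y hy
  · have h1 := ghat_prop hX hb H (hK3D hqK3) (step2 q' hq'b).1 (step2 q' hq'b).2.1 hG1.1
      hG1.2.1.ne_zero hrel2
    have h2 : Tendsto (fun η => (ζ η, η)) (𝓝 q') (𝓝 (ζ q', q')) :=
      ((hζan q' hq'b).continuousAt.prodMk continuousAt_id).tendsto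
    filter_upwards [h2.eventually h1, prop1, Metric.isOpen_ball.mem_nhds hq'b] with η h3 h4 h5
    obtain ⟨c, hc⟩ := h3 (hζR η h5)
    obtain ⟨c', hc'⟩ := h4
    refine ⟨c * c', ?_⟩
    change ghat F1 e b t (ζ η, η) = _
    rw [hc, mul_smul, ← hc']
end loc

theorem fderiv_diag_real {N : ℕ} (r : (Fin N → ℂ) → ℝ) (R : (Fin N → ℂ) × (Fin N → ℂ) → ℂ)
    (p : Fin N → ℂ) (hr : AnalyticAt ℝ r p) (hR : AnalyticAt ℂ R (p, star p))
    (hrR : ∀ᶠ z in 𝓝 p, R (z, star z) = r z) (v : Fin N → ℂ) :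
    fderiv ℂ R (p, star p) (v, star v) = (fderiv ℝ r p v : ℂ) := by
  rw [← real_fderiv_diag (fun x => (r x : ℂ)) R p hR hrR v]
  have h1 := (Complex.ofRealCLM.hasFDerivAt (x := r p)).comp p hr.differentiableAt.hasFDerivAt
  have h2 : fderiv ℝ (fun x => (r x : ℂ)) p = Complex.ofRealCLM.comp (fderiv ℝ r p) := h1.fderiv
  rw [h2]; rfl

theorem polarize {N : ℕ} (r : (Fin N → ℂ) → ℝ) (R : (Fin N → ℂ) × (Fin N → ℂ) → ℂ)
    (p : Fin N → ℂ) (hr : AnalyticAt ℝ r p) (hR : AnalyticAt ℂ R (p, star p))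
    (hrR : ∀ᶠ z in 𝓝 p, R (z, star z) = r z) (h0 : r p = 0) (hd : fderiv ℝ r p ≠ 0)
    (K : (Fin N → ℂ) × (Fin N → ℂ) → ℂ) (hK : AnalyticAt ℂ K (p, star p))
    (hz : ∀ᶠ z in 𝓝 p, r z = 0 → K (z, star z) = 0) :
    ∀ᶠ x in 𝓝 (p, star p), R x = 0 → K x = 0 := by
  obtain ⟨e, he⟩ : ∃ e, fderiv ℝ r p e ≠ 0 := by
    by_contra! h
    exact hd (ContinuousLinearMap.ext h)
  have hRe := fderiv_diag_real r R p hr hR hrR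
  have hRp : R (p, star p) = 0 := by rw [hrR.self_of_nhds, h0]; simp
  -- complex projection
  let L : (((Fin N → ℂ) × (Fin N → ℂ)) × ℂ) →L[ℂ] ((Fin N → ℂ) × (Fin N → ℂ)) :=
    ContinuousLinearMap.fst ℂ _ _ + (ContinuousLinearMap.snd ℂ _ _).smulRight (e, star e)
  have hL : ∀ x, L x = (x.1.1 + x.2 • e, x.1.2 + x.2 • star e) := fun x => by
    simp [L, Prod.ext_iff]
  have hL0 : L ((p, star p), 0) = (p, star p) := by simp [hL]
  have hRL : AnalyticAt ℂ R (L ((p, star p), 0)) := by rw [hL0]; exact hR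
  have hfC : AnalyticAt ℂ (fun x => R (L x)) ((p, star p), (0 : ℂ)) :=
    hRL.comp (L.analyticAt _)
  obtain ⟨g, hg, hg0, hgu, hgz⟩ := an_ift (𝕜 := ℂ) (fun x => R (L x)) (p, star p) (0 : ℂ) hfC
    (by simp only [hL0]; exact hRp) (by
      have h1 : fderiv ℂ (fun x => R (L x)) ((p, star p), (0 : ℂ)) =
          (fderiv ℂ R (L ((p, star p), 0))).comp L :=
        (hRL.differentiableAt.hasFDerivAt.comp _ L.hasFDerivAt).fderiv
      have h2 : ∀ y : ℂ, fderiv ℂ (fun x => R (L x)) ((p, star p), (0 : ℂ)) (0, y)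
          = y * (fderiv ℝ r p e : ℂ) := fun y => by
        rw [h1, hL0, ContinuousLinearMap.comp_apply, hL]
        have : ((0 : (Fin N → ℂ) × (Fin N → ℂ)).1 + y • e,
          (0 : (Fin N → ℂ) × (Fin N → ℂ)).2 + y • star e) = y • (e, star e) := by simp
        simp only [this]
        rw [map_smul, hRe, smul_eq_mul]
      simp only [h2]
      have he' : (fderiv ℝ r p e : ℂ) ≠ 0 := by exact_mod_cast he
      exact mulRight_bijective₀ _ he')
  -- real projection
  let S : ((Fin N → ℂ) × ℝ) →L[ℝ] (Fin N → ℂ) :=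
    ContinuousLinearMap.fst ℝ _ _ + (ContinuousLinearMap.snd ℝ _ _).smulRight e
  have hS : ∀ x, S x = x.1 + x.2 • e := fun x => by simp [S]
  have hS0 : S (p, 0) = p := by simp [hS]
  have hrS : AnalyticAt ℝ r (S (p, 0)) := by rw [hS0]; exact hr
  obtain ⟨k, hk, hk0, -, hkz⟩ := an_ift (𝕜 := ℝ) (fun x => r (S x)) p (0 : ℝ)
    (hrS.comp (S.analyticAt _)) (by simp only [hS0]; exact h0) (by
      have h1 : fderiv ℝ (fun x => r (S x)) (p, (0 : ℝ)) = (fderiv ℝ r (S (p, 0))).comp S :=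
        (hrS.differentiableAt.hasFDerivAt.comp _ S.hasFDerivAt).fderiv
      have h2 : ∀ y : ℝ, fderiv ℝ (fun x => r (S x)) (p, (0 : ℝ)) (0, y) 
          = y * fderiv ℝ r p e := fun y => by
        rw [h1, hS0, ContinuousLinearMap.comp_apply, hS]
        simp
      simp only [h2]
      exact mulRight_bijective₀ _ he)
  -- composite
  let Q : (Fin N → ℂ) × (Fin N → ℂ) → ℂ := fun x => K (L (x, g x))
  have hQ : AnalyticAt ℂ Q (p, star p) := by
    have hKL : AnalyticAt ℂ K (L ((p, star p), g (p, star p))) := by rw [hg0, hL0]; exact hK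
    have h1 : AnalyticAt ℂ (fun x => (x, g x)) (p, star p) := analyticAt_id.prod hg
    have h2 : AnalyticAt ℂ (fun x => L (x, g x)) (p, star p) :=
      AnalyticAt.comp (g := L) (f := fun x => (x, g x)) (L.analyticAt _) h1
    exact AnalyticAt.comp (g := K) (f := fun x => L (x, g x)) hKL h2
  have hcS : Tendsto (fun z => S (z, k z)) (𝓝 p) (𝓝 p) := by
    have : ContinuousAt (fun z => S (z, k z)) p :=
      S.continuous.continuousAt.comp (continuousAt_id.prodMk hk.continuousAt)
    have h3 := this.tendsto
    simp only [hk0, hS0] at h3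
    exact h3
  have hcD : Tendsto (fun z => ((z, star z), (k z : ℂ))) (𝓝 p) (𝓝 ((p, star p), 0)) := by
    have h1 : ContinuousAt (fun z : Fin N → ℂ => (z, star z)) p := by fun_prop
    have : ContinuousAt (fun z => ((z, star z), (k z : ℂ))) p :=
      h1.prodMk (Complex.continuous_ofReal.continuousAt.comp hk.continuousAt)
    have h3 := this.tendsto
    simp only [hk0, Complex.ofReal_zero] at h3
    exact h3
  have hdiag : ∀ᶠ z in 𝓝 p, Q (z, star z) = 0 := by
    filter_upwards [hkz, hcS.eventually hrR, hcS.eventually hz, hcD.eventually hgu]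
      with z h1 h2 h3 h4
    have hl : L ((z, star z), (k z : ℂ)) = (S (z, k z), star (S (z, k z))) := by
      rw [hL, hS]
      simp
    have h5 : g (z, star z) = (k z : ℂ) := by
      apply h4.1
      simp only [hl]
      rw [h2, h1]; simp
    simp only [Q, h5, hl]
    exact h3 h1
  have hev := totally_real Q p hQ hdiag
  have hc0 : Tendsto (fun x : (Fin N → ℂ) × (Fin N → ℂ) => (x, (0 : ℂ))) (𝓝 (p, star p))
      (𝓝 ((p, star p), 0)) := by
    have : Continuous (fun x : (Fin N → ℂ) × (Fin N → ℂ) => (x, (0 : ℂ))) := by fun_prop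
    exact this.tendsto _
  filter_upwards [hev, hc0.eventually hgu] with x h1 h2 h3
  have h4 : L (x, 0) = x := by simp [hL]
  have h5 : g x = 0 := h2.1 (by simp only [h4]; exact h3)
  simpa only [Q, h5, h4] using h1

theorem spans_exists {n : ℕ} (e : Fin (n + 1) → ℂ) (he : e ≠ 0) :
    ∃ b : Fin n → (Fin (n + 1) → ℂ), Spans e b := by
  obtain ⟨i, hi⟩ := Function.ne_iff.1 he
  simp only [Pi.zero_apply] at hi
  refine ⟨fun j => Pi.single (i.succAbove j) 1, fun v => ⟨v i / e i, fun j =>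
    v (i.succAbove j) - v i / e i * e (i.succAbove j), ?_⟩⟩
  ext m
  rcases Fin.eq_self_or_eq_succAbove i m with h | ⟨j, h⟩
  · subst h
    simp [Finset.sum_apply, hi, Pi.single_apply, Fin.ne_succAbove]
  · subst h
    simp [Finset.sum_apply, Pi.single_apply]

/-- middle coordinate -/
abbrev mid {n : ℕ} (α : Fin n) : Fin (n + 2) := (Fin.castSucc α).succ
/-- last coordinate -/
abbrev lst (n : ℕ) : Fin (n + 2) := (Fin.last n).succ

theorem vec_cases {n : ℕ} {P : Fin (n + 2) → Prop} (h0 : P 0) (hm : ∀ α : Fin n, P (mid α))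
    (hl : P (lst n)) (i : Fin (n + 2)) : P i := by
  induction i using Fin.cases with
  | zero => exact h0
  | succ i =>
    induction i using Fin.lastCases with
    | last => exact hl
    | cast i => exact hm i

/-- block antidiagonal linear maps -/
noncomputable def Jm {n : ℕ} (a b : ℂ) (s : Fin n → ℂ) :
    (Fin (n + 2) → ℂ) →L[ℂ] (Fin (n + 2) → ℂ) :=
  LinearMap.toContinuousLinearMap
    { toFun := fun Y => Fin.cons (a * Y (lst n))
        (Fin.snoc (α := fun _ => ℂ) (fun α => - s α * Y (mid α)) (b * Y 0))
      map_add' := fun x y => by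
        funext i
        induction i using vec_cases <;> simp <;> ring
      map_smul' := fun c x => by
        funext i
        induction i using vec_cases <;> simp <;> ring }

section
variable {n : ℕ} (a b : ℂ) (s : Fin n → ℂ) (Y : Fin (n + 2) → ℂ)
theorem Jm_zero : Jm a b s Y 0 = a * Y (lst n) := by simp [Jm]
theorem Jm_mid (α : Fin n) : Jm a b s Y (mid α) = - s α * Y (mid α) := by simp [Jm]
theorem Jm_lst : Jm a b s Y (lst n) = b * Y 0 := by simp [Jm]

theorem Jm_Jm (a' b' : ℂ) (s' : Fin n → ℂ) (h1 : a * b' = 1) (h2 : b * a' = 1)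
    (h3 : ∀ α, s α * s' α = 1) : Jm a b s (Jm a' b' s' Y) = Y := by
  funext i
  induction i using vec_cases with
  | h0 => rw [Jm_zero, Jm_lst, ← mul_assoc, h1, one_mul]
  | hm α => rw [Jm_mid, Jm_mid]; linear_combination (Y (mid α)) * h3 α
  | hl => rw [Jm_lst, Jm_zero, ← mul_assoc, h2, one_mul]

theorem dot_split (X Y : Fin (n + 2) → ℂ) :
    X ⬝ᵥ Y = X 0 * Y 0 + (∑ α : Fin n, X (mid α) * Y (mid α)) + X (lst n) * Y (lst n) := by
  rw [dotProduct, Fin.sum_univ_succ, Fin.sum_univ_castSucc]; ring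
end

/-- sign vector -/
def sg (n e : ℕ) (α : Fin n) : ℝ := if (α : ℕ) < e then (1 : ℝ) else -1

theorem sg_mul (n e : ℕ) (α : Fin n) : sg n e α * sg n e α = 1 := by
  unfold sg; split_ifs <;> norm_num

/-- homogeneous quadric form -/
noncomputable def Qf (n e : ℕ) (X : Fin (n + 2) → ℂ) : ℝ :=
  (X (lst n) * star (X 0)).im - ∑ α : Fin n, sg n e α * normSq (X (mid α))

noncomputable def JJ (n e : ℕ) := Jm (n := n) (-1 / (2 * I)) (1 / (2 * I)) (fun α => (sg n e α : ℂ))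
noncomputable def JI (n e : ℕ) := Jm (n := n) (2 * I) (-(2 * I)) (fun α => (sg n e α : ℂ))

theorem JJ_JI (n e : ℕ) (Y : Fin (n + 2) → ℂ) : JJ n e (JI n e Y) = Y := by
  apply Jm_Jm
  · field_simp
  · field_simp
  · intro α; exact_mod_cast sg_mul n e α

theorem JI_JJ (n e : ℕ) (Y : Fin (n + 2) → ℂ) : JI n e (JJ n e Y) = Y := by
  apply Jm_Jm
  · field_simp
  · field_simp
  · intro α; exact_mod_cast sg_mul n e α

theorem im_formula (A B : ℂ) : ((A * star B).im : ℂ) =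
    B * (-1 / (2 * I) * star A) + A * (1 / (2 * I) * star B) := by
  have h1 : (1 : ℂ) / (2 * I) = -I / 2 := by
    rw [div_eq_iff (by simp)]; linear_combination I_sq
  have h2 : (-1 : ℂ) / (2 * I) = I / 2 := by
    rw [div_eq_iff (by simp)]; linear_combination -I_sq
  have h3 := Complex.sub_conj (A * star B)
  rw [h1, h2]
  have h4 : (starRingEnd ℂ) (A * star B) = star A * B := by simp
  rw [h4] at h3
  push_cast at h3
  linear_combination (I / 2) * h3 + ((A * star B).im : ℂ) * I_sq

theorem Qf_dot (n e : ℕ) (X : Fin (n + 2) → ℂ) : X ⬝ᵥ JJ n e (star X) = (Qf n e X : ℂ) := by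
  rw [dot_split, JJ, Jm_zero, Jm_lst, Qf]
  simp only [Jm_mid]
  push_cast
  have h1 : ∀ α : Fin n, X (mid α) * (-(sg n e α : ℂ) * star X (mid α)) =
      - ((sg n e α : ℂ) * (normSq (X (mid α)) : ℂ)) := fun α => by
    rw [← mul_conj]; simp; ring
  simp only [h1, Finset.sum_neg_distrib]
  have h2 : ((X (lst n) * star (X 0)).im : ℂ) =
      X 0 * (-1 / (2 * I) * star X (lst n)) + X (lst n) * (1 / (2 * I) * star X 0) := by
    exact im_formula _ _
  rw [h2]; ring

theorem Qf_swap (n e : ℕ) (X : Fin (n + 2) → ℂ) : Qf n e (Jm (-1) 1 (fun _ => -1) X) = Qf n e X := by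
  unfold Qf
  simp only [Jm_zero, Jm_lst, Jm_mid]
  simp; ring

/-- Heisenberg shear -/
noncomputable def shear {n : ℕ} (e : ℕ) (j : Fin n) : 
    (Fin (n + 2) → ℂ) →L[ℂ] (Fin (n + 2) → ℂ) :=
  ContinuousLinearMap.id ℂ _ + 
    (ContinuousLinearMap.proj (R := ℂ) (φ := fun _ : Fin (n + 2) => ℂ) 0).smulRight
      (Pi.single (mid j) 1 + Pi.single (lst n) (I * sg n e j)) +
    (ContinuousLinearMap.proj (R := ℂ) (φ := fun _ : Fin (n + 2) => ℂ) (mid j)).smulRight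
      (Pi.single (lst n) (2 * I * sg n e j))

section
variable {n : ℕ} (e : ℕ) (j : Fin n) (X : Fin (n + 2) → ℂ)
theorem mid_ne_lst (α : Fin n) : mid α ≠ lst n := by
  intro h
  exact (Fin.castSucc_lt_last α).ne (Fin.succ_injective _ h)
theorem shear_zero : shear e j X 0 = X 0 := by
  simp [shear, (Fin.succ_ne_zero _).symm]
theorem shear_mid (α : Fin n) : shear e j X (mid α) = X (mid α) + if α = j then X 0 else 0 := by
  have h2 : mid α ≠ lst n := mid_ne_lst α
  simp [shear, h2, Pi.single_apply]
theorem shear_lst : shear e j X (lst n) = 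
    X (lst n) + I * sg n e j * X 0 + 2 * I * sg n e j * X (mid j) := by
  have h2 : lst n ≠ mid j := (mid_ne_lst j).symm
  simp [shear, h2, Pi.single_apply]; ring

theorem shear_inj (h : shear e j X = 0) : X = 0 := by
  have h0 : X 0 = 0 := by rw [← shear_zero e j X, h]; rfl
  have hm : ∀ α, X (mid α) = 0 := fun α => by
    have := congrFun h (mid α)
    rw [shear_mid, h0] at this; simpa using this
  funext i
  induction i using vec_cases with
  | h0 => exact h0
  | hm α => exact hm α
  | hl => 
    have := congrFun h (lst n)
    rw [shear_lst, h0, hm] at this; simpa using this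

theorem Qf_shear : Qf n e (shear e j X) = Qf n e X := by
  unfold Qf
  simp only [shear_zero, shear_lst, shear_mid]
  have h1 : ∀ α : Fin n, sg n e α * normSq (X (mid α) + if α = j then X 0 else 0) =
      sg n e α * normSq (X (mid α)) +
        if α = j then sg n e j * (normSq (X 0) + 2 * (X (mid j) * star (X 0)).re) else 0 := by
    intro α
    split_ifs with h
    · subst h; rw [normSq_add]; simp; ring
    · simp
  simp only [h1, Finset.sum_add_distrib]
  simp [normSq_apply]
  ring
end

theorem normalize_vec {n : ℕ} (e : ℕ) (X : Fin (n + 2) → ℂ) (hX : X ≠ 0) :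
    ∃ T : (Fin (n + 2) → ℂ) →L[ℂ] (Fin (n + 2) → ℂ), (∀ Y, T Y = 0 → Y = 0) ∧
      (∀ Y, Qf n e (T Y) = Qf n e Y) ∧ T X 0 ≠ 0 := by
  let W := Jm (n := n) (-1) 1 (fun _ => -1)
  have hW : ∀ Y, W Y = 0 → Y = 0 := fun Y h => by
    have := Jm_Jm (n := n) 1 (-1) (fun _ => -1) Y (-1) 1 (fun _ => -1) (by simp) (by simp) (by simp)
    change Jm 1 (-1) _ (W Y) = Y at this
    rw [← this, h, map_zero]
  by_cases h0 : X 0 = 0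
  · by_cases hl : X (lst n) = 0
    · obtain ⟨j, hj⟩ : ∃ j : Fin n, X (mid j) ≠ 0 := by
        by_contra! h
        exact hX (funext fun i => by
          induction i using vec_cases with
          | h0 => exact h0
          | hm α => exact h α
          | hl => exact hl)
      refine ⟨W.comp (shear e j), fun Y h => shear_inj e j Y (hW _ h), fun Y => ?_, ?_⟩
      · rw [ContinuousLinearMap.comp_apply, Qf_swap, Qf_shear]
      · rw [ContinuousLinearMap.comp_apply, Jm_zero, shear_lst, h0, hl]
        have : (sg n e j : ℂ) ≠ 0 := by
          unfold sg; split_ifs <;> simp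
        simp [hj, this]
    · exact ⟨W, hW, Qf_swap n e, by rw [Jm_zero]; simpa using hl⟩
  · exact ⟨ContinuousLinearMap.id ℂ _, fun Y h => h, fun Y => rfl, h0⟩

theorem an_comp_at {X Y Z : Type*} [NormedAddCommGroup X] [NormedSpace ℂ X]
    [NormedAddCommGroup Y] [NormedSpace ℂ Y] [NormedAddCommGroup Z] [NormedSpace ℂ Z]
    {g : Y → Z} {f : X → Y} {x : X} (hg : AnalyticAt ℂ g (f x)) (hf : AnalyticAt ℂ f x) :
    AnalyticAt ℂ (fun x => g (f x)) x := hg.comp hf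

theorem finish_aux {n : ℕ} (M : Set (Fin (n + 1) → ℂ)) (p : Fin (n + 1) → ℂ) (e : ℕ) (hen : e ≤ n)
    (F : (Fin (n + 1) → ℂ) → (Fin (n + 2) → ℂ)) (hF : AnalyticAt ℂ F p) (hI : Imm F p)
    (hQ : ∀ᶠ z in 𝓝 p, z ∈ M → Qf n e (F z) = 0) (h0 : F p 0 ≠ 0) : IsSphericalPt n M p := by
  have hFi : ∀ i, AnalyticAt ℂ (fun z => F z i) p := fun i =>
    an_comp_at (g := fun v : Fin (n + 2) → ℂ => v i)
      ((ContinuousLinearMap.proj (R := ℂ) (φ := fun _ : Fin (n + 2) => ℂ) i).analyticAt _) hF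
  let φ : (Fin (n + 1) → ℂ) → (Fin (n + 1) → ℂ) := fun z j => F z j.succ / F z 0
  have hφ : AnalyticAt ℂ φ p := by
    rw [analyticAt_pi_iff]
    exact fun j => (hFi _).div (hFi 0) h0
  have hne : ∀ᶠ z in 𝓝 p, F z 0 ≠ 0 := (hFi 0).continuousAt.eventually_ne h0
  have hFd : ∀ i h, fderiv ℂ (fun z => F z i) p h = fderiv ℂ F p h i := fun i h => by
    rw [fderiv_apply hF.differentiableAt]; rfl
  have hφd : ∀ j h, fderiv ℂ (fun z => φ z j) p h = fderiv ℂ φ p h j := fun i h => by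
    rw [fderiv_apply hφ.differentiableAt]; rfl
  have hinj : ∀ h, fderiv ℂ φ p h = 0 → h = 0 := by
    intro h hh
    have key : fderiv ℂ F p h + (-(fderiv ℂ F p h 0 / F p 0)) • F p = 0 := by
      funext i
      induction i using Fin.cases with
      | zero => simp; field_simp; simp
      | succ j =>
        have h1 : (fun z => F z j.succ) =ᶠ[𝓝 p] fun z => F z 0 * φ z j := by
          filter_upwards [hne] with z hz
          simp only [φ]; field_simp
        have h2 := h1.fderiv_eq (𝕜 := ℂ)
        have hφj : DifferentiableAt ℂ (fun z => φ z j) p :=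
          ((analyticAt_pi_iff.1 hφ) j).differentiableAt
        rw [fderiv_fun_mul (hFi 0).differentiableAt hφj] at h2
        have h3 := congrArg (fun L => L h) h2
        simp only [ContinuousLinearMap.add_apply, ContinuousLinearMap.smul_apply, hFd, hφd, hh,
          Pi.zero_apply, smul_eq_mul, mul_zero, zero_add] at h3
        simp only [Pi.add_apply, Pi.smul_apply, Pi.zero_apply, smul_eq_mul, h3, φ]
        field_simp; simp
    exact (hI h _ key).1
  let f : (Fin (n + 1) → ℂ) × (Fin (n + 1) → ℂ) → (Fin (n + 1) → ℂ) := fun v => φ v.2 - v.1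
  have hf : AnalyticAt ℂ f (φ p, p) :=
    (an_comp_at (g := φ) (f := Prod.snd) (x := (φ p, p)) hφ analyticAt_snd).sub analyticAt_fst
  obtain ⟨g, hg, hg0, hgu, hgz⟩ := an_ift (𝕜 := ℂ) f (φ p) p hf (by simp [f]) (by
    have h1 : fderiv ℂ f (φ p, p) = (fderiv ℂ φ p).comp (ContinuousLinearMap.snd ℂ _ _) -
        ContinuousLinearMap.fst ℂ _ _ := by
      have a1 : HasFDerivAt (fun v : (Fin (n + 1) → ℂ) × (Fin (n + 1) → ℂ) => φ v.2) 
          ((fderiv ℂ φ p).comp (ContinuousLinearMap.snd ℂ _ _)) (φ p, p) :=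
        HasFDerivAt.comp (g := φ) (f := Prod.snd) (φ p, p) 
          hφ.differentiableAt.hasFDerivAt hasFDerivAt_snd
      exact (a1.sub hasFDerivAt_fst).fderiv
    have h2 : (fun y => fderiv ℂ f (φ p, p) (0, y)) = fderiv ℂ φ p := by
      funext y; rw [h1]; simp
    rw [h2]
    have hi : Function.Injective (fderiv ℂ φ p) :=
      (injective_iff_map_eq_zero _).2 hinj
    exact ⟨hi, (LinearMap.injective_iff_surjective (f := (fderiv ℂ φ p).toLinearMap)).1 hi⟩)
  have hgφ : ∀ᶠ z in 𝓝 p, g (φ z) = z := by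
    have : Tendsto (fun z => (φ z, z)) (𝓝 p) (𝓝 (φ p, p)) :=
      hφ.continuousAt.prodMk continuousAt_id
    filter_upwards [this.eventually hgu] with z hz
    exact hz.1 (by simp [f])
  have hφg : ∀ᶠ y in 𝓝 (φ p), φ (g y) = y := by
    filter_upwards [hgz] with y hy
    exact sub_eq_zero.1 hy
  obtain ⟨A, hA, hAo, hpA⟩ := eventually_nhds_iff.1
    (hφ.eventually_analyticAt.and (hgφ.and (hne.and hQ)))
  have hgc : Tendsto g (𝓝 (φ p)) (𝓝 p) := by
    have := hg.continuousAt.tendsto; rwa [hg0] at this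
  obtain ⟨B, hB, hBo, hpB⟩ := eventually_nhds_iff.1
    (hg.eventually_analyticAt.and (hφg.and (hgc.eventually (hAo.mem_nhds hpA))))
  have hco : ContinuousOn φ A := fun z hz => (hA z hz).1.continuousAt.continuousWithinAt
  have him : φ '' (A ∩ φ ⁻¹' B) = B := by
    ext y; constructor
    · rintro ⟨z, hz, rfl⟩; exact hz.2
    · intro hy
      have h1 := (hB y hy).2.1
      exact ⟨g y, ⟨(hB y hy).2.2, by rw [Set.mem_preimage, h1]; exact hy⟩, h1⟩
  refine ⟨A ∩ φ ⁻¹' B, φ, e, hen, hco.isOpen_inter_preimage hAo hBo, ⟨hpA, hpB⟩,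
    fun z hz => (hA z hz.1).1, ?_, by rw [him]; exact hBo, ⟨g, ?_, fun z hz => (hA z hz.1).2.1⟩, ?_⟩
  · intro x hx y hy hxy
    rw [← (hA x hx.1).2.1, ← (hA y hy.1).2.1, hxy]
  · rw [him]; exact fun y hy => (hB y hy).1
  · rintro _ ⟨z, ⟨⟨hzA, _⟩, hzM⟩, rfl⟩
    obtain ⟨-, -, hz0, hzQ⟩ := hA z hzA
    have hq := hzQ hzM
    have hN : normSq (F z 0) ≠ 0 := by simpa using hz0
    change (φ z (Fin.last n)).im = ∑ α : Fin n, sg n e α * normSq (φ z α.castSucc)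
    have h1 : ∀ α : Fin n, normSq (φ z α.castSucc) = normSq (F z (mid α)) / normSq (F z 0) :=
      fun α => by simp only [φ]; rw [normSq_div]
    have h2 : (φ z (Fin.last n)).im = (F z (lst n) * star (F z 0)).im / normSq (F z 0) := by
      have : φ z (Fin.last n) = (F z (lst n) * star (F z 0)) * ((1 / normSq (F z 0) : ℝ) : ℂ) := by
        simp only [φ]
        push_cast
        rw [← mul_conj]
        have : (starRingEnd ℂ) (F z 0) ≠ 0 := by simpa using hz0
        change _ = F z (lst n) * (starRingEnd ℂ) (F z 0) * _
        field_simp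
      rw [this, im_mul_ofReal]; ring
    rw [h2]
    simp only [h1, mul_div_assoc', ← Finset.sum_div]
    rw [sub_eq_zero.1 hq]

theorem finish {n : ℕ} (M : Set (Fin (n + 1) → ℂ)) (p : Fin (n + 1) → ℂ) (e : ℕ) (hen : e ≤ n)
    (F : (Fin (n + 1) → ℂ) → (Fin (n + 2) → ℂ)) (hF : AnalyticAt ℂ F p) (hI : Imm F p)
    (hQ : ∀ᶠ z in 𝓝 p, z ∈ M → Qf n e (F z) = 0) : IsSphericalPt n M p := by
  have hne : F p ≠ 0 := hI.ne_zero
  obtain ⟨T, hT, hTQ, hT0⟩ := normalize_vec e (F p) hne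
  refine finish_aux M p e hen (fun z => T (F z)) (an_comp_at (T.analyticAt _) hF) ?_ ?_ hT0
  · intro h c hh
    have : fderiv ℂ (fun z => T (F z)) p = T.comp (fderiv ℂ F p) :=
      (T.hasFDerivAt.comp p hF.differentiableAt.hasFDerivAt).fderiv
    rw [this, ContinuousLinearMap.comp_apply, ← map_smul, ← map_add] at hh
    exact hI h c (hT _ hh)
  · filter_upwards [hQ] with z hz hm
    rw [hTQ]; exact hz hm

theorem sph_start {n : ℕ} {M : Set (Fin (n + 1) → ℂ)} {q : Fin (n + 1) → ℂ}
    (h : IsSphericalPt n M q) : ∃ e ≤ n, ∃ F : (Fin (n + 1) → ℂ) → (Fin (n + 2) → ℂ),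
      AnalyticAt ℂ F q ∧ Imm F q ∧ ∀ᶠ z in 𝓝 q, z ∈ M → Qf n e (F z) = 0 := by
  obtain ⟨U, φ, e, hen, hU, hq, hφ, -, -, ⟨ψ, hψ, hinv⟩, hsub⟩ := h
  let F : (Fin (n + 1) → ℂ) → (Fin (n + 2) → ℂ) := fun z => Fin.cons (1 : ℂ) (φ z)
  have hF : AnalyticAt ℂ F q := by
    rw [analyticAt_pi_iff]
    intro i
    induction i using Fin.cases with
    | zero => exact analyticAt_const
    | succ j => exact (analyticAt_pi_iff.1 (hφ q hq)) j
  have hFd : ∀ i h, fderiv ℂ (fun z => F z i) q h = fderiv ℂ F q h i := fun i h => by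
    rw [fderiv_apply hF.differentiableAt]; rfl
  have hφd : ∀ j h, fderiv ℂ (fun z => φ z j) q h = fderiv ℂ φ q h j := fun i h => by
    rw [fderiv_apply (hφ q hq).differentiableAt]; rfl
  refine ⟨e, hen, F, hF, ?_, ?_⟩
  · intro h c hh
    have hc : c = 0 := by
      have h1 := congrFun hh 0
      have h2 : fderiv ℂ F q h 0 = 0 := by
        rw [← hFd]
        have : (fun z => F z 0) = fun _ => (1 : ℂ) := by funext z; rfl
        rw [this]; simp
      simp only [Pi.add_apply, h2, Pi.smul_apply, Pi.zero_apply, zero_add, smul_eq_mul] at h1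
      simpa [F] using h1
    subst hc
    refine ⟨?_, rfl⟩
    have h3 : fderiv ℂ φ q h = 0 := by
      funext j
      have h1 := congrFun hh j.succ
      rw [← hφd]
      rw [zero_smul, add_zero, ← hFd] at h1
      exact h1
    have h4 : (fun z => ψ (φ z)) =ᶠ[𝓝 q] id := by
      filter_upwards [hU.mem_nhds hq] with z hz using hinv z hz
    have h5 := ((hψ _ ⟨q, hq, rfl⟩).differentiableAt.hasFDerivAt.comp q
      (hφ q hq).differentiableAt.hasFDerivAt).fderiv
    have h6 := h4.fderiv_eq (𝕜 := ℂ)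
    have h7 := congrArg (fun L => L h) (h5.symm.trans h6)
    simpa [h3] using h7.symm
  · filter_upwards [hU.mem_nhds hq] with z hz hM
    have := hsub ⟨z, ⟨hz, hM⟩, rfl⟩
    change (φ z (Fin.last n)).im = ∑ α : Fin n, sg n e α * normSq (φ z α.castSucc) at this
    unfold Qf
    rw [sub_eq_zero]
    have h1 : F z (lst n) * star (F z 0) = φ z (Fin.last n) := by
      change φ z (Fin.last n) * star (1 : ℂ) = _
      simp
    rw [h1, this]
    rfl

theorem sph_key {n : ℕ} (hn : 1 ≤ n) (M : Set (Fin (n + 1) → ℂ))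
    (hM : IsNondegHypersurface (n + 1) M) (p : Fin (n + 1) → ℂ) (hp : p ∈ M) :
    ∀ᶠ q in 𝓝 p, q ∈ M → IsSphericalPt n M q → IsSphericalPt n M p := by
  obtain ⟨V, r, hV, hpV, hr, hMV, hdr, hL⟩ := hM p hp
  have hmem : ∀ x ∈ V, (x ∈ M ↔ r x = 0) := fun x hx => by
    have : x ∈ M ∩ V ↔ x ∈ {x ∈ V | r x = 0} := by rw [hMV]
    simpa [hx] using this
  have hrp : r p = 0 := (hmem p hpV).1 hp
  obtain ⟨R, hR, hrR⟩ := complexify r p (hr p hpV)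
  have hRp : R (p, star p) = 0 := by rw [hrR.self_of_nhds, hrp]; simp
  obtain ⟨hnd, hnd'⟩ := ndr_of_levi r R p hR hrR (hL p ⟨hp, hpV⟩)
  obtain ⟨e, he⟩ : ∃ e, fderiv ℝ r p e ≠ 0 := by
    by_contra! h
    exact hdr p hpV (ContinuousLinearMap.ext h)
  have hsum : fderiv ℂ R (p, star p) (e, 0) + fderiv ℂ R (p, star p) (0, star e) =
      (fderiv ℝ r p e : ℂ) := by
    rw [← fderiv_diag_real r R p (hr p hpV) hR hrR e, ← map_add]; simp
  have hher := (hermit r R p hR hrR 0 (0, star e)).1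
  simp only [star_star, star_zero] at hher
  have heR : fderiv ℂ R (p, star p) (e, 0) ≠ 0 := by
    intro h
    rw [hher, h] at hsum
    simp at hsum
    exact he (by exact_mod_cast hsum.symm)
  have heR' : fderiv ℂ R (p, star p) (0, star e) ≠ 0 := by
    rw [hher]; exact star_ne_zero.2 heR
  have hene : e ≠ 0 := by rintro rfl; simp at he
  obtain ⟨b, hb⟩ := spans_exists e hene
  obtain ⟨b', hb'⟩ := spans_exists (star e) (star_ne_zero.2 hene)
  obtain ⟨t, D, hD, H⟩ := half_exists R e (p, star p) hR hRp heR hnd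
  obtain ⟨s, D', hD', H'⟩ := half_exists
    (fun x : (Fin (n + 1) → ℂ) × (Fin (n + 1) → ℂ) => R (x.2, x.1)) (star e) (star p, p)
    (an_comp_at (g := R) (f := fun x : (Fin (n + 1) → ℂ) × (Fin (n + 1) → ℂ) => (x.2, x.1)) hR
      (analyticAt_snd.prod analyticAt_fst)) hRp
    (by rw [fderiv_swap]; exact heR') hnd'
  obtain ⟨δ, hδ, hloc⟩ := prop_local (n := n) hn (by simp) (by simp) p (star p) hRp H hD hb H' hD' hb'
  -- a small ball
  have hev : ∀ᶠ y in 𝓝 (p, star p), y ∈ D ∧ prj e t y ∈ Metric.ball p δ ∧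
      y.2 ∈ Metric.ball (star p) δ := by
    have h1 := (H.prj2_tendsto hD hRp).eventually
      (prod_mem_nhds (Metric.ball_mem_nhds p hδ) (Metric.ball_mem_nhds (star p) hδ))
    filter_upwards [H.op.mem_nhds hD, h1] with y h2 h3
    exact ⟨h2, h3.1, h3.2⟩
  obtain ⟨ρ, hρ, hball⟩ := Metric.eventually_nhds_iff_ball.1 hev
  have hcd : Continuous (fun z : Fin (n + 1) → ℂ => (z, star z)) := by fun_prop
  have hcs : Continuous (fun z : Fin (n + 1) → ℂ => star z) := by fun_prop
  filter_upwards [hV.mem_nhds hpV, near_diag r R p hR hrR, Metric.ball_mem_nhds p hδ,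
    (hcs.tendsto p).eventually (Metric.ball_mem_nhds (star p) hδ),
    (hcd.tendsto p).eventually (Metric.ball_mem_nhds (p, star p) hρ)]
    with q hqV hqd hqδ hqδ' hqρ hqM hsph
  obtain ⟨hRq, hrRq⟩ := hqd
  have hrq : r q = 0 := (hmem q hqV).1 hqM
  have hRq0 : R (q, star q) = 0 := by rw [hrRq.self_of_nhds, hrq]; simp
  obtain ⟨m, hm, F0, hF0, hI0, hQ0⟩ := sph_start hsph
  let G0 : (Fin (n + 1) → ℂ) → (Fin (n + 2) → ℂ) := fun η => JJ n m (star (F0 (star η)))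
  have hG0 : AnalyticAt ℂ G0 (star q) := by
    have : AnalyticAt ℂ F0 (star (star q)) := by rw [star_star]; exact hF0
    exact an_comp_at ((JJ n m).analyticAt _) (conj_analytic this)
  have hG0ne : G0 (star q) ≠ 0 := by
    intro h
    have h1 := JI_JJ n m (star (F0 (star (star q))))
    change JI n m (G0 (star q)) = _ at h1
    rw [h, map_zero, star_star] at h1
    exact hI0.ne_zero (star_eq_zero.1 h1.symm)
  have hS0 : SRel R F0 G0 (q, star q) := by
    refine polarize r R q (hr q hqV) hRq hrRq hrq (hdr q hqV) (fun x => F0 x.1 ⬝ᵥ G0 x.2) ?_ ?_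
    · exact analytic_dot
        (an_comp_at (g := F0) (f := Prod.fst) (x := (q, star q)) hF0 analyticAt_fst)
        (an_comp_at (g := G0) (f := Prod.snd) (x := (q, star q)) hG0 analyticAt_snd)
    · filter_upwards [hQ0, hV.mem_nhds hqV] with z hz hzV h0
      simp only [G0, star_star]
      rw [Qf_dot, hz ((hmem z hzV).2 h0)]; simp
  obtain ⟨Gt, hGt, hGp⟩ := hloc q (star q) hqδ hqδ' hRq0 F0 G0 hF0 hI0 hG0 hG0ne hS0
  let Fp : (Fin (n + 1) → ℂ) → (Fin (n + 2) → ℂ) := fun ζ => star (JI n m (Gt (star ζ)))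
  have hstar : ∀ ζ ∈ Metric.ball p δ, star ζ ∈ Metric.ball (star p) δ := fun ζ hζ => by
    rw [Metric.mem_ball] at hζ ⊢
    rw [dist_eq_norm] at hζ ⊢
    rw [← star_sub, norm_star]; exact hζ
  have hJG : ∀ ζ ∈ Metric.ball p δ, AnalyticAt ℂ (fun η => JI n m (Gt η)) (star ζ) :=
    fun ζ hζ => an_comp_at ((JI n m).analyticAt _) (hGt _ (hstar ζ hζ)).1
  have hFp : ∀ ζ ∈ Metric.ball p δ, AnalyticAt ℂ Fp ζ := fun ζ hζ => conj_analytic (hJG ζ hζ)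
  have hpδ : p ∈ Metric.ball p δ := Metric.mem_ball_self hδ
  have hIp : Imm Fp p := by
    intro h c hh
    have h1 := conj_fderiv (hJG p hpδ) h
    change fderiv ℂ Fp p h = _ at h1
    have hGa := (hGt _ (hstar p hpδ)).1
    have h2 : fderiv ℂ (fun η => JI n m (Gt η)) (star p) =
        (JI n m).comp (fderiv ℂ Gt (star p)) :=
      ((JI n m).hasFDerivAt.comp _ hGa.differentiableAt.hasFDerivAt).fderiv
    rw [h1, h2, ContinuousLinearMap.comp_apply] at hh
    have h3 := congrArg star hh
    simp only [star_add, star_star, star_smul, star_zero, Fp] at h3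
    rw [← map_smul, ← map_add] at h3
    have h4 := congrArg (JJ n m) h3
    rw [JJ_JI, map_zero] at h4
    have h5 := (hGt _ (hstar p hpδ)).2 _ _ h4
    exact ⟨star_eq_zero.1 h5.1, star_eq_zero.1 h5.2⟩
  have hSp : SRel R Fp Gt (q, star q) := by
    have h1 : ∀ᶠ x in 𝓝 (q, star q), ∃ c : ℂ, Gt x.2 = c • G0 x.2 :=
      (continuous_snd.tendsto (q, star q)).eventually hGp
    have h2 : ∀ᶠ x in 𝓝 (q, star q), ∃ c : ℂ, Gt (star x.1) = c • G0 (star x.1) := by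
      have : Continuous (fun x : (Fin (n + 1) → ℂ) × (Fin (n + 1) → ℂ) => star x.1) := by fun_prop
      exact (this.tendsto (q, star q)).eventually hGp
    filter_upwards [hS0, h1, h2] with x hx ⟨c, hc⟩ ⟨d, hd⟩ h0
    have h3 : Fp x.1 = star d • F0 x.1 := by
      simp only [Fp]
      rw [hd, map_smul, star_smul]
      simp only [G0]
      rw [JI_JJ, star_star, star_star]
    rw [h3, hc, smul_dotProduct, dotProduct_smul, hx h0]; simp
  have hqD : (q, star q) ∈ D := (hball _ hqρ).1
  have hrel := H.rel_prj hqD hRq0 hSp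
  have hfin := an_ident (fun y => Fp (prj e t y) ⬝ᵥ Gt y.2) (Metric.ball (p, star p) ρ)
    (convex_ball _ _).isPreconnected (fun y hy => by
      obtain ⟨h1, h2, h3⟩ := hball y hy
      exact analytic_dot (an_comp_at (g := Fp) (hFp _ h2) (H.prj_analytic h1))
        (an_comp_at (g := Gt) (f := Prod.snd) (hGt _ h3).1 analyticAt_snd))
    (q, star q) hqρ hrel (p, star p) (Metric.mem_ball_self hρ)
  refine finish M p m hm Fp (hFp p hpδ) hIp ?_
  filter_upwards [(hcd.tendsto p).eventually hfin, (hcd.tendsto p).eventually (H.op.mem_nhds hD),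
    hV.mem_nhds hpV, hrR] with z h1 h2 hzV h3 hzM
  have h4 : R (z, star z) = 0 := by rw [h3, (hmem z hzV).1 hzM]; simp
  rw [H.prj_eq h2 h4] at h1
  have h5 : Gt (star z) = JJ n m (star (Fp z)) := by
    simp only [Fp, star_star, JJ_JI]
  simp only [h5] at h1
  rw [Qf_dot] at h1
  exact_mod_cast h1

theorem sph_path {n : ℕ} (hn : 1 ≤ n) (M : Set (Fin (n + 1) → ℂ))
    (hM : IsNondegHypersurface (n + 1) M) (γ : ℝ → Fin (n + 1) → ℂ)
    (hγ : ContinuousOn γ (Set.Icc 0 1)) (hγM : ∀ x ∈ Set.Icc (0 : ℝ) 1, γ x ∈ M) :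
    IsSphericalPt n M (γ 0) ↔ IsSphericalPt n M (γ 1) := by
  let P : Set.Icc (0 : ℝ) 1 → Prop := fun x => IsSphericalPt n M (γ x)
  have hc : Continuous (fun x : Set.Icc (0 : ℝ) 1 => γ x) := hγ.domRestrict
  have hloc : IsLocallyConstant P := by
    rw [IsLocallyConstant.iff_eventually_eq]
    intro x
    have h1 := (hc.tendsto x).eventually (sph_key hn M hM (γ x) (hγM x x.2))
    by_cases hx : P x
    · obtain ⟨U, φ, e, hen, hU, hq, h⟩ := hx
      filter_upwards [(hc.tendsto x).eventually (hU.mem_nhds hq)] with y hy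
      exact propext ⟨fun _ => ⟨U, φ, e, hen, hU, hq, h⟩, fun _ => ⟨U, φ, e, hen, hU, hy, h⟩⟩
    · filter_upwards [h1] with y hy
      exact propext ⟨fun h => hy (hγM y y.2) h, fun h => absurd h hx⟩
  have := hloc.apply_eq_of_preconnectedSpace ⟨0, by simp⟩ ⟨1, by simp⟩
  exact iff_of_eq this

end PinchukAux

/-- **Pinchuk.** On a nondegenerate real-analytic real hypersurface
`M ⊆ ℂ^{n+1}`, if `p, q ∈ M` are joined by a continuous path inside `M`, then `p` is
spherical iff `q` is spherical. -/
theorem stmt14 (n : ℕ) (hn : 1 ≤ n) (M : Set (Fin (n + 1) → ℂ))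
    (hM : IsNondegHypersurface (n + 1) M)
    (p q : Fin (n + 1) → ℂ) (hp : p ∈ M) (hq : q ∈ M)
    (γ : ℝ → (Fin (n + 1) → ℂ))
    (hγc : ContinuousOn γ (Set.Icc 0 1))
    (hγM : ∀ t ∈ Set.Icc (0 : ℝ) 1, γ t ∈ M)
    (hγ0 : γ 0 = p) (hγ1 : γ 1 = q) :
    IsSphericalPt n M p ↔ IsSphericalPt n M q := by
  subst hγ0 hγ1
  exact PinchukAux.sph_path hn M hM γ hγc hγM
end
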